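/- Let n ≥ 2 and let μ = f·ν be a finite complex Borel measure on S^{2n−1}. Suppose there exist ε ∈ (0,1) and a finite set F ⊆ ℤ₊² such that for every (p,q) ∈ ℤ₊² ∖ F with (p,q) ∈ κ(ε) one has π_{p,q}μ = 0. Then for every Borel set E ⊆ S^{2n−1} with H^{2n−2}(E) < ∞ and μ(E) = ∫_E f dν ≠ 0, there exists a (2n−2)-rectifiable set E_r ⊆ E such that |μ|(E ∖ E_r) = ∫_{E∖E_r} |f| dν = 0. -/

import Mathlib

open MeasureTheory Metric Set
open scoped ENNReal NNReal

noncomputable section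

instance {n : ℕ} : MeasurableSpace (EuclideanSpace ℂ (Fin n)) := borel _
instance {n : ℕ} : BorelSpace (EuclideanSpace ℂ (Fin n)) := ⟨rfl⟩

/-- The unit sphere `S^{2n−1} ⊆ ℂⁿ`. -/
def unitSphere (n : ℕ) : Set (EuclideanSpace ℂ (Fin n)) :=
  Metric.sphere 0 1

/-- The real Laplacian (in the `2n` real variables) of `P : ℂⁿ → ℂ` at `z`, computed
with respect to the orthonormal real basis `e_j, i·e_j`. -/
def cplxLaplacian {n : ℕ} (P : EuclideanSpace ℂ (Fin n) → ℂ)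
    (z : EuclideanSpace ℂ (Fin n)) : ℂ :=
  ∑ j : Fin n,
    (fderiv ℝ (fun w => fderiv ℝ P w (EuclideanSpace.single j 1)) z
        (EuclideanSpace.single j 1) +
      fderiv ℝ (fun w => fderiv ℝ P w (Complex.I • EuclideanSpace.single j 1)) z
        (Complex.I • EuclideanSpace.single j 1))

/-- `P : ℂⁿ → ℂ` is (the extension of) an element of `H(p,q)`: smooth, harmonic in the
`2n` real variables, and `(p,q)`-homogeneous: `P(λz) = λᵖ (conj λ)^q P(z)`. -/
def MemHpq (n p q : ℕ) (P : EuclideanSpace ℂ (Fin n) → ℂ) : Prop :=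
  ContDiff ℝ (⊤ : ℕ∞) P ∧ (∀ z, cplxLaplacian P z = 0) ∧
  ∀ (c : ℂ) (z : EuclideanSpace ℂ (Fin n)),
    P (c • z) = c ^ p * (starRingEnd ℂ c) ^ q * P z

/-- `π_{p,q}μ = 0` for the complex measure `μ = f·ν` on the sphere:
`∫ conj(h) dμ = 0` for every `h ∈ H(p,q)`. -/
def projPQZero {n : ℕ} (ν : Measure (EuclideanSpace ℂ (Fin n)))
    (f : EuclideanSpace ℂ (Fin n) → ℂ) (p q : ℕ) : Prop :=
  ∀ P : EuclideanSpace ℂ (Fin n) → ℂ, MemHpq n p q P →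
    ∫ z, (starRingEnd ℂ) (P z) * f z ∂ν = 0

/-- `(p,q) ∈ κ(ε) = {(x,y) ∈ (0,∞)² : 1−ε < y/x < 1/(1−ε)}`. -/
def memKappa (ε : ℝ) (p q : ℕ) : Prop :=
  0 < p ∧ 0 < q ∧ 1 - ε < (q : ℝ) / p ∧ (q : ℝ) / p < 1 / (1 - ε)

/-- The circle orbit `𝕋·E = {e^{it} z : z ∈ E, t ∈ ℝ}`. -/
def circleOrbit {n : ℕ} (E : Set (EuclideanSpace ℂ (Fin n))) :
    Set (EuclideanSpace ℂ (Fin n)) :=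
  {w | ∃ z ∈ E, ∃ t : ℝ, w = Complex.exp (t * Complex.I) • z}

/-- `R ⊆ ℂⁿ ≅ ℝ²ⁿ` is `k`-rectifiable: countably many Lipschitz images of `ℝᵏ`
cover `R` up to an `H^k`-null set. -/
def RectifiableSetC (n k : ℕ) (R : Set (EuclideanSpace ℂ (Fin n))) : Prop :=
  ∃ g : ℕ → (EuclideanSpace ℝ (Fin k) → EuclideanSpace ℂ (Fin n)),
    (∀ i, ∃ K : ℝ≥0, LipschitzWith K (g i)) ∧
    μH[(k : ℝ)] (R \ ⋃ i, Set.range (g i)) = 0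

section

open MvPolynomial in
/-- Polynomials in `z` and `conj z`. -/
abbrev Pol (n : ℕ) := MvPolynomial (Fin n ⊕ Fin n) ℂ

def wt1 (n : ℕ) : Fin n ⊕ Fin n → ℕ := Sum.elim (fun _ => 1) (fun _ => 0)
def wt2 (n : ℕ) : Fin n ⊕ Fin n → ℕ := Sum.elim (fun _ => 0) (fun _ => 1)

/-- The evaluation point. -/
def evPt {n : ℕ} (z : EuclideanSpace ℂ (Fin n)) : Fin n ⊕ Fin n → ℂ :=
  Sum.elim (fun i => z i) (fun i => (starRingEnd ℂ) (z i))

def ev {n : ℕ} (P : Pol n) (z : EuclideanSpace ℂ (Fin n)) : ℂ :=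
  MvPolynomial.eval (evPt z) P

def lapD {n : ℕ} (P : Pol n) : Pol n :=
  ∑ i : Fin n, MvPolynomial.pderiv (Sum.inl i) (MvPolynomial.pderiv (Sum.inr i) P)

def Bihom {n : ℕ} (p q : ℕ) (P : Pol n) : Prop :=
  P.IsWeightedHomogeneous (wt1 n) p ∧ P.IsWeightedHomogeneous (wt2 n) q

def HP {n : ℕ} (p q : ℕ) (P : Pol n) : Prop := Bihom p q P ∧ lapD P = 0

def Xsq (n : ℕ) : Pol n :=
  ∑ i : Fin n, MvPolynomial.X (Sum.inl i) * MvPolynomial.X (Sum.inr i)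

namespace Bihom
variable {n p q : ℕ} {P Q : Pol n}
lemma add (h : Bihom p q P) (h' : Bihom p q Q) : Bihom p q (P + Q) := ⟨h.1.add h'.1, h.2.add h'.2⟩
lemma sub (h : Bihom p q P) (h' : Bihom p q Q) : Bihom p q (P - Q) := ⟨h.1.sub h'.1, h.2.sub h'.2⟩
lemma C_mul (h : Bihom p q P) (c : ℂ) : Bihom p q (MvPolynomial.C c * P) :=
  ⟨h.1.C_mul c, h.2.C_mul c⟩
lemma zero : Bihom p q (0 : Pol n) :=
  ⟨MvPolynomial.isWeightedHomogeneous_zero _ _ _, MvPolynomial.isWeightedHomogeneous_zero _ _ _⟩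
lemma mul {p' q' : ℕ} (h : Bihom p q P) (h' : Bihom p' q' Q) : Bihom (p + p') (q + q') (P * Q) :=
  ⟨h.1.mul h'.1, h.2.mul h'.2⟩
lemma sum {ι : Type*} (s : Finset ι) (f : ι → Pol n) (h : ∀ i ∈ s, Bihom p q (f i)) :
    Bihom p q (∑ i ∈ s, f i) :=
  ⟨MvPolynomial.IsWeightedHomogeneous.sum s f _ (fun i hi => (h i hi).1),
   MvPolynomial.IsWeightedHomogeneous.sum s f _ (fun i hi => (h i hi).2)⟩
lemma Xl (i : Fin n) : Bihom 1 0 (MvPolynomial.X (Sum.inl i) : Pol n) :=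
  ⟨MvPolynomial.isWeightedHomogeneous_X _ (wt1 n) _, MvPolynomial.isWeightedHomogeneous_X _ (wt2 n) _⟩
lemma Xr (i : Fin n) : Bihom 0 1 (MvPolynomial.X (Sum.inr i) : Pol n) :=
  ⟨MvPolynomial.isWeightedHomogeneous_X _ (wt1 n) _, MvPolynomial.isWeightedHomogeneous_X _ (wt2 n) _⟩
lemma Xsq : Bihom 1 1 (Xsq n) := sum _ _ (fun i _ => by
  simpa using (Xl i).mul (Xr i))
lemma dl (h : Bihom (p+1) q P) (i : Fin n) : Bihom p q (MvPolynomial.pderiv (Sum.inl i) P) :=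
  ⟨h.1.pderiv rfl, h.2.pderiv rfl⟩
lemma dr (h : Bihom p (q+1) P) (i : Fin n) : Bihom p q (MvPolynomial.pderiv (Sum.inr i) P) :=
  ⟨h.1.pderiv rfl, h.2.pderiv rfl⟩
lemma lapD (h : Bihom (p+1) (q+1) P) : Bihom p q (lapD P) :=
  sum _ _ (fun i _ => (h.dr i).dl i)

lemma weight1 {m : Fin n ⊕ Fin n →₀ ℕ} :
    Finsupp.weight (wt1 n) m = ∑ i, m (Sum.inl i) := by
  rw [Finsupp.weight_apply, Finsupp.sum_fintype _ _ (by simp)]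
  simp [wt1, Fintype.sum_sum_type]
lemma weight2 {m : Fin n ⊕ Fin n →₀ ℕ} :
    Finsupp.weight (wt2 n) m = ∑ i, m (Sum.inr i) := by
  rw [Finsupp.weight_apply, Finsupp.sum_fintype _ _ (by simp)]
  simp [wt2, Fintype.sum_sum_type]

lemma dl_zero (h : Bihom 0 q P) (i : Fin n) : MvPolynomial.pderiv (Sum.inl i) P = 0 := by
  ext m
  rw [MvPolynomial.coeff_pderiv, h.1.coeff_eq_zero]
  · simp
  · rw [weight1]
    intro h0
    have := Finset.sum_eq_zero_iff.1 h0 i (Finset.mem_univ _)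
    simp at this
lemma dr_zero (h : Bihom p 0 P) (i : Fin n) : MvPolynomial.pderiv (Sum.inr i) P = 0 := by
  ext m
  rw [MvPolynomial.coeff_pderiv, h.2.coeff_eq_zero]
  · simp
  · rw [weight2]
    intro h0
    have := Finset.sum_eq_zero_iff.1 h0 i (Finset.mem_univ _)
    simp at this
lemma lapD_zero (h : Bihom p q P) (h0 : p = 0 ∨ q = 0) : _root_.lapD P = 0 := by
  unfold _root_.lapD
  refine Finset.sum_eq_zero fun i _ => ?_
  rcases h0 with rfl | rfl
  · rcases q with _ | q
    · rw [h.dr_zero]; simp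
    · exact (h.dr i).dl_zero i
  · rw [h.dr_zero]; simp

lemma euler1 (h : Bihom p q P) :
    ∑ i : Fin n, MvPolynomial.X (Sum.inl i) * MvPolynomial.pderiv (Sum.inl i) P = (p : Pol n) * P := by
  have := h.1.sum_weight_X_mul_pderiv
  simpa [wt1, Fintype.sum_sum_type] using this
lemma euler2 (h : Bihom p q P) :
    ∑ i : Fin n, MvPolynomial.X (Sum.inr i) * MvPolynomial.pderiv (Sum.inr i) P = (q : Pol n) * P := by
  have := h.2.sum_weight_X_mul_pderiv
  simpa [wt2, Fintype.sum_sum_type] using this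
end Bihom

lemma lapD_add {n : ℕ} (P Q : Pol n) : lapD (P + Q) = lapD P + lapD Q := by
  simp [lapD, Finset.sum_add_distrib]
lemma lapD_sub {n : ℕ} (P Q : Pol n) : lapD (P - Q) = lapD P - lapD Q := by
  simp [lapD, Finset.sum_sub_distrib]
lemma lapD_C_mul {n : ℕ} (c : ℂ) (P : Pol n) :
    lapD (MvPolynomial.C c * P) = MvPolynomial.C c * lapD P := by
  simp [lapD, MvPolynomial.pderiv_C_mul, Finset.mul_sum]

lemma pderiv_Xsq_r {n : ℕ} (i : Fin n) :
    MvPolynomial.pderiv (Sum.inr i) (Xsq n) = MvPolynomial.X (Sum.inl i) := by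
  classical
  simp only [Xsq, map_sum, MvPolynomial.pderiv_mul, MvPolynomial.pderiv_X]
  rw [Finset.sum_eq_single i]
  · simp
  · intro j _ hj
    simp [Pi.single_apply, hj]
  · simp
lemma pderiv_Xsq_l {n : ℕ} (i : Fin n) :
    MvPolynomial.pderiv (Sum.inl i) (Xsq n) = MvPolynomial.X (Sum.inr i) := by
  classical
  simp only [Xsq, map_sum, MvPolynomial.pderiv_mul, MvPolynomial.pderiv_X]
  rw [Finset.sum_eq_single i]
  · simp
  · intro j _ hj
    simp [Pi.single_apply, hj]
  · simp

lemma lapD_Xsq_mul {n p q : ℕ} {R : Pol n} (h : Bihom p q R) :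
    lapD (Xsq n * R) = Xsq n * lapD R + ((n + p + q : ℕ) : Pol n) * R := by
  unfold lapD
  simp only [MvPolynomial.pderiv_mul, map_add, pderiv_Xsq_r, pderiv_Xsq_l,
    MvPolynomial.pderiv_X_self]
  simp only [Finset.sum_add_distrib, ← Finset.mul_sum, h.euler1, h.euler2]
  simp
  ring

lemma solveD {n : ℕ} (p : ℕ) : ∀ (q : ℕ) (c : ℝ) (_ : 0 < c) (S : Pol n), Bihom p q S →
    ∃ R : Pol n, Bihom p q R ∧ Xsq n * lapD R + MvPolynomial.C (c : ℂ) * R = S := by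
  have hcc : ∀ (c : ℝ), 0 < c → ∀ S : Pol n,
      MvPolynomial.C (c:ℂ) * (MvPolynomial.C ((c:ℂ)⁻¹) * S) = S := by
    intro c hc S
    rw [← mul_assoc, ← MvPolynomial.C_mul, mul_inv_cancel₀ (by exact_mod_cast hc.ne')]
    simp
  induction p with
  | zero =>
    intro q c hc S hS
    refine ⟨MvPolynomial.C ((c:ℂ)⁻¹) * S, hS.C_mul _, ?_⟩
    rw [lapD_C_mul, hS.lapD_zero (Or.inl rfl), hcc c hc]; simp
  | succ p ih =>
    intro q c hc S hS
    rcases q with _ | q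
    · refine ⟨MvPolynomial.C ((c:ℂ)⁻¹) * S, hS.C_mul _, ?_⟩
      rw [lapD_C_mul, hS.lapD_zero (Or.inr rfl), hcc c hc]; simp
    obtain ⟨U, hU, hU2⟩ := ih q (c + (n + p + q : ℕ)) (by positivity) (lapD S) hS.lapD
    have hXU : Bihom (p+1) (q+1) (Xsq n * U) := by
      have := Bihom.Xsq.mul hU
      rwa [add_comm 1 p, add_comm 1 q] at this
    refine ⟨MvPolynomial.C ((c:ℂ)⁻¹) * (S - Xsq n * U), (hS.sub hXU).C_mul _, ?_⟩
    have : lapD (S - Xsq n * U) = MvPolynomial.C (c:ℂ) * U := by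
      rw [lapD_sub, lapD_Xsq_mul hU, ← hU2]
      push_cast
      simp only [map_add, map_natCast]
      ring
    rw [lapD_C_mul, this, hcc c hc, mul_comm (MvPolynomial.C ((c:ℂ)⁻¹)) (MvPolynomial.C (c:ℂ) * U),
      mul_comm (MvPolynomial.C (c:ℂ)) U, mul_assoc U, ← MvPolynomial.C_mul,
      mul_inv_cancel₀ (by exact_mod_cast hc.ne')]
    simp

lemma ev_add {n : ℕ} (P Q : Pol n) (z) : ev (P + Q) z = ev P z + ev Q z := by simp [ev]
lemma ev_sub {n : ℕ} (P Q : Pol n) (z) : ev (P - Q) z = ev P z - ev Q z := by simp [ev]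
lemma ev_mul {n : ℕ} (P Q : Pol n) (z) : ev (P * Q) z = ev P z * ev Q z := by simp [ev]
lemma ev_C {n : ℕ} (c : ℂ) (z) : ev (MvPolynomial.C c : Pol n) z = c := by simp [ev]
lemma ev_sum {n : ℕ} {ι : Type*} (s : Finset ι) (f : ι → Pol n) (z) :
    ev (∑ i ∈ s, f i) z = ∑ i ∈ s, ev (f i) z := by simp [ev]

lemma ev_Xsq {n : ℕ} (z : EuclideanSpace ℂ (Fin n)) (hz : ‖z‖ = 1) : ev (Xsq n) z = 1 := by
  have h := EuclideanSpace.norm_sq_eq z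
  rw [hz] at h
  simp only [ev, Xsq, evPt, map_sum, map_mul, MvPolynomial.eval_X, Sum.elim_inl, Sum.elim_inr,
    Complex.mul_conj, Complex.normSq_eq_norm_sq]
  rw [← Complex.ofReal_sum, ← h]; simp

/-- Every bihomogeneous polynomial equals on the sphere a finite sum of harmonics. -/
lemma bihom_span {n : ℕ} (hn : 1 ≤ n) (T : Submodule ℂ (EuclideanSpace ℂ (Fin n) → ℂ))
    (hT : ∀ p q (h : Pol n), HP p q h → ev h ∈ T)
    (p : ℕ) : ∀ (q : ℕ) (P : Pol n), Bihom p q P →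
      ∃ g ∈ T, ∀ z, ‖z‖ = 1 → ev P z = g z := by
  induction p with
  | zero => intro q P hP; exact ⟨ev P, hT 0 q P ⟨hP, hP.lapD_zero (Or.inl rfl)⟩, fun _ _ => rfl⟩
  | succ p ih =>
    intro q P hP
    rcases q with _ | q
    · exact ⟨ev P, hT _ 0 P ⟨hP, hP.lapD_zero (Or.inr rfl)⟩, fun _ _ => rfl⟩
    obtain ⟨R, hR, hR2⟩ := solveD p q ((n + p + q : ℕ) : ℝ) (by positivity) (lapD P) hP.lapD
    obtain ⟨g, hg, hg2⟩ := ih q R hR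
    have hXR : Bihom (p+1) (q+1) (Xsq n * R) := by
      have := Bihom.Xsq.mul hR
      rwa [add_comm 1 p, add_comm 1 q] at this
    refine ⟨ev (P - Xsq n * R) + g, T.add_mem (hT (p+1) (q+1) _ ⟨hP.sub hXR, ?_⟩) hg, ?_⟩
    · rw [lapD_sub, lapD_Xsq_mul hR, ← hR2]
      simp
    · intro z hz
      simp [ev_sub, ev_mul, ev_Xsq z hz, hg2 z hz]

lemma bihom_monomial {n : ℕ} (m : Fin n ⊕ Fin n →₀ ℕ) (c : ℂ) :
    Bihom (∑ i, m (Sum.inl i)) (∑ i, m (Sum.inr i)) (MvPolynomial.monomial m c) :=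
  ⟨MvPolynomial.isWeightedHomogeneous_monomial _ _ _ Bihom.weight1,
   MvPolynomial.isWeightedHomogeneous_monomial _ _ _ Bihom.weight2⟩

lemma pol_span {n : ℕ} (hn : 1 ≤ n) (T : Submodule ℂ (EuclideanSpace ℂ (Fin n) → ℂ))
    (hT : ∀ p q (h : Pol n), HP p q h → ev h ∈ T) (P : Pol n) :
      ∃ g ∈ T, ∀ z, ‖z‖ = 1 → ev P z = g z := by
  induction P using MvPolynomial.induction_on' with
  | monomial m c => exact bihom_span hn T hT _ _ _ (bihom_monomial m c)
  | add P Q hP hQ =>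
    obtain ⟨g, hg, hg2⟩ := hP
    obtain ⟨g', hg', hg2'⟩ := hQ
    exact ⟨g + g', T.add_mem hg hg', fun z hz => by simp [ev_add, hg2 z hz, hg2' z hz]⟩

end

section

lemma evPt_smul {n : ℕ} (c : ℂ) (z : EuclideanSpace ℂ (Fin n)) (m : Fin n ⊕ Fin n →₀ ℕ) :
    ∏ i, evPt (c • z) i ^ m i = c ^ (∑ i, m (Sum.inl i)) * (starRingEnd ℂ c) ^ (∑ i, m (Sum.inr i))
      * ∏ i, evPt z i ^ m i := by
  simp only [Fintype.prod_sum_type, evPt, Sum.elim_inl, Sum.elim_inr, PiLp.smul_apply, smul_eq_mul,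
    map_mul, mul_pow, Finset.prod_mul_distrib, Finset.prod_pow_eq_pow_sum]
  ring

lemma ev_smul {n p q : ℕ} {P : Pol n} (h : Bihom p q P) (c : ℂ) (z : EuclideanSpace ℂ (Fin n)) :
    ev P (c • z) = c ^ p * (starRingEnd ℂ c) ^ q * ev P z := by
  unfold ev
  rw [MvPolynomial.eval_eq', MvPolynomial.eval_eq', Finset.mul_sum]
  refine Finset.sum_congr rfl fun m hm => ?_
  rw [evPt_smul]
  have h1 := h.1 (MvPolynomial.mem_support_iff.1 hm)
  have h2 := h.2 (MvPolynomial.mem_support_iff.1 hm)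
  rw [Bihom.weight1] at h1
  rw [Bihom.weight2] at h2
  rw [h1, h2]; ring

/-- coordinates as real-linear maps -/
def pcoord {n : ℕ} : Fin n ⊕ Fin n → (EuclideanSpace ℂ (Fin n) →L[ℝ] ℂ) :=
  Sum.elim (fun i => (EuclideanSpace.proj i : EuclideanSpace ℂ (Fin n) →L[ℂ] ℂ).restrictScalars ℝ)
    (fun i => (Complex.conjCLE : ℂ →L[ℝ] ℂ).comp
      ((EuclideanSpace.proj i : EuclideanSpace ℂ (Fin n) →L[ℂ] ℂ).restrictScalars ℝ))

lemma evPt_eq_pcoord {n : ℕ} (z : EuclideanSpace ℂ (Fin n)) (k) : evPt z k = pcoord k z := by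
  rcases k with k | k <;> simp [evPt, pcoord]

lemma ev_X {n : ℕ} (k) (z : EuclideanSpace ℂ (Fin n)) :
    ev (MvPolynomial.X k) z = pcoord k z := by
  rw [← evPt_eq_pcoord]; simp [ev]

lemma hasFDerivAt_ev {n : ℕ} (P : Pol n) (z : EuclideanSpace ℂ (Fin n)) :
    HasFDerivAt (ev P) (∑ k, ev (MvPolynomial.pderiv k P) z • pcoord k) z := by
  classical
  induction P using MvPolynomial.induction_on with
  | C a =>
    have : ev (MvPolynomial.C a : Pol n) = fun _ => a := by ext z; simp [ev]
    rw [this]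
    refine (hasFDerivAt_const (𝕜 := ℝ) a z).congr_fderiv ?_
    ext v
    simp [ev]
  | add P Q hP hQ =>
    have : ev (P + Q) = fun z => ev P z + ev Q z := by ext z; simp [ev]
    rw [this]
    refine (hP.add hQ).congr_fderiv ?_
    ext v
    simp only [map_add, ev_add, sum_apply, smul_apply, smul_eq_mul, add_apply, add_mul,
      Finset.sum_add_distrib]
  | mul_X P k hP =>
    have : ev (P * MvPolynomial.X k) = fun z => ev P z * pcoord k z := by
      ext z; rw [ev_mul, ev_X]
    rw [this]
    refine (hP.mul (pcoord k).hasFDerivAt).congr_fderiv ?_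
    ext v
    simp only [sum_apply, smul_apply, smul_eq_mul,
      add_apply, MvPolynomial.pderiv_mul, ev_add, ev_mul, ev_X, add_mul,
      Finset.sum_add_distrib, Finset.mul_sum]
    rw [add_comm]
    congr 1
    · refine Finset.sum_congr rfl fun i _ => by ring
    · rw [Finset.sum_eq_single k]
      · simp [ev]
      · intro j _ hj
        simp [ev, Pi.single_apply, hj.symm]
      · simp

lemma fderiv_ev {n : ℕ} (P : Pol n) (z v : EuclideanSpace ℂ (Fin n)) :
    fderiv ℝ (ev P) z v = ev (∑ k, MvPolynomial.C (pcoord k v) * MvPolynomial.pderiv k P) z := by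
  rw [(hasFDerivAt_ev P z).fderiv]
  simp only [ev_sum, ev_mul, ev_C, sum_apply, smul_apply, smul_eq_mul]
  exact Finset.sum_congr rfl fun _ _ => mul_comm _ _

lemma contDiff_ev {n : ℕ} (P : Pol n) : ContDiff ℝ (⊤ : ℕ∞) (ev P) := by
  induction P using MvPolynomial.induction_on with
  | C a =>
    have : ev (MvPolynomial.C a : Pol n) = fun _ => a := by ext z; simp [ev]
    rw [this]; exact contDiff_const
  | add P Q hP hQ =>
    have : ev (P + Q) = fun z => ev P z + ev Q z := by ext z; simp [ev]
    rw [this]; exact hP.add hQ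
  | mul_X P k hP =>
    have : ev (P * MvPolynomial.X k) = fun z => ev P z * pcoord k z := by
      ext z; rw [ev_mul, ev_X]
    rw [this]; exact hP.mul (pcoord k).contDiff

lemma continuous_ev {n : ℕ} (P : Pol n) : Continuous (ev P) := (contDiff_ev P).continuous

lemma pderiv_comm' {n : ℕ} (k l : Fin n ⊕ Fin n) (P : Pol n) :
    MvPolynomial.pderiv k (MvPolynomial.pderiv l P) = MvPolynomial.pderiv l (MvPolynomial.pderiv k P) := by
  classical
  ext m
  simp only [MvPolynomial.coeff_pderiv]
  rw [add_right_comm]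
  by_cases h : k = l
  · subst h; rfl
  · have h' : l ≠ k := fun e => h e.symm
    simp [Finsupp.single_apply, h, h']
    ring

lemma cplxLaplacian_ev {n : ℕ} (P : Pol n) (z : EuclideanSpace ℂ (Fin n)) :
    cplxLaplacian (ev P) z = 4 * ev (lapD P) z := by
  classical
  have e1 : ∀ (v : EuclideanSpace ℂ (Fin n)), (fun w => fderiv ℝ (ev P) w v)
      = ev (∑ k, MvPolynomial.C (pcoord k v) * MvPolynomial.pderiv k P) := by
    intro v; ext w; rw [fderiv_ev]
  have e2 : ∀ (j : Fin n) (a : ℂ) (Q : Pol n),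
      ∑ k, MvPolynomial.C (pcoord k (a • EuclideanSpace.single j (1:ℂ))) * MvPolynomial.pderiv k Q
       = MvPolynomial.C a * MvPolynomial.pderiv (Sum.inl j) Q
        + MvPolynomial.C (starRingEnd ℂ a) * MvPolynomial.pderiv (Sum.inr j) Q := by
    intro j a Q
    rw [Fintype.sum_sum_type]
    congr 1
    · rw [Finset.sum_eq_single j]
      · simp [pcoord]
      · intro i _ hi; simp [pcoord, hi]
      · simp
    · rw [Finset.sum_eq_single j]
      · simp [pcoord]
      · intro i _ hi; simp [pcoord, hi]
      · simp
  unfold cplxLaplacian lapD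
  rw [ev_sum, Finset.mul_sum]
  refine Finset.sum_congr rfl fun j _ => ?_
  have e3 := fun Q => e2 j 1 Q
  simp only [one_smul] at e3
  rw [e1, e1, fderiv_ev, fderiv_ev, e3, e3, e2, e2]
  simp only [map_add, MvPolynomial.pderiv_C_mul, ev_add, ev_mul, ev_C, map_one, Complex.conj_I,
    MvPolynomial.C_1, one_mul]
  rw [pderiv_comm' (Sum.inr j) (Sum.inl j)]
  linear_combination (- ev (MvPolynomial.pderiv (Sum.inl j) (MvPolynomial.pderiv (Sum.inl j) P)) z
    - ev (MvPolynomial.pderiv (Sum.inr j) (MvPolynomial.pderiv (Sum.inr j) P)) z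
    +2 * ev (MvPolynomial.pderiv (Sum.inl j) (MvPolynomial.pderiv (Sum.inr j) P)) z) * (-Complex.I_sq)

lemma HP.memHpq {n p q : ℕ} {P : Pol n} (h : HP p q P) : MemHpq n p q (ev P) :=
  ⟨contDiff_ev P, fun z => by rw [cplxLaplacian_ev, h.2]; simp [ev], fun c z => ev_smul h.1 c z⟩

/-! Unitary substitution -/

def umat {n : ℕ} (u : EuclideanSpace ℂ (Fin n) ≃ₗᵢ[ℂ] EuclideanSpace ℂ (Fin n)) (i k : Fin n) : ℂ :=
  (starRingEnd ℂ) (u.symm (EuclideanSpace.single i 1) k)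

lemma umat_apply {n : ℕ} (u : EuclideanSpace ℂ (Fin n) ≃ₗᵢ[ℂ] EuclideanSpace ℂ (Fin n)) (z) (i) :
    u z i = ∑ k, umat u i k * z k := by
  have h : inner ℂ (EuclideanSpace.single i (1:ℂ)) (u z)
      = inner ℂ (u.symm (EuclideanSpace.single i (1:ℂ))) z := by
    rw [← u.inner_map_map (u.symm _) z]; simp
  rw [EuclideanSpace.inner_single_left] at h
  simp only [map_one, one_mul] at h
  rw [h]
  simp [PiLp.inner_apply, umat, mul_comm]

lemma umat_orth {n : ℕ} (u : EuclideanSpace ℂ (Fin n) ≃ₗᵢ[ℂ] EuclideanSpace ℂ (Fin n)) (i j) :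
    ∑ k, umat u i k * (starRingEnd ℂ) (umat u j k) = if i = j then 1 else 0 := by
  have h : inner ℂ (u.symm (EuclideanSpace.single i (1:ℂ))) (u.symm (EuclideanSpace.single j (1:ℂ)))
      = inner ℂ (EuclideanSpace.single i (1:ℂ)) (EuclideanSpace.single j (1:ℂ)) :=
    u.symm.inner_map_map _ _
  rw [EuclideanSpace.inner_single_left] at h
  simp only [PiLp.inner_apply] at h
  have e : ∀ k, umat u i k * (starRingEnd ℂ) (umat u j k)
      = inner ℂ ((u.symm (EuclideanSpace.single i 1)).ofLp k)
          ((u.symm (EuclideanSpace.single j 1)).ofLp k) := by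
    intro k
    simp [umat, mul_comm]
  simp only [e, h]
  simp [Pi.single_apply]

def usub {n : ℕ} (u : EuclideanSpace ℂ (Fin n) ≃ₗᵢ[ℂ] EuclideanSpace ℂ (Fin n)) :
    Fin n ⊕ Fin n → Pol n :=
  Sum.elim (fun i => ∑ k, MvPolynomial.C (umat u i k) * MvPolynomial.X (Sum.inl k))
    (fun i => ∑ k, MvPolynomial.C ((starRingEnd ℂ) (umat u i k)) * MvPolynomial.X (Sum.inr k))

def subst {n : ℕ} (u : EuclideanSpace ℂ (Fin n) ≃ₗᵢ[ℂ] EuclideanSpace ℂ (Fin n)) (P : Pol n) : Pol n :=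
  MvPolynomial.aeval (usub u) P

lemma ev_subst {n : ℕ} (u : EuclideanSpace ℂ (Fin n) ≃ₗᵢ[ℂ] EuclideanSpace ℂ (Fin n)) (P : Pol n)
    (z) : ev (subst u P) z = ev P (u z) := by
  induction P using MvPolynomial.induction_on with
  | C a => simp [subst, ev]
  | add P Q hP hQ => simp only [subst, map_add, ev_add] at *; rw [hP, hQ]
  | mul_X P k hP =>
    simp only [subst, map_mul, ev_mul] at *
    rw [hP]
    congr 1
    rcases k with k | k
    · simp [ev, usub, evPt, umat_apply]
    · simp [ev, usub, evPt, umat_apply]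

lemma bihom_subst {n p q : ℕ} (u : EuclideanSpace ℂ (Fin n) ≃ₗᵢ[ℂ] EuclideanSpace ℂ (Fin n))
    {P : Pol n} (h : Bihom p q P) : Bihom p q (subst u P) := by
  unfold subst
  rw [MvPolynomial.aeval_def, MvPolynomial.eval₂_eq']
  refine Bihom.sum _ _ fun m hm => ?_
  have h1 := h.1 (MvPolynomial.mem_support_iff.1 hm)
  have h2 := h.2 (MvPolynomial.mem_support_iff.1 hm)
  rw [Finsupp.weight_apply, Finsupp.sum_fintype _ _ (by simp)] at h1 h2
  have hb : ∀ k, Bihom (wt1 n k) (wt2 n k) (usub u k) := by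
    rintro (k | k)
    · exact Bihom.sum (p := 1) (q := 0) Finset.univ (fun i => MvPolynomial.C (umat u k i) * MvPolynomial.X (Sum.inl i)) fun i _ => (Bihom.Xl i).C_mul _
    · exact Bihom.sum (p := 0) (q := 1) Finset.univ (fun i => MvPolynomial.C ((starRingEnd ℂ) (umat u k i)) * MvPolynomial.X (Sum.inr i)) fun i _ => (Bihom.Xr i).C_mul _
  refine Bihom.C_mul ⟨?_, ?_⟩ _
  · rw [← h1]
    exact MvPolynomial.IsWeightedHomogeneous.prod _ _ _ fun i _ => (hb i).1.pow _
  · rw [← h2]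
    exact MvPolynomial.IsWeightedHomogeneous.prod _ _ _ fun i _ => (hb i).2.pow _

lemma pderiv_subst {n : ℕ} (u : EuclideanSpace ℂ (Fin n) ≃ₗᵢ[ℂ] EuclideanSpace ℂ (Fin n)) (P : Pol n)
    (k) : MvPolynomial.pderiv k (subst u P)
      = ∑ l, subst u (MvPolynomial.pderiv l P) * MvPolynomial.pderiv k (usub u l) := by
  classical
  induction P using MvPolynomial.induction_on with
  | C a => simp [subst]
  | add P Q hP hQ =>
    simp only [subst, map_add, add_mul, Finset.sum_add_distrib] at *; rw [hP, hQ]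
  | mul_X P j hP =>
    have e1 : subst u (P * MvPolynomial.X j) = subst u P * usub u j := by simp [subst]
    have e2 : ∀ l, subst u (MvPolynomial.pderiv l (P * MvPolynomial.X j))
        = subst u (MvPolynomial.pderiv l P) * usub u j
          + subst u P * subst u (MvPolynomial.pderiv l (MvPolynomial.X j)) := by
      intro l; rw [MvPolynomial.pderiv_mul]; simp only [subst, map_add, map_mul, MvPolynomial.aeval_X]
    simp only [e2]
    simp only [e1, MvPolynomial.pderiv_mul, hP, add_mul, Finset.sum_add_distrib, Finset.sum_mul]
    refine congrArg₂ (· + ·) ?_ ?_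
    · exact Finset.sum_congr rfl fun _ _ => by ring
    · rw [Finset.sum_eq_single j]
      · simp [subst]
      · intro i _ hi; simp [subst, Pi.single_apply, hi.symm]
      · simp

lemma pderiv_subst_l {n : ℕ} (u : EuclideanSpace ℂ (Fin n) ≃ₗᵢ[ℂ] EuclideanSpace ℂ (Fin n)) (P : Pol n)
    (k) : MvPolynomial.pderiv (Sum.inl k) (subst u P)
      = ∑ i, MvPolynomial.C (umat u i k) * subst u (MvPolynomial.pderiv (Sum.inl i) P) := by
  classical
  rw [pderiv_subst, Fintype.sum_sum_type]
  have h2 : ∀ i, MvPolynomial.pderiv (Sum.inl k) (usub u (Sum.inr i)) = 0 := by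
    intro i; simp [usub]
  have h1 : ∀ i, MvPolynomial.pderiv (Sum.inl k) (usub u (Sum.inl i)) = MvPolynomial.C (umat u i k) := by
    intro i
    simp only [usub, Sum.elim_inl, map_sum, MvPolynomial.pderiv_C_mul]
    rw [Finset.sum_eq_single k]
    · simp
    · intro j _ hj; simp [Pi.single_apply, hj]
    · simp
  simp [h1, h2, mul_comm]

lemma pderiv_subst_r {n : ℕ} (u : EuclideanSpace ℂ (Fin n) ≃ₗᵢ[ℂ] EuclideanSpace ℂ (Fin n)) (P : Pol n)
    (k) : MvPolynomial.pderiv (Sum.inr k) (subst u P)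
      = ∑ i, MvPolynomial.C ((starRingEnd ℂ) (umat u i k)) * subst u (MvPolynomial.pderiv (Sum.inr i) P) := by
  classical
  rw [pderiv_subst, Fintype.sum_sum_type]
  have h2 : ∀ i, MvPolynomial.pderiv (Sum.inr k) (usub u (Sum.inl i)) = 0 := by
    intro i; simp [usub]
  have h1 : ∀ i, MvPolynomial.pderiv (Sum.inr k) (usub u (Sum.inr i))
      = MvPolynomial.C ((starRingEnd ℂ) (umat u i k)) := by
    intro i
    simp only [usub, Sum.elim_inr, map_sum, MvPolynomial.pderiv_C_mul]
    rw [Finset.sum_eq_single k]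
    · simp
    · intro j _ hj; simp [Pi.single_apply, hj]
    · simp
  simp [h1, h2, mul_comm]

lemma lapD_subst {n : ℕ} (u : EuclideanSpace ℂ (Fin n) ≃ₗᵢ[ℂ] EuclideanSpace ℂ (Fin n)) (P : Pol n) :
    lapD (subst u P) = subst u (lapD P) := by
  classical
  unfold lapD
  simp only [pderiv_subst_r, map_sum, MvPolynomial.pderiv_C_mul, pderiv_subst_l, Finset.mul_sum]
  have h0 : ∀ Q : Fin n → Pol n, subst u (∑ i, Q i) = ∑ i, subst u (Q i) := by
    intro Q; simp [subst]
  rw [h0, Finset.sum_comm]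
  refine Finset.sum_congr rfl fun i _ => ?_
  rw [Finset.sum_comm, Finset.sum_eq_single i]
  · simp only [← mul_assoc, ← Finset.sum_mul, ← MvPolynomial.C_mul]
    rw [← map_sum]
    have := umat_orth u i i
    simp only [mul_comm] at this ⊢
    rw [this]; simp
  · intro j _ hj
    simp only [← mul_assoc, ← Finset.sum_mul, ← MvPolynomial.C_mul]
    rw [← map_sum]
    have := umat_orth u j i
    simp only [mul_comm] at this ⊢
    rw [this]; simp [hj]
  · simp

lemma HP.subst {n p q : ℕ} (u : EuclideanSpace ℂ (Fin n) ≃ₗᵢ[ℂ] EuclideanSpace ℂ (Fin n))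
    {P : Pol n} (h : HP p q P) : HP p q (subst u P) :=
  ⟨bihom_subst u h.1, by rw [lapD_subst, h.2]; simp [_root_.subst]⟩

end

section

/-- the weights of the functional `S_j`. -/
def wS {d : ℕ} (j : ℕ) (m : Fin (d+1) ⊕ Fin (d+1) →₀ ℕ) : ℂ :=
  if (∀ i : Fin d, m (Sum.inl i.succ) = m (Sum.inr i.succ)) ∧ ∑ i : Fin d, m (Sum.inl i.succ) = j
  then ∏ i : Fin d, ((m (Sum.inl i.succ)).factorial : ℂ) else 0

def SS {d : ℕ} (j : ℕ) : Pol (d+1) →ₗ[ℂ] ℂ :=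
  (MvPolynomial.basisMonomials (Fin (d+1) ⊕ Fin (d+1)) ℂ).constr ℂ (wS j)

lemma SS_monomial {d : ℕ} (j : ℕ) (m : Fin (d+1) ⊕ Fin (d+1) →₀ ℕ) (c : ℂ) :
    SS j (MvPolynomial.monomial m c) = c * wS j m := by
  have : MvPolynomial.monomial m c = c • (MvPolynomial.basisMonomials (Fin (d+1) ⊕ Fin (d+1)) ℂ) m := by
    simp [MvPolynomial.smul_monomial]
  rw [this, map_smul, SS, Module.Basis.constr_basis, smul_eq_mul]

lemma SS_dd_succ {d : ℕ} (j : ℕ) (m : Fin (d+1) ⊕ Fin (d+1) →₀ ℕ) (c : ℂ) (i : Fin d) :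
    SS j (MvPolynomial.pderiv (Sum.inl i.succ) (MvPolynomial.pderiv (Sum.inr i.succ)
      (MvPolynomial.monomial m c))) = c * (m (Sum.inl i.succ)) * wS (j+1) m := by
  classical
  rw [MvPolynomial.pderiv_monomial, MvPolynomial.pderiv_monomial, SS_monomial]
  have hv : ∀ k, (m - Finsupp.single (Sum.inr i.succ) 1 - Finsupp.single (Sum.inl i.succ) 1 : Fin (d+1) ⊕ Fin (d+1) →₀ ℕ) k
      = m k - (if k = Sum.inr i.succ then 1 else 0) - (if k = Sum.inl i.succ then 1 else 0) := by
    intro k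
    simp [Finsupp.single_apply, eq_comm]
  have hl : (m - Finsupp.single (Sum.inr i.succ) 1 : Fin (d+1) ⊕ Fin (d+1) →₀ ℕ) (Sum.inl i.succ)
      = m (Sum.inl i.succ) := by simp
  rw [hl]
  by_cases hml : m (Sum.inl i.succ) = 0
  · simp [hml]
  by_cases hmr : m (Sum.inr i.succ) = 0
  · have : wS (j+1) m = 0 := by
      unfold wS
      rw [if_neg]
      rintro ⟨h, -⟩
      exact hml ((h i).trans hmr)
    simp [hmr, this]
  have hvl : ∀ i' : Fin d, (m - Finsupp.single (Sum.inr i.succ) 1 - Finsupp.single (Sum.inl i.succ) 1 : Fin (d+1) ⊕ Fin (d+1) →₀ ℕ)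
      (Sum.inl i'.succ) = m (Sum.inl i'.succ) - (if i' = i then 1 else 0) := by
    intro i'; rw [hv]; simp
  have hvr : ∀ i' : Fin d, (m - Finsupp.single (Sum.inr i.succ) 1 - Finsupp.single (Sum.inl i.succ) 1 : Fin (d+1) ⊕ Fin (d+1) →₀ ℕ)
      (Sum.inr i'.succ) = m (Sum.inr i'.succ) - (if i' = i then 1 else 0) := by
    intro i'; rw [hv]; simp
  unfold wS
  simp only [hvl, hvr]
  have hc1 : (∀ i' : Fin d, m (Sum.inl i'.succ) - (if i' = i then 1 else 0)
      = m (Sum.inr i'.succ) - (if i' = i then 1 else 0)) ↔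
      (∀ i' : Fin d, m (Sum.inl i'.succ) = m (Sum.inr i'.succ)) := by
    refine forall_congr' fun i' => ?_
    by_cases h : i' = i
    · subst h; simp; omega
    · simp [h]
  have hsum : ∑ i' : Fin d, (m (Sum.inl i'.succ) - (if i' = i then 1 else 0)) + 1
      = ∑ i' : Fin d, m (Sum.inl i'.succ) := by
    rw [← Finset.add_sum_erase _ _ (Finset.mem_univ i), ← Finset.add_sum_erase _ (fun i' : Fin d => m (Sum.inl i'.succ)) (Finset.mem_univ i)]
    have : ∑ x ∈ Finset.univ.erase i, (m (Sum.inl x.succ) - if x = i then 1 else 0)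
        = ∑ x ∈ Finset.univ.erase i, m (Sum.inl x.succ) :=
      Finset.sum_congr rfl fun x hx => by simp [Finset.ne_of_mem_erase hx]
    rw [this]
    simp; omega
  have hprod : ((m (Sum.inl i.succ) : ℕ) : ℂ) * ∏ i' : Fin d, ((m (Sum.inl i'.succ) - (if i' = i then 1 else 0)).factorial : ℂ)
      = ∏ i' : Fin d, ((m (Sum.inl i'.succ)).factorial : ℂ) := by
    rw [← Finset.mul_prod_erase _ _ (Finset.mem_univ i), ← Finset.mul_prod_erase _ (fun i' : Fin d => ((m (Sum.inl i'.succ)).factorial : ℂ)) (Finset.mem_univ i)]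
    have : ∏ x ∈ Finset.univ.erase i, ((m (Sum.inl x.succ) - if x = i then 1 else 0).factorial : ℂ)
        = ∏ x ∈ Finset.univ.erase i, ((m (Sum.inl x.succ)).factorial : ℂ) :=
      Finset.prod_congr rfl fun x hx => by simp [Finset.ne_of_mem_erase hx]
    rw [this, ← mul_assoc]
    congr 1
    simp only [if_true]
    exact_mod_cast Nat.mul_factorial_pred hml
  simp only [hc1]
  by_cases hA : ∀ i' : Fin d, m (Sum.inl i'.succ) = m (Sum.inr i'.succ)
  · by_cases hB : ∑ i' : Fin d, m (Sum.inl i'.succ) = j + 1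
    · rw [if_pos ⟨hA, by omega⟩, if_pos ⟨hA, hB⟩, ← hprod, ← hA i]; ring
    · rw [if_neg (by rintro ⟨-, h⟩; omega), if_neg (by rintro ⟨-, h⟩; omega)]; simp
  · rw [if_neg (fun h => hA h.1), if_neg (fun h => hA h.1)]; simp

lemma SS_dd_zero {d : ℕ} (j : ℕ) (m : Fin (d+1) ⊕ Fin (d+1) →₀ ℕ) (c : ℂ) :
    SS j (MvPolynomial.pderiv (Sum.inl 0) (MvPolynomial.pderiv (Sum.inr 0)
      (MvPolynomial.monomial m c))) = c * (m (Sum.inl 0)) * (m (Sum.inr 0)) * wS j m := by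
  classical
  rw [MvPolynomial.pderiv_monomial, MvPolynomial.pderiv_monomial, SS_monomial]
  have : wS j (m - Finsupp.single (Sum.inr 0) 1 - Finsupp.single (Sum.inl 0) 1) = wS j m := by
    unfold wS
    simp [Finsupp.single_apply, Fin.succ_ne_zero, (Fin.succ_ne_zero _).symm]
  rw [this]
  simp
  ring_nf
  simp

lemma SS_lapD_monomial {d p q : ℕ} (j : ℕ) (m : Fin (d+1) ⊕ Fin (d+1) →₀ ℕ) (c : ℂ)
    (hp : ∑ i, m (Sum.inl i) = p) (hq : ∑ i, m (Sum.inr i) = q) :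
    SS j (lapD (MvPolynomial.monomial m c)) = ((p:ℂ) - j) * ((q:ℂ) - j) * (c * wS j m)
      + (j + 1) * (c * wS (j+1) m) := by
  unfold lapD
  rw [Fin.sum_univ_succ, map_add, map_sum, SS_dd_zero]
  simp only [SS_dd_succ]
  rw [← Finset.sum_mul, ← Finset.mul_sum]
  rw [Fin.sum_univ_succ] at hp hq
  congr 1
  · by_cases h : wS j m = 0
    · simp [h]
    · unfold wS at h
      have h' : (∀ i : Fin d, m (Sum.inl i.succ) = m (Sum.inr i.succ)) ∧ ∑ i : Fin d, m (Sum.inl i.succ) = j := by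
        by_contra hc; rw [if_neg hc] at h; exact h rfl
      have e1 : ((p:ℂ) - j) = m (Sum.inl 0) := by rw [← hp, ← h'.2]; push_cast; ring
      have e2 : ((q:ℂ) - j) = m (Sum.inr 0) := by
        rw [← hq, ← h'.2]; simp only [h'.1]; push_cast; ring
      rw [e1, e2]; ring
  · by_cases h : wS (j+1) m = 0
    · simp [h]
    · unfold wS at h
      have h' : (∀ i : Fin d, m (Sum.inl i.succ) = m (Sum.inr i.succ)) ∧ ∑ i : Fin d, m (Sum.inl i.succ) = j + 1 := by
        by_contra hc; rw [if_neg hc] at h; exact h rfl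
      have : (∑ i : Fin d, (m (Sum.inl i.succ) : ℂ)) = j + 1 := by exact_mod_cast h'.2
      rw [this]; ring

/-- linear extension principle on bihomogeneous polynomials -/
lemma bihom_lin_ext {n p q : ℕ} {P : Pol n} (h : Bihom p q P) (L L' : Pol n →ₗ[ℂ] ℂ)
    (hL : ∀ m c, ∑ i, m (Sum.inl i) = p → ∑ i, m (Sum.inr i) = q →
      L (MvPolynomial.monomial m c) = L' (MvPolynomial.monomial m c)) : L P = L' P := by
  rw [P.as_sum, map_sum, map_sum]
  refine Finset.sum_congr rfl fun m hm => ?_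
  have h1 := h.1 (MvPolynomial.mem_support_iff.1 hm)
  have h2 := h.2 (MvPolynomial.mem_support_iff.1 hm)
  rw [Bihom.weight1] at h1
  rw [Bihom.weight2] at h2
  exact hL m _ h1 h2

def lapDL (n : ℕ) : Pol n →ₗ[ℂ] Pol n where
  toFun := lapD
  map_add' := lapD_add
  map_smul' c P := by
    rw [MvPolynomial.smul_eq_C_mul, lapD_C_mul, MvPolynomial.smul_eq_C_mul]; rfl

lemma SS_rec {d p q : ℕ} {h : Pol (d+1)} (hh : HP p q h) (j : ℕ) :
    ((p:ℂ) - j) * ((q:ℂ) - j) * SS j h + (j + 1) * SS (j+1) h = 0 := by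
  have := bihom_lin_ext hh.1 ((SS j).comp (lapDL _))
    ((((p:ℂ) - j) * ((q:ℂ) - j)) • SS j + ((j:ℂ) + 1) • SS (j+1)) (by
      intro m c h1 h2
      simp only [LinearMap.comp_apply, LinearMap.add_apply, LinearMap.smul_apply, SS_monomial, smul_eq_mul]
      exact SS_lapD_monomial j m c h1 h2)
  simp only [LinearMap.comp_apply, LinearMap.add_apply, LinearMap.smul_apply, smul_eq_mul] at this
  rw [← this]
  show SS j (lapD h) = 0
  rw [hh.2]; simp

def rhoPQ (p q : ℕ) : ℕ → ℂ
  | 0 => 1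
  | j + 1 => - (((p:ℂ) - j) * ((q:ℂ) - j) / (j + 1)) * rhoPQ p q j

def evL {n : ℕ} (z : EuclideanSpace ℂ (Fin n)) : Pol n →ₗ[ℂ] ℂ where
  toFun P := ev P z
  map_add' P Q := ev_add P Q z
  map_smul' c P := by simp [ev]

lemma ev_monomial {n : ℕ} (m : Fin n ⊕ Fin n →₀ ℕ) (c : ℂ) (z : EuclideanSpace ℂ (Fin n)) :
    ev (MvPolynomial.monomial m c) z
      = c * ((∏ i, z i ^ m (Sum.inl i)) * ∏ i, (starRingEnd ℂ (z i)) ^ m (Sum.inr i)) := by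
  unfold ev
  rw [MvPolynomial.eval_monomial, Finsupp.prod_fintype _ _ (by simp), Fintype.prod_sum_type]
  simp [evPt]

lemma SS_zero {d p q : ℕ} {h : Pol (d+1)} (hh : Bihom p q h) :
    SS 0 h = ev h (EuclideanSpace.single 0 1) := by
  have := bihom_lin_ext hh (SS 0) (evL (EuclideanSpace.single 0 1)) (by
    intro m c _ _
    rw [SS_monomial]
    show _ = ev _ _
    rw [ev_monomial, Fin.prod_univ_succ, Fin.prod_univ_succ]
    congr 1
    have e : ∀ i : Fin d, (EuclideanSpace.single (0 : Fin (d+1)) (1:ℂ)).ofLp i.succ = 0 := by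
      intro i; simp [Fin.succ_ne_zero]
    have e0 : (EuclideanSpace.single (0 : Fin (d+1)) (1:ℂ)).ofLp 0 = 1 := by simp
    simp only [e, e0, map_one, map_zero, one_pow, one_mul]
    unfold wS
    split_ifs with hc
    · have hz : ∀ i : Fin d, m (Sum.inl i.succ) = 0 := fun i =>
        Finset.sum_eq_zero_iff.1 hc.2 i (Finset.mem_univ _)
      have hz' : ∀ i : Fin d, m (Sum.inr i.succ) = 0 := fun i => (hc.1 i).symm.trans (hz i)
      simp [hz, hz']
    · by_cases h1 : ∀ i : Fin d, m (Sum.inl i.succ) = 0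
      · have : ∃ i : Fin d, m (Sum.inr i.succ) ≠ 0 := by
          by_contra h2
          push Not at h2
          exact hc ⟨fun i => (h1 i).trans (h2 i).symm, Finset.sum_eq_zero fun i _ => h1 i⟩
        obtain ⟨i, hi⟩ := this
        rw [Finset.prod_eq_zero (f := fun x : Fin d => (0:ℂ) ^ m (Sum.inr x.succ)) (Finset.mem_univ i) (by simp [hi])]
        simp
      · push Not at h1
        obtain ⟨i, hi⟩ := h1
        rw [Finset.prod_eq_zero (f := fun x : Fin d => (0:ℂ) ^ m (Sum.inl x.succ)) (Finset.mem_univ i) (by simp [hi])]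
        simp)
  exact this

lemma SS_eq {d p q : ℕ} {h : Pol (d+1)} (hh : HP p q h) (j : ℕ) :
    SS j h = rhoPQ p q j * ev h (EuclideanSpace.single 0 1) := by
  induction j with
  | zero => rw [SS_zero hh.1, rhoPQ, one_mul]
  | succ j ih =>
    have := SS_rec hh j
    have hj : (j:ℂ) + 1 ≠ 0 := by exact_mod_cast Nat.succ_ne_zero j
    rw [rhoPQ, mul_assoc, ← ih]
    field_simp
    linear_combination this

/-- Abstract Funk-Hecke: a functional of the right form on monomials acts on harmonics as
a multiple of the evaluation at `e_0`. -/
lemma funk_hecke_abs {d p q : ℕ} {h : Pol (d+1)} (hh : HP p q h) (L : Pol (d+1) →ₗ[ℂ] ℂ)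
    (A : ℕ → ℂ)
    (hL : ∀ m c, ∑ i, m (Sum.inl i) = p → ∑ i, m (Sum.inr i) = q →
      L (MvPolynomial.monomial m c) = c * ∑ j ∈ Finset.range (p + 1), A j * wS j m) :
    L h = (∑ j ∈ Finset.range (p + 1), A j * rhoPQ p q j) * ev h (EuclideanSpace.single 0 1) := by
  have := bihom_lin_ext hh.1 L (∑ j ∈ Finset.range (p + 1), A j • SS j) (by
    intro m c h1 h2
    rw [hL m c h1 h2, LinearMap.sum_apply, Finset.mul_sum]
    refine Finset.sum_congr rfl fun j _ => ?_
    rw [LinearMap.smul_apply, SS_monomial, smul_eq_mul]; ring)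
  rw [this, LinearMap.sum_apply, Finset.sum_mul]
  refine Finset.sum_congr rfl fun j _ => ?_
  rw [LinearMap.smul_apply, SS_eq hh, smul_eq_mul]; ring

end

section

lemma measurable_toLpV (n : ℕ) : Measurable (fun x : Fin n → ℂ => (WithLp.toLp 2 x : EuclideanSpace ℂ (Fin n))) :=
  (PiLp.continuous_toLp 2 _).measurable

lemma measurable_ofLpV (n : ℕ) : Measurable (fun x : EuclideanSpace ℂ (Fin n) => (x.ofLp : Fin n → ℂ)) :=
  (PiLp.continuous_ofLp 2 _).measurable

lemma measurable_coordV {n : ℕ} (i : Fin n) : Measurable (fun x : EuclideanSpace ℂ (Fin n) => x i) :=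
  (measurable_pi_apply i).comp (measurable_ofLpV n)

/-- Lebesgue measure on `ℂⁿ`. -/
def cvol (n : ℕ) : Measure (EuclideanSpace ℂ (Fin n)) :=
  (volume : Measure (Fin n → ℂ)).map (fun x => WithLp.toLp 2 x)

instance (n : ℕ) : (cvol n).IsAddHaarMeasure :=
  ContinuousLinearEquiv.isAddHaarMeasure_map (EuclideanSpace.equiv (Fin n) ℂ).symm volume

lemma lintegral_cvol {n : ℕ} {F : EuclideanSpace ℂ (Fin n) → ℝ≥0∞} (hF : Measurable F) :
    ∫⁻ z, F z ∂(cvol n) = ∫⁻ x : Fin n → ℂ, F (WithLp.toLp 2 x) := by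
  rw [cvol, lintegral_map hF (measurable_toLpV n)]

def consV {d : ℕ} (z : ℂ) (x : EuclideanSpace ℂ (Fin d)) : EuclideanSpace ℂ (Fin (d+1)) :=
  WithLp.toLp 2 (Fin.cons z x.ofLp)

@[simp] lemma consV_zero {d : ℕ} (z : ℂ) (x : EuclideanSpace ℂ (Fin d)) : consV z x 0 = z := rfl
@[simp] lemma consV_succ {d : ℕ} (z : ℂ) (x : EuclideanSpace ℂ (Fin d)) (i : Fin d) :
    consV z x i.succ = x i := rfl

lemma norm_sq_V {n : ℕ} (x : EuclideanSpace ℂ (Fin n)) : ‖x‖^2 = ∑ i, ‖x i‖^2 := by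
  rw [EuclideanSpace.norm_sq_eq]

lemma norm_consV {d : ℕ} (z : ℂ) (x : EuclideanSpace ℂ (Fin d)) :
    ‖consV z x‖^2 = ‖z‖^2 + ‖x‖^2 := by
  rw [norm_sq_V, norm_sq_V, Fin.sum_univ_succ]; simp

lemma measurable_consV {d : ℕ} : Measurable (fun p : ℂ × EuclideanSpace ℂ (Fin d) => consV p.1 p.2) := by
  apply (measurable_toLpV (d+1)).comp
  rw [measurable_pi_iff]
  intro i
  refine Fin.cases ?_ (fun i => ?_) i
  · simpa using measurable_fst
  · exact (measurable_coordV i).comp measurable_snd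

lemma lintegral_cvol_succ {d : ℕ} {F : EuclideanSpace ℂ (Fin (d+1)) → ℝ≥0∞} (hF : Measurable F) :
    ∫⁻ z, F z ∂(cvol (d+1)) = ∫⁻ z : ℂ, ∫⁻ x, F (consV z x) ∂(cvol d) := by
  rw [lintegral_cvol hF]
  have h := (volume_preserving_piFinSuccAbove (fun _ : Fin (d+1) => ℂ) 0).symm
  refine (h.lintegral_comp (hF.comp (measurable_toLpV (d+1)))).symm.trans ?_
  rw [Measure.volume_eq_prod, lintegral_prod]
  · congr 1; ext z
    have hmz : Measurable (fun x : EuclideanSpace ℂ (Fin d) => F (consV z x)) :=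
      hF.comp (measurable_consV.comp measurable_prodMk_left)
    rw [lintegral_cvol hmz]
    refine lintegral_congr fun x => ?_
    simp only [Function.comp]
    congr 2
    simp [MeasurableEquiv.piFinSuccAbove, Fin.insertNthEquiv]
  · exact ((hF.comp (measurable_toLpV (d+1))).comp (MeasurableEquiv.measurable _)).aemeasurable

/-- Gaussian moments in one complex variable. -/
lemma gauss_one (a : ℕ) : ∫⁻ z : ℂ, ENNReal.ofReal (Real.exp (-‖z‖^2) * ‖z‖^(2*a))
    = ENNReal.ofReal (Real.pi * a.factorial) := by
  have h := Complex.integral_rpow_mul_exp_neg_rpow (p := 2) (q := 2*a) (by norm_num)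
    (by have : (0:ℝ) ≤ a := by positivity
        linarith)
  have e : ((2*(a:ℝ)+2)/2) = a + 1 := by ring
  rw [e, Real.Gamma_nat_eq_factorial] at h
  have e2 : (fun x : ℂ => ‖x‖ ^ (2*(a:ℝ)) * Real.exp (-‖x‖ ^ (2:ℝ)))
      = fun z : ℂ => Real.exp (-‖z‖^2) * ‖z‖^(2*a) := by
    ext x
    rw [mul_comm]
    have := Real.rpow_natCast ‖x‖ (2*a)
    push_cast at this
    rw [this, Real.rpow_two]
  rw [e2] at h
  rw [← ofReal_integral_eq_lintegral_ofReal, h]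
  · congr 1; ring
  · apply Integrable.of_integral_ne_zero
    rw [h]; positivity
  · exact Filter.Eventually.of_forall fun z => by positivity

lemma gauss_prod {d : ℕ} (α : Fin d → ℕ) :
    ∫⁻ x, ENNReal.ofReal (Real.exp (-‖x‖^2)) * ∏ i, ENNReal.ofReal (‖x i‖^(2 * α i)) ∂(cvol d)
    = ENNReal.ofReal (Real.pi^d * ∏ i, ((α i).factorial : ℝ)) := by
  induction d with
  | zero =>
    rw [lintegral_cvol (by measurability)]
    simp [norm_sq_V, volume_pi]
  | succ d ih =>
    have hm : ∀ {d : ℕ} (α : Fin d → ℕ), Measurable (fun x : EuclideanSpace ℂ (Fin d) => ENNReal.ofReal (Real.exp (-‖x‖^2)) * ∏ i, ENNReal.ofReal (‖x i‖^(2 * α i))) := by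
      intro d α
      apply Measurable.mul
      · exact ENNReal.measurable_ofReal.comp (by fun_prop)
      · apply Finset.measurable_prod
        intro i _
        exact ENNReal.measurable_ofReal.comp ((measurable_coordV i).norm.pow_const _)
    rw [lintegral_cvol_succ (hm α)]
    have : ∀ z x, ENNReal.ofReal (Real.exp (-‖consV z x‖^2)) * ∏ i : Fin (d+1), ENNReal.ofReal (‖consV z x i‖^(2 * α i))
      = ENNReal.ofReal (Real.exp (-‖z‖^2) * ‖z‖^(2*α 0)) * (ENNReal.ofReal (Real.exp (-‖x‖^2)) * ∏ i : Fin d, ENNReal.ofReal (‖x i‖^(2 * α i.succ))) := by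
      intro z x
      rw [norm_consV, Fin.prod_univ_succ, neg_add, Real.exp_add, ENNReal.ofReal_mul (by positivity), ENNReal.ofReal_mul (by positivity)]
      simp only [consV_zero, consV_succ]
      ring
    simp_rw [this]
    simp_rw [lintegral_const_mul _ (hm fun i => α i.succ), ih]
    rw [lintegral_mul_const _ (by fun_prop), gauss_one, ← ENNReal.ofReal_mul (by positivity), Fin.prod_univ_succ]
    congr 1; ring

lemma finrankV (d : ℕ) : Module.finrank ℝ (EuclideanSpace ℂ (Fin d)) = 2 * d := by
  rw [← Module.finrank_mul_finrank ℝ ℂ, Complex.finrank_real_complex, finrank_euclideanSpace_fin]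

lemma sphere_split {d : ℕ} (hd : 1 ≤ d) (α : Fin d → ℕ) :
    ∃ c : ℝ≥0∞, ∀ Φ : ℝ → ℝ≥0∞, Measurable Φ →
    ∫⁻ x, Φ ‖x‖ * ∏ i, ENNReal.ofReal (‖x i‖^(2 * α i)) ∂(cvol d)
    = c * ∫⁻ r in Ioi (0:ℝ), Φ r * ENNReal.ofReal (r^(2*d-1+2*∑ i, α i)) := by
  haveI : Nonempty (Fin d) := ⟨⟨0, hd⟩⟩
  haveI : Nontrivial (EuclideanSpace ℂ (Fin d)) := inferInstance
  have hmp : Measurable (fun x : EuclideanSpace ℂ (Fin d) => ∏ i, ENNReal.ofReal (‖x i‖^(2 * α i))) := by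
    apply Finset.measurable_prod
    intro i _
    exact ENNReal.measurable_ofReal.comp ((measurable_coordV i).norm.pow_const _)
  refine ⟨∫⁻ w : sphere (0:EuclideanSpace ℂ (Fin d)) 1, ∏ i, ENNReal.ofReal (‖w.1 i‖^(2 * α i)) ∂((cvol d).toSphere), fun Φ hΦ => ?_⟩
  have h := (cvol d).measurePreserving_homeomorphUnitSphereProd
  set G : sphere (0:EuclideanSpace ℂ (Fin d)) 1 × Ioi (0:ℝ) → ℝ≥0∞ := fun p =>
    (∏ i, ENNReal.ofReal (‖p.1.1 i‖^(2 * α i))) * (Φ p.2.1 * ENNReal.ofReal (p.2.1^(2*∑ i, α i))) with hG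
  have hm1 : Measurable (fun w : sphere (0:EuclideanSpace ℂ (Fin d)) 1 => ∏ i, ENNReal.ofReal (‖w.1 i‖^(2 * α i))) :=
    hmp.comp measurable_subtype_coe
  have hm2 : Measurable (fun p : Ioi (0:ℝ) => Φ p.1 * ENNReal.ofReal (p.1^(2*∑ i, α i))) :=
    (hΦ.comp measurable_subtype_coe).mul (by fun_prop)
  have h2 := h.lintegral_comp (f := G) ((hm1.comp measurable_fst).mul (hm2.comp measurable_snd))
  rw [hG, lintegral_prod_mul hm1.aemeasurable hm2.aemeasurable] at h2
  have e1 : ∫⁻ x, Φ ‖x‖ * ∏ i, ENNReal.ofReal (‖x i‖^(2 * α i)) ∂(cvol d)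
     = ∫⁻ x : ({(0)}ᶜ : Set (EuclideanSpace ℂ (Fin d))), Φ ‖x.1‖ * ∏ i, ENNReal.ofReal (‖x.1 i‖^(2 * α i)) ∂((cvol d).comap (↑)) := by
    rw [lintegral_subtype_comap (measurableSet_singleton _).compl (fun x : EuclideanSpace ℂ (Fin d) => Φ ‖x‖ * ∏ i, ENNReal.ofReal (‖x i‖^(2 * α i))), restrict_compl_singleton]
  rw [e1]
  refine Eq.trans ?_ (h2.trans ?_)
  · refine lintegral_congr fun x => ?_
    have hx : ‖x.1‖ ≠ 0 := norm_ne_zero_iff.2 x.2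
    simp only [homeomorphUnitSphereProd_apply_fst_coe, homeomorphUnitSphereProd_apply_snd_coe]
    rw [mul_left_comm, mul_comm (∏ i, _)]
    congr 1
    rw [Finset.mul_sum, ← Finset.prod_pow_eq_pow_sum, ENNReal.ofReal_prod_of_nonneg (fun i _ => by positivity), ← Finset.prod_mul_distrib]
    refine Finset.prod_congr rfl fun i _ => ?_
    rw [← ENNReal.ofReal_mul (by positivity), ← mul_pow]
    simp only [PiLp.smul_apply, norm_smul, norm_inv, norm_norm]
    rw [mul_inv_cancel_left₀ hx]
  · congr 1
    rw [Measure.volumeIoiPow, lintegral_withDensity_eq_lintegral_mul _ (by fun_prop) hm2]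
    rw [finrankV]
    simp only [Pi.mul_apply]
    rw [lintegral_subtype_comap measurableSet_Ioi (fun r : ℝ => ENNReal.ofReal (r ^ (2*d-1)) * (Φ r * ENNReal.ofReal (r^(2*∑ i, α i))))]
    refine setLIntegral_congr_fun measurableSet_Ioi fun r hr => ?_
    have hr : 0 < r := hr
    rw [pow_add, ENNReal.ofReal_mul (by positivity)]
    ring

end

section

def gaussR (k : ℕ) : ℝ≥0∞ := ∫⁻ r in Ioi (0:ℝ), ENNReal.ofReal (Real.exp (-r^2)) * ENNReal.ofReal (r^k)

lemma gaussR_val (k : ℕ) : ∃ x : ℝ, 0 < x ∧ gaussR k = ENNReal.ofReal x := by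
  have hk : (-1:ℝ) < k := by have : (0:ℝ) ≤ k := by positivity
                             linarith
  have h := integral_rpow_mul_exp_neg_rpow (p := 2) (q := k) (by norm_num) hk
  have hpos : 0 < (1/2:ℝ) * Real.Gamma ((k+1)/2) := mul_pos (by norm_num) (Real.Gamma_pos_of_pos (by linarith))
  refine ⟨_, hpos, ?_⟩
  rw [← h, ofReal_integral_eq_lintegral_ofReal]
  · unfold gaussR
    refine setLIntegral_congr_fun measurableSet_Ioi fun r hr => ?_
    have hr : 0 < r := hr
    simp only [Real.rpow_natCast, Real.rpow_two]
    rw [mul_comm, ENNReal.ofReal_mul (by positivity)]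
  · apply Integrable.of_integral_ne_zero
    rw [h]; exact hpos.ne'
  · filter_upwards [ae_restrict_mem measurableSet_Ioi] with r hr
    have hr : 0 < r := hr
    simp only [Pi.zero_apply]
    positivity

lemma gaussR_ne_zero (k : ℕ) : gaussR k ≠ 0 := by
  obtain ⟨x, hx, h⟩ := gaussR_val k
  rw [h]; simpa using hx

lemma gaussR_ne_top (k : ℕ) : gaussR k ≠ ∞ := by
  obtain ⟨x, hx, h⟩ := gaussR_val k
  rw [h]; simp

lemma lemmaA {d : ℕ} (hd : 1 ≤ d) (α : Fin d → ℕ) (Φ : ℝ → ℝ≥0∞) (hΦ : Measurable Φ) :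
    ∫⁻ x, Φ ‖x‖ * ∏ i, ENNReal.ofReal (‖x i‖^(2 * α i)) ∂(cvol d)
    = ENNReal.ofReal (Real.pi^d * ∏ i, ((α i).factorial : ℝ)) / gaussR (2*d-1+2*∑ i, α i)
     * ∫⁻ r in Ioi (0:ℝ), Φ r * ENNReal.ofReal (r^(2*d-1+2*∑ i, α i)) := by
  obtain ⟨c, hc⟩ := sphere_split hd α
  have h1 := hc (fun r => ENNReal.ofReal (Real.exp (-r^2))) (by fun_prop)
  rw [gauss_prod] at h1
  change _ = c * gaussR _ at h1
  rw [hc Φ hΦ, h1, ENNReal.mul_div_cancel_right (gaussR_ne_zero _) (gaussR_ne_top _)]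

lemma lintegral_complex_radial {F : ℝ → ℝ≥0∞} (hF : Measurable F) :
    ∫⁻ z : ℂ, F ‖z‖ = ENNReal.ofReal (2 * Real.pi) * ∫⁻ r in Ioi (0:ℝ), ENNReal.ofReal r * F r := by
  rw [← Complex.lintegral_comp_polarCoord_symm, polarCoord_target]
  simp_rw [Complex.norm_polarCoord_symm]
  rw [Measure.volume_eq_prod, ← Measure.prod_restrict, lintegral_prod]
  · simp only [smul_eq_mul, lintegral_const, Measure.restrict_apply MeasurableSet.univ, univ_inter, Real.volume_Ioo]
    rw [← lintegral_const_mul _ (by fun_prop)]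
    refine setLIntegral_congr_fun measurableSet_Ioi fun r hr => ?_
    have hr : 0 < r := hr
    simp only [abs_of_pos hr]
    rw [mul_comm]; congr 2; ring
  · apply Measurable.aemeasurable; simp only [smul_eq_mul]; fun_prop

lemma quad_polar {H : ℝ × ℝ → ℝ≥0∞} (hH : Measurable H) :
    ∫⁻ ρ in Ioi (0:ℝ), ∫⁻ r in Ioi (0:ℝ), H (ρ, r) =
    ∫⁻ t in Ioo (0:ℝ) (Real.pi/2), ∫⁻ R in Ioi (0:ℝ), ENNReal.ofReal R * H (R * Real.cos t, R * Real.sin t) := by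
  have hms : MeasurableSet (Ioi (0:ℝ) ×ˢ Ioi (0:ℝ)) := measurableSet_Ioi.prod measurableSet_Ioi
  rw [← lintegral_prod (μ := volume.restrict (Ioi (0:ℝ))) (ν := volume.restrict (Ioi (0:ℝ))) H hH.aemeasurable,
    Measure.prod_restrict, ← Measure.volume_eq_prod, ← lintegral_indicator hms,
    ← lintegral_comp_polarCoord_symm, polarCoord_target]
  have hm2 : Measurable (fun p : ℝ × ℝ => ENNReal.ofReal p.1 * H (p.1 * Real.cos p.2, p.1 * Real.sin p.2)) := by
    apply Measurable.mul (by fun_prop)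
    exact hH.comp (by fun_prop)
  rw [← lintegral_prod_symm' (μ := volume.restrict (Ioi (0:ℝ))) (ν := volume.restrict (Ioo (0:ℝ) (Real.pi/2)))
    (fun p : ℝ × ℝ => ENNReal.ofReal p.1 * H (p.1 * Real.cos p.2, p.1 * Real.sin p.2)) hm2,
    Measure.prod_restrict, ← Measure.volume_eq_prod,
    ← lintegral_indicator (measurableSet_Ioi.prod measurableSet_Ioo),
    ← lintegral_indicator (measurableSet_Ioi.prod measurableSet_Ioo)]
  refine lintegral_congr fun p => ?_
  obtain ⟨R, t⟩ := p
  by_cases h1 : 0 < R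
  swap
  · simp [indicator, h1]
  have key : (t ∈ Ioo (-Real.pi) Real.pi ∧ 0 < Real.cos t ∧ 0 < Real.sin t) ↔ t ∈ Ioo 0 (Real.pi/2) := by
    have hpi := Real.pi_pos
    constructor
    · rintro ⟨⟨a, b⟩, c, s⟩
      constructor
      · by_contra hh
        push Not at hh
        have := Real.sin_nonpos_of_nonpos_of_neg_pi_le hh a.le
        linarith
      · by_contra hh
        push Not at hh
        have := Real.cos_nonpos_of_pi_div_two_le_of_le hh (by linarith)
        linarith
    · rintro ⟨a, b⟩
      exact ⟨⟨by linarith, by linarith⟩, Real.cos_pos_of_mem_Ioo ⟨by linarith, b⟩, Real.sin_pos_of_pos_of_lt_pi a (by linarith)⟩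
  by_cases h2 : t ∈ Ioo 0 (Real.pi/2)
  · obtain ⟨k1, k2, k3⟩ := key.2 h2
    rw [indicator_of_mem (show (R,t) ∈ Ioi (0:ℝ) ×ˢ Ioo (-Real.pi) Real.pi from ⟨h1, k1⟩),
      indicator_of_mem (show (R,t) ∈ Ioi (0:ℝ) ×ˢ Ioo (0:ℝ) (Real.pi/2) from ⟨h1, h2⟩)]
    simp only [polarCoord_symm_apply]
    rw [indicator_of_mem (show (R * Real.cos t, R * Real.sin t) ∈ Ioi (0:ℝ) ×ˢ Ioi (0:ℝ) from ⟨mul_pos h1 k2, mul_pos h1 k3⟩)]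
    rfl
  · rw [indicator_of_notMem (s := Ioi (0:ℝ) ×ˢ Ioo (0:ℝ) (Real.pi/2)) (fun hh => h2 hh.2)]
    by_cases h3 : t ∈ Ioo (-Real.pi) Real.pi
    · rw [indicator_of_mem (show (R,t) ∈ Ioi (0:ℝ) ×ˢ Ioo (-Real.pi) Real.pi from ⟨h1, h3⟩)]
      simp only [polarCoord_symm_apply]
      rw [indicator_of_notMem]
      · simp
      · rintro ⟨a, b⟩
        exact h2 (key.1 ⟨h3, by simpa [h1] using a, by simpa [h1] using b⟩)
    · rw [indicator_of_notMem (fun hh => h3 hh.2)]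

/-- the (unnormalized) rotation invariant measure on the sphere. -/
def sig (n : ℕ) : Measure (EuclideanSpace ℂ (Fin n)) :=
  ((cvol n).withDensity (fun z => ENNReal.ofReal (Real.exp (-‖z‖^2)))).map (fun z => (‖z‖⁻¹ : ℝ) • z)

lemma measurable_normalize (n : ℕ) : Measurable (fun z : EuclideanSpace ℂ (Fin n) => (‖z‖⁻¹ : ℝ) • z) :=
  (measurable_norm.inv).smul measurable_id

lemma lintegral_sig {n : ℕ} {F : EuclideanSpace ℂ (Fin n) → ℝ≥0∞} (hF : Measurable F) :
    ∫⁻ w, F w ∂(sig n) = ∫⁻ z, ENNReal.ofReal (Real.exp (-‖z‖^2)) * F ((‖z‖⁻¹ : ℝ) • z) ∂(cvol n) := by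
  have hm : Measurable (fun z : EuclideanSpace ℂ (Fin n) => F ((‖z‖⁻¹ : ℝ) • z)) := hF.comp (measurable_normalize n)
  rw [sig, lintegral_map hF (measurable_normalize n), lintegral_withDensity_eq_lintegral_mul _ (by fun_prop) hm]
  rfl

/-- the constant of Lemma M. -/
def gC (d j : ℕ) : ℝ≥0∞ := ENNReal.ofReal (2 * Real.pi) * (ENNReal.ofReal (Real.pi^d) / gaussR (2*d-1+2*j)) * gaussR (2*d+1)

lemma gC_ne_zero (d j : ℕ) : gC d j ≠ 0 := by
  unfold gC
  have := Real.pi_pos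
  refine mul_ne_zero (mul_ne_zero ?_ (ENNReal.div_ne_zero.2 ⟨?_, gaussR_ne_top _⟩)) (gaussR_ne_zero _)
  · simpa using this
  · simp; positivity

lemma gC_ne_top (d j : ℕ) : gC d j ≠ ∞ := by
  unfold gC
  refine ENNReal.mul_ne_top (ENNReal.mul_ne_top ENNReal.ofReal_ne_top (ENNReal.div_ne_top ENNReal.ofReal_ne_top (gaussR_ne_zero _))) (gaussR_ne_top _)


def psiM (κ : ℝ → ℝ≥0∞) (j : ℕ) (ρ r : ℝ) : ℝ≥0∞ := ENNReal.ofReal (Real.exp (-(ρ^2 + r^2))) *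
    (κ ((√(ρ^2+r^2))⁻¹ * ρ) * ENNReal.ofReal ((√(ρ^2+r^2))⁻¹^(2*j)))

lemma measurable_psiM {κ : ℝ → ℝ≥0∞} (hκ : Measurable κ) (j : ℕ) :
    Measurable (fun p : ℝ × ℝ => psiM κ j p.1 p.2) := by
  unfold psiM
  refine Measurable.mul (by fun_prop) (Measurable.mul (hκ.comp (by fun_prop)) (by fun_prop))

lemma measurable_psiM' {κ : ℝ → ℝ≥0∞} (hκ : Measurable κ) (j : ℕ) (ρ : ℝ) :
    Measurable (fun r : ℝ => psiM κ j ρ r) := by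
  unfold psiM
  refine Measurable.mul (by fun_prop) (Measurable.mul (hκ.comp (by fun_prop)) (by fun_prop))

lemma psiM_step1 {d : ℕ} (α : Fin d → ℕ) (κ : ℝ → ℝ≥0∞) (z : ℂ) (x : EuclideanSpace ℂ (Fin d)) :
    ENNReal.ofReal (Real.exp (-‖consV z x‖^2)) *
      (κ ‖((‖consV z x‖⁻¹ : ℝ) • consV z x) 0‖ * ∏ i : Fin d, ENNReal.ofReal (‖((‖consV z x‖⁻¹ : ℝ) • consV z x) i.succ‖^(2 * α i)))
      = psiM κ (∑ i, α i) ‖z‖ ‖x‖ * ∏ i, ENNReal.ofReal (‖x i‖^(2 * α i)) := by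
  have hn : ‖consV z x‖ = √(‖z‖^2+‖x‖^2) := by
    rw [← norm_consV, Real.sqrt_sq (norm_nonneg _)]
  simp only [PiLp.smul_apply, norm_smul, norm_inv, norm_norm, consV_zero, consV_succ, psiM, norm_consV]
  rw [hn, mul_assoc, mul_assoc]
  congr 2
  rw [Finset.mul_sum, ← Finset.prod_pow_eq_pow_sum, ENNReal.ofReal_prod_of_nonneg (fun i _ => by positivity), ← Finset.prod_mul_distrib]
  refine Finset.prod_congr rfl fun i _ => ?_
  rw [← ENNReal.ofReal_mul (by positivity), ← mul_pow]

lemma psiM_polar {d : ℕ} (hd : 1 ≤ d) (κ : ℝ → ℝ≥0∞) (j : ℕ) (t : ℝ) (ht : t ∈ Ioo (0:ℝ) (Real.pi/2)) :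
    ∫⁻ R in Ioi (0:ℝ), ENNReal.ofReal R * (ENNReal.ofReal (R * Real.cos t) * (psiM κ j (R * Real.cos t) (R * Real.sin t) * ENNReal.ofReal ((R * Real.sin t)^(2*d-1+2*j))))
     = gaussR (2*d+1) * (κ (Real.cos t) * ENNReal.ofReal (Real.cos t * Real.sin t^(2*d-1+2*j))) := by
  have hc : 0 < Real.cos t := Real.cos_pos_of_mem_Ioo ⟨by linarith [ht.1, Real.pi_pos], ht.2⟩
  have hs : 0 < Real.sin t := Real.sin_pos_of_pos_of_lt_pi ht.1 (by linarith [ht.2, Real.pi_pos])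
  unfold gaussR
  rw [← lintegral_mul_const _ (by fun_prop)]
  refine setLIntegral_congr_fun measurableSet_Ioi fun R hR => ?_
  have hR : 0 < R := hR
  have e1 : (R * Real.cos t)^2 + (R * Real.sin t)^2 = R^2 := by
    have := Real.sin_sq_add_cos_sq t
    linear_combination R^2 * this
  have e2 : √(R^2) = R := Real.sqrt_sq hR.le
  simp only [psiM, e1, e2]
  rw [inv_mul_cancel_left₀ hR.ne']
  have e3 : ENNReal.ofReal R * ENNReal.ofReal (R * Real.cos t) * ENNReal.ofReal (R⁻¹^(2*j)) * ENNReal.ofReal ((R * Real.sin t)^(2*d-1+2*j))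
     = ENNReal.ofReal (R^(2*d+1)) * ENNReal.ofReal (Real.cos t * Real.sin t^(2*d-1+2*j)) := by
    rw [← ENNReal.ofReal_mul (by positivity), ← ENNReal.ofReal_mul (by positivity), ← ENNReal.ofReal_mul (by positivity), ← ENNReal.ofReal_mul (by positivity)]
    congr 1
    have : R^(2*d+1) = R^2 * R^(2*d-1) := by rw [← pow_add]; congr 1; omega
    rw [this, inv_pow, mul_pow, pow_add, pow_add]
    field_simp
  calc _ = ENNReal.ofReal (Real.exp (-R^2)) * κ (Real.cos t) * (ENNReal.ofReal R * ENNReal.ofReal (R * Real.cos t) * ENNReal.ofReal (R⁻¹^(2*j)) * ENNReal.ofReal ((R * Real.sin t)^(2*d-1+2*j))) := by ring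
    _ = _ := by rw [e3]; ring

lemma psiM_total {d : ℕ} (hd : 1 ≤ d) (κ : ℝ → ℝ≥0∞) (hκ : Measurable κ) (j : ℕ) :
    ∫⁻ z : ℂ, ∫⁻ r in Ioi (0:ℝ), psiM κ j ‖z‖ r * ENNReal.ofReal (r^(2*d-1+2*j))
    = ENNReal.ofReal (2 * Real.pi) * (gaussR (2*d+1) * ∫⁻ t in Ioo (0:ℝ) (Real.pi/2), κ (Real.cos t) * ENNReal.ofReal (Real.cos t * Real.sin t^(2*d-1+2*j))) := by
  have hΨm := measurable_psiM hκ j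
  have hm2 : Measurable (fun p : ℝ × ℝ => psiM κ j p.1 p.2 * ENNReal.ofReal (p.2^(2*d-1+2*j))) :=
    hΨm.mul (by fun_prop)
  have hm3 : Measurable (fun ρ : ℝ => ∫⁻ r in Ioi (0:ℝ), psiM κ j ρ r * ENNReal.ofReal (r^(2*d-1+2*j))) :=
    hm2.lintegral_prod_right'
  rw [lintegral_complex_radial hm3]
  have h5 : ∫⁻ r in Ioi (0:ℝ), ENNReal.ofReal r * ∫⁻ s in Ioi (0:ℝ), psiM κ j r s * ENNReal.ofReal (s^(2*d-1+2*j))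
      = ∫⁻ r in Ioi (0:ℝ), ∫⁻ s in Ioi (0:ℝ), (fun p : ℝ × ℝ => ENNReal.ofReal p.1 * (psiM κ j p.1 p.2 * ENNReal.ofReal (p.2^(2*d-1+2*j)))) (r, s) := by
    refine lintegral_congr fun r => ?_
    rw [← lintegral_const_mul]
    have hm7 : Measurable (fun s => psiM κ j r s * ENNReal.ofReal (s^(2*d-1+2*j))) :=
       (measurable_psiM' hκ j r).mul (by fun_prop)
    exact hm7
  have hm6 : Measurable (fun p : ℝ × ℝ => ENNReal.ofReal p.1 * (psiM κ j p.1 p.2 * ENNReal.ofReal (p.2^(2*d-1+2*j)))) :=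
    (ENNReal.measurable_ofReal.comp measurable_fst).mul hm2
  rw [h5, quad_polar hm6]
  congr 1
  have hm8 : Measurable (fun t => κ (Real.cos t) * ENNReal.ofReal (Real.cos t * Real.sin t^(2*d-1+2*j))) :=
    (hκ.comp Real.measurable_cos).mul (by fun_prop)
  rw [← lintegral_const_mul _ hm8]
  exact setLIntegral_congr_fun measurableSet_Ioo fun t ht => psiM_polar hd κ j t ht

lemma lemmaM {d : ℕ} (hd : 1 ≤ d) (α : Fin d → ℕ) (κ : ℝ → ℝ≥0∞) (hκ : Measurable κ) :
    ∫⁻ w, κ ‖w 0‖ * ∏ i : Fin d, ENNReal.ofReal (‖w i.succ‖^(2 * α i)) ∂(sig (d+1))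
    = gC d (∑ i, α i) * ENNReal.ofReal (∏ i, ((α i).factorial : ℝ)) *
      ∫⁻ t in Ioo (0:ℝ) (Real.pi/2), κ (Real.cos t) * ENNReal.ofReal (Real.cos t * Real.sin t^(2*d-1+2*∑ i, α i)) := by
  have hm0 : Measurable (fun w : EuclideanSpace ℂ (Fin (d+1)) => κ ‖w 0‖ * ∏ i : Fin d, ENNReal.ofReal (‖w i.succ‖^(2 * α i))) := by
    apply Measurable.mul (hκ.comp (measurable_coordV 0).norm)
    apply Finset.measurable_prod
    intro i _
    exact ENNReal.measurable_ofReal.comp ((measurable_coordV i.succ).norm.pow_const _)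
  have hm1 : Measurable (fun z : EuclideanSpace ℂ (Fin (d+1)) => ENNReal.ofReal (Real.exp (-‖z‖ ^ 2)) *
        (κ ‖(‖z‖⁻¹ • z).ofLp 0‖ * ∏ i : Fin d, ENNReal.ofReal (‖(‖z‖⁻¹ • z).ofLp i.succ‖ ^ (2 * α i)))) :=
    Measurable.mul (by fun_prop) (hm0.comp (measurable_normalize _))
  rw [lintegral_sig hm0, lintegral_cvol_succ hm1]
  simp_rw [psiM_step1]
  have hA : ∀ z : ℂ, ∫⁻ x, psiM κ (∑ i, α i) ‖z‖ ‖x‖ * ∏ i, ENNReal.ofReal (‖x i‖^(2 * α i)) ∂(cvol d)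
    = ENNReal.ofReal (Real.pi^d * ∏ i, ((α i).factorial : ℝ)) / gaussR (2*d-1+2*∑ i, α i)
     * ∫⁻ r in Ioi (0:ℝ), psiM κ (∑ i, α i) ‖z‖ r * ENNReal.ofReal (r^(2*d-1+2*∑ i, α i)) := by
    intro z
    exact lemmaA hd α _ (measurable_psiM' hκ _ _)
  rw [lintegral_congr hA]
  generalize (∑ i, α i) = j
  have hm2 : Measurable (fun p : ℝ × ℝ => psiM κ j p.1 p.2 * ENNReal.ofReal (p.2^(2*d-1+2*j))) :=
    (measurable_psiM hκ j).mul (by fun_prop)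
  have hm3 : Measurable (fun ρ : ℝ => ∫⁻ r in Ioi (0:ℝ), psiM κ j ρ r * ENNReal.ofReal (r^(2*d-1+2*j))) :=
    hm2.lintegral_prod_right'
  have hm4 : Measurable (fun z : ℂ => ∫⁻ r in Ioi (0:ℝ), psiM κ j ‖z‖ r * ENNReal.ofReal (r^(2*d-1+2*j))) :=
    hm3.comp measurable_norm
  rw [lintegral_const_mul _ hm4, psiM_total hd κ hκ]
  unfold gC
  generalize (∫⁻ t in Ioo (0:ℝ) (Real.pi/2), κ (Real.cos t) * ENNReal.ofReal (Real.cos t * Real.sin t^(2*d-1+2*j))) = I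
  rw [ENNReal.ofReal_mul (p := Real.pi^d) (by positivity), div_eq_mul_inv, div_eq_mul_inv]
  generalize gaussR (2*d+1) = g1
  generalize (gaussR (2*d-1+2*j))⁻¹ = g2
  ring

end

section

instance (n : ℕ) : IsFiniteMeasure (sig n) := by
  constructor
  have h := lintegral_sig (n := n) (F := fun _ => 1) measurable_const
  have h2 := gauss_prod (d := n) (fun _ => 0)
  simp only [lintegral_one, mul_one, mul_zero, pow_zero, ENNReal.ofReal_one, Finset.prod_const_one] at h h2
  rw [h, h2]
  exact ENNReal.ofReal_lt_top

lemma sig_ae_norm {n : ℕ} (hn : 1 ≤ n) : ∀ᵐ w ∂(sig n), ‖w‖ = 1 := by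
  haveI : Nonempty (Fin n) := ⟨⟨0, hn⟩⟩
  haveI : Nontrivial (EuclideanSpace ℂ (Fin n)) := inferInstance
  rw [sig, ae_map_iff (measurable_normalize n).aemeasurable (measurableSet_eq_fun (by fun_prop) (by fun_prop))]
  apply (withDensity_absolutelyContinuous _ _).ae_le
  have : ∀ᵐ z ∂(cvol n), z ∉ ({0} : Set (EuclideanSpace ℂ (Fin n))) := measure_eq_zero_iff_ae_notMem.1 (measure_singleton 0)
  filter_upwards [this] with z hz
  have : ‖z‖ ≠ 0 := norm_ne_zero_iff.2 hz
  rw [norm_smul, norm_inv, norm_norm, inv_mul_cancel₀ this]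

lemma measurable_lie {n : ℕ} (u : EuclideanSpace ℂ (Fin n) ≃ₗᵢ[ℂ] EuclideanSpace ℂ (Fin n)) : Measurable u :=
  u.continuous.measurable

lemma cvol_map {n : ℕ} (u : EuclideanSpace ℂ (Fin n) ≃ₗᵢ[ℂ] EuclideanSpace ℂ (Fin n)) :
    (cvol n).map u = cvol n := by
  haveI : ((cvol n).map u).IsAddHaarMeasure :=
    ContinuousLinearEquiv.isAddHaarMeasure_map (u.toContinuousLinearEquiv) (cvol n)
  have h := Measure.isAddLeftInvariant_eq_smul ((cvol n).map u) (cvol n)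
  have hb : ((cvol n).map u) (ball 0 1) = cvol n (ball 0 1) := by
    rw [Measure.map_apply (measurable_lie u) measurableSet_ball]
    congr 1; ext z; simp
  set c := Measure.addHaarScalarFactor ((cvol n).map u) (cvol n)
  rw [h] at hb ⊢
  have h0 : cvol n (ball 0 1) ≠ 0 := (measure_ball_pos _ _ one_pos).ne'
  have h1 : cvol n (ball 0 1) ≠ ∞ := measure_ball_lt_top.ne
  have hc : (c : ℝ≥0∞) = 1 := by
    have : (c : ℝ≥0∞) * cvol n (ball 0 1) = 1 * cvol n (ball 0 1) := by
      rw [one_mul]; exact hb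
    exact (ENNReal.mul_left_inj h0 h1).1 this
  have : c = 1 := by exact_mod_cast hc
  rw [this, one_smul]

lemma sig_map {n : ℕ} (u : EuclideanSpace ℂ (Fin n) ≃ₗᵢ[ℂ] EuclideanSpace ℂ (Fin n)) :
    (sig n).map u = sig n := by
  refine Measure.ext_of_lintegral _ fun F hF => ?_
  have hFu : Measurable (fun w => F (u w)) := hF.comp (measurable_lie u)
  rw [lintegral_map hF (measurable_lie u), lintegral_sig hFu, lintegral_sig hF]
  have hm : Measurable fun z => ENNReal.ofReal (Real.exp (-‖z‖^2)) * F ((‖z‖⁻¹ : ℝ) • z) :=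
    Measurable.mul (by fun_prop) (hF.comp (measurable_normalize n))
  conv_rhs => rw [← cvol_map u, lintegral_map hm (measurable_lie u)]
  refine lintegral_congr fun z => ?_
  simp only [LinearIsometryEquiv.norm_map, Function.comp]
  congr 2
  exact (u.toLinearIsometry.toContinuousLinearMap.restrictScalars ℝ).map_smul _ _

lemma integral_sig_comp {n : ℕ} (u : EuclideanSpace ℂ (Fin n) ≃ₗᵢ[ℂ] EuclideanSpace ℂ (Fin n)) 
    (F : EuclideanSpace ℂ (Fin n) → ℂ) : ∫ w, F (u w) ∂(sig n) = ∫ w, F w ∂(sig n) := by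
  have : MeasurePreserving u (sig n) (sig n) := ⟨measurable_lie u, sig_map u⟩
  exact this.integral_comp u.toHomeomorph.measurableEmbedding F

/-- multiplication of the i-th coordinate by a unimodular number. -/
def dPhase {n : ℕ} (i : Fin n) (c : ℂ) (hc : ‖c‖ = 1) : EuclideanSpace ℂ (Fin n) ≃ₗᵢ[ℂ] EuclideanSpace ℂ (Fin n) :=
  LinearIsometryEquiv.piLpCongrRight 2 (fun k => if k = i then
    ⟨LinearEquiv.smulOfNeZero ℂ ℂ c (by rintro rfl; simp at hc), fun x => by simp [hc]⟩
   else LinearIsometryEquiv.refl ℂ ℂ)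

lemma dPhase_apply {n : ℕ} (i : Fin n) (c : ℂ) (hc : ‖c‖ = 1) (z : EuclideanSpace ℂ (Fin n)) (k : Fin n) :
    dPhase i c hc z k = if k = i then c * z k else z k := by
  unfold dPhase
  simp only [LinearIsometryEquiv.piLpCongrRight_apply]
  split_ifs with h <;> rfl

lemma phase_vanish {n : ℕ} (κ : ℝ → ℂ) (i0 : Fin n) (m : Fin n ⊕ Fin n →₀ ℕ) (i : Fin n)
    (hi : m (Sum.inl i) ≠ m (Sum.inr i)) :
    ∫ w, κ ‖w i0‖ * ((∏ i, w i ^ m (Sum.inl i)) * ∏ i, (starRingEnd ℂ) (w i) ^ m (Sum.inr i)) ∂(sig n) = 0 := by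
  have h0 : (((m (Sum.inl i) : ℤ) - m (Sum.inr i) : ℤ) : ℂ) ≠ 0 := by
    rw [Int.cast_ne_zero]; omega
  set D : ℂ := (((m (Sum.inl i) : ℤ) - m (Sum.inr i) : ℤ) : ℂ) with hD
  set θ : ℝ := Real.pi / (((m (Sum.inl i) : ℤ) - m (Sum.inr i) : ℤ) : ℝ) with hθ
  set c : ℂ := Complex.exp (θ * Complex.I) with hc
  have hc1 : ‖c‖ = 1 := Complex.norm_exp_ofReal_mul_I θ
  have hk : c ^ m (Sum.inl i) * (starRingEnd ℂ) c ^ m (Sum.inr i) = -1 := by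
    rw [hc, ← Complex.exp_conj, ← Complex.exp_nat_mul, ← Complex.exp_nat_mul, ← Complex.exp_add, ← Complex.exp_pi_mul_I]
    congr 1
    simp only [map_mul, Complex.conj_ofReal, Complex.conj_I]
    have : (θ : ℂ) * D = Real.pi := by
      rw [hθ, hD]; push_cast; rw [div_mul_cancel₀]; rw [hD] at h0; exact_mod_cast h0
    rw [← this, hD]; push_cast; ring
  have h := integral_sig_comp (dPhase i c hc1) (fun w => κ ‖w i0‖ * ((∏ i, w i ^ m (Sum.inl i)) * ∏ i, (starRingEnd ℂ) (w i) ^ m (Sum.inr i)))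
  have e : ∀ w : EuclideanSpace ℂ (Fin n), κ ‖dPhase i c hc1 w i0‖ * ((∏ k, dPhase i c hc1 w k ^ m (Sum.inl k)) * ∏ k, (starRingEnd ℂ) (dPhase i c hc1 w k) ^ m (Sum.inr k))
     = - (κ ‖w i0‖ * ((∏ i, w i ^ m (Sum.inl i)) * ∏ i, (starRingEnd ℂ) (w i) ^ m (Sum.inr i))) := by
    intro w
    have e1 : ‖dPhase i c hc1 w i0‖ = ‖w i0‖ := by
      rw [dPhase_apply]; split_ifs <;> simp [hc1]
    have e2 : ∀ k, dPhase i c hc1 w k = (if k = i then c else 1) * w k := by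
      intro k; rw [dPhase_apply]; split_ifs <;> simp
    rw [e1]
    simp only [e2, mul_pow, map_mul, Finset.prod_mul_distrib]
    have e3 : ∏ k, (if k = i then c else 1) ^ m (Sum.inl k) = c ^ m (Sum.inl i) := by
      rw [Finset.prod_eq_single i] <;> simp +contextual
    have e4 : ∏ k, (starRingEnd ℂ) (if k = i then c else 1) ^ m (Sum.inr k) = (starRingEnd ℂ) c ^ m (Sum.inr i) := by
      rw [Finset.prod_eq_single i] <;> simp +contextual
    rw [e3, e4]
    linear_combination (κ ‖w i0‖ * ((∏ i, w i ^ m (Sum.inl i)) * ∏ i, (starRingEnd ℂ) (w i) ^ m (Sum.inr i))) * hk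
  simp only [e] at h
  rw [integral_neg] at h
  have h2 : (2:ℂ) * ∫ w, κ ‖w i0‖ * ((∏ i, w i ^ m (Sum.inl i)) * ∏ i, (starRingEnd ℂ) (w i) ^ m (Sum.inr i)) ∂(sig n) = 0 := by
    linear_combination -h
  simpa using h2

lemma lemmaM_int {d : ℕ} (hd : 1 ≤ d) (α : Fin d → ℕ) (κ : ℝ → ℂ) (hκ : Measurable κ) :
    ∫ w, κ ‖w 0‖ * ((∏ i : Fin d, ‖w i.succ‖^(2 * α i) : ℝ) : ℂ) ∂(sig (d+1))
    = (gC d (∑ i, α i)).toReal * (∏ i, ((α i).factorial : ℂ)) *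
      ∫ t in Ioo (0:ℝ) (Real.pi/2), κ (Real.cos t) * ((Real.cos t * Real.sin t^(2*d-1+2*∑ i, α i) : ℝ) : ℂ) := by
  set k := 2*d-1+2*∑ i, α i with hk
  set ρ1 : Measure ℝ := ((sig (d+1)).withDensity (fun w => ∏ i : Fin d, ENNReal.ofReal (‖w i.succ‖^(2 * α i)))).map (fun w => ‖w 0‖) with hρ1
  set C : ℝ≥0∞ := gC d (∑ i, α i) * ENNReal.ofReal (∏ i, ((α i).factorial : ℝ)) with hC
  set ρ2 : Measure ℝ := C • ((volume.restrict (Ioo (0:ℝ) (Real.pi/2))).withDensity (fun t => ENNReal.ofReal (Real.cos t * Real.sin t^k))).map Real.cos with hρ2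
  have m1 : Measurable (fun w : EuclideanSpace ℂ (Fin (d+1)) => ‖w 0‖) := (measurable_coordV 0).norm
  have m2 : Measurable (fun w : EuclideanSpace ℂ (Fin (d+1)) => ∏ i : Fin d, ENNReal.ofReal (‖w i.succ‖^(2 * α i))) := by
    apply Finset.measurable_prod
    intro i _
    exact ENNReal.measurable_ofReal.comp ((measurable_coordV i.succ).norm.pow_const _)
  have m3 : Measurable (fun t => ENNReal.ofReal (Real.cos t * Real.sin t^k)) := by fun_prop
  have heq : ρ1 = ρ2 := by
    refine Measure.ext_of_lintegral _ fun F hF => ?_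
    have m4 : Measurable (fun w : EuclideanSpace ℂ (Fin (d+1)) => F ‖w 0‖) := hF.comp m1
    have m5 : Measurable (fun t => F (Real.cos t)) := hF.comp Real.measurable_cos
    rw [hρ1, hρ2, lintegral_map hF m1, lintegral_smul_measure, lintegral_map hF Real.measurable_cos,
      lintegral_withDensity_eq_lintegral_mul _ m2 m4, lintegral_withDensity_eq_lintegral_mul _ m3 m5]
    have := lemmaM hd α F hF
    simp only [Pi.mul_apply, mul_comm (∏ i : Fin d, _) _]
    rw [this, smul_eq_mul]
    simp only [mul_comm (F _)]
    rw [hC]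
  have h1 : ∫ x, κ x ∂ρ1 = ∫ w, κ ‖w 0‖ * ((∏ i : Fin d, ‖w i.succ‖^(2 * α i) : ℝ) : ℂ) ∂(sig (d+1)) := by
    rw [hρ1, integral_map m1.aemeasurable hκ.aestronglyMeasurable,
      integral_withDensity_eq_integral_toReal_smul m2]
    · refine integral_congr_ae (Filter.Eventually.of_forall fun w => ?_)
      simp only
      rw [← ENNReal.ofReal_prod_of_nonneg (fun i _ => by positivity), ENNReal.toReal_ofReal (Finset.prod_nonneg fun i _ => by positivity)]
      rw [Complex.real_smul, mul_comm]
    · refine Filter.Eventually.of_forall fun w => ?_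
      exact ENNReal.prod_lt_top fun i _ => ENNReal.ofReal_lt_top
  have h2 : ∫ x, κ x ∂ρ2 = C.toReal * ∫ t in Ioo (0:ℝ) (Real.pi/2), κ (Real.cos t) * ((Real.cos t * Real.sin t^k : ℝ) : ℂ) := by
    rw [hρ2, integral_smul_measure, integral_map Real.measurable_cos.aemeasurable hκ.aestronglyMeasurable,
      integral_withDensity_eq_integral_toReal_smul m3 (Filter.Eventually.of_forall fun t => ENNReal.ofReal_lt_top)]
    rw [Complex.real_smul]
    congr 1
    refine setIntegral_congr_fun measurableSet_Ioo fun t ht => ?_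
    have hc : 0 < Real.cos t := Real.cos_pos_of_mem_Ioo ⟨by linarith [ht.1, Real.pi_pos], ht.2⟩
    have hs : 0 < Real.sin t := Real.sin_pos_of_pos_of_lt_pi ht.1 (by linarith [ht.2, Real.pi_pos])
    rw [ENNReal.toReal_ofReal (by positivity), Complex.real_smul, mul_comm]
  rw [← h1, heq, h2, hC, ENNReal.toReal_mul, ENNReal.toReal_ofReal (by positivity)]
  push_cast
  ring

end

section

def ktR (N : ℕ) (c : ℂ) : ℝ := ‖∑ i ∈ Finset.range N, c^i‖^2 / N

lemma ktR_eq (N : ℕ) (c : ℂ) : (ktR N c : ℂ) =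
    ∑ i ∈ Finset.range N, ∑ i' ∈ Finset.range N, (1/N : ℂ) * (c^i * (starRingEnd ℂ) c ^ i') := by
  unfold ktR
  push_cast
  rw [← Complex.mul_conj', map_sum, Finset.sum_mul_sum, Finset.sum_div]
  refine Finset.sum_congr rfl fun i _ => ?_
  rw [Finset.sum_div]
  refine Finset.sum_congr rfl fun i' _ => ?_
  rw [map_pow]; ring

lemma continuous_ktR (N : ℕ) : Continuous (ktR N) := by unfold ktR; fun_prop

lemma ktR_conj (N : ℕ) (c : ℂ) : ktR N ((starRingEnd ℂ) c) = ktR N c := by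
  unfold ktR
  have : ∑ i ∈ Finset.range N, (starRingEnd ℂ) c^i = (starRingEnd ℂ) (∑ i ∈ Finset.range N, c^i) := by simp
  rw [this, RCLike.norm_conj]

def vint (d : ℕ) (κ : ℝ → ℝ) (a j : ℕ) : ℂ :=
  (gC d j).toReal * ∫ t in Ioo (0:ℝ) (Real.pi/2), ((κ (Real.cos t) * Real.cos t^(2*a) : ℝ) : ℂ) * ((Real.cos t * Real.sin t^(2*d-1+2*j) : ℝ) : ℂ)

lemma mono_int {d : ℕ} (hd : 1 ≤ d) (κ : ℝ → ℝ) (hκ : Measurable κ) (m : Fin (d+1) ⊕ Fin (d+1) →₀ ℕ) :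
    ∫ w, (κ ‖w 0‖ : ℂ) * ((∏ i, w i ^ m (Sum.inl i)) * ∏ i, (starRingEnd ℂ) (w i) ^ m (Sum.inr i)) ∂(sig (d+1))
    = if ∀ i, m (Sum.inl i) = m (Sum.inr i) then
      (∏ i : Fin d, ((m (Sum.inl i.succ)).factorial : ℂ)) * vint d κ (m (Sum.inl 0)) (∑ i : Fin d, m (Sum.inl i.succ)) else 0 := by
  split_ifs with h
  swap
  · push Not at h
    obtain ⟨i, hi⟩ := h
    exact phase_vanish (fun x => (κ x : ℂ)) 0 m i hi
  have hm : Measurable (fun x : ℝ => ((κ x * x^(2*m (Sum.inl 0)) : ℝ) : ℂ)) :=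
    Complex.measurable_ofReal.comp (hκ.mul (by fun_prop))
  have := lemmaM_int hd (fun i => m (Sum.inl i.succ)) _ hm
  rw [vint, ← mul_assoc, mul_comm (∏ i : Fin d, _) _, ← this]
  refine integral_congr_ae (Filter.Eventually.of_forall fun w => ?_)
  simp only
  simp only [← h]
  rw [← Finset.prod_mul_distrib, Fin.prod_univ_succ]
  have e : ∀ i k, w i ^ k * (starRingEnd ℂ) (w i) ^ k = ((‖w i‖^(2*k) : ℝ) : ℂ) := by
    intro i k
    rw [← mul_pow, Complex.mul_conj', pow_mul]; push_cast; rfl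
  simp only [e]
  push_cast
  ring

def FHlam (d : ℕ) (κ : ℝ → ℝ) (N p q : ℕ) : ℂ :=
  ∑ j ∈ Finset.range (p+1), (∑ i ∈ Finset.range N, ∑ i' ∈ Finset.range N,
    if i + p = i' + q then (1/N : ℂ) * vint d κ (i + p - j) j else 0) * rhoPQ p q j

def Kk (κ : ℝ → ℝ) (N : ℕ) (c : ℂ) : ℝ := κ ‖c‖ * ktR N c

lemma Kk_conj (κ : ℝ → ℝ) (N : ℕ) (c : ℂ) : Kk κ N ((starRingEnd ℂ) c) = Kk κ N c := by
  unfold Kk; rw [ktR_conj, RCLike.norm_conj]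

lemma measurable_Kk {κ : ℝ → ℝ} (hκ : Measurable κ) (N : ℕ) : Measurable (Kk κ N) :=
  (hκ.comp measurable_norm).mul (continuous_ktR N).measurable

lemma integrable_sig_bdd {n : ℕ} (hn : 1 ≤ n) {κ : ℝ → ℝ} (hκ : Measurable κ) {B : ℝ} (hB : ∀ x, |κ x| ≤ B)
    (i0 : Fin n) {g : EuclideanSpace ℂ (Fin n) → ℂ} (hg : Continuous g) :
    Integrable (fun w => (κ ‖w i0‖ : ℂ) * g w) (sig n) := by
  obtain ⟨C, hC⟩ := (isCompact_sphere (0 : EuclideanSpace ℂ (Fin n)) 1).exists_bound_of_continuousOn hg.continuousOn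
  have hC0 : 0 ≤ B := (abs_nonneg _).trans (hB 0)
  refine Integrable.of_bound (C := B * C) ?_ ?_
  · have h1 : Measurable (fun w : EuclideanSpace ℂ (Fin n) => (κ ‖w i0‖ : ℂ)) :=
      Complex.measurable_ofReal.comp (hκ.comp (measurable_coordV i0).norm)
    exact (h1.mul hg.measurable).aestronglyMeasurable
  · filter_upwards [sig_ae_norm hn] with w hw
    rw [norm_mul, Complex.norm_real]
    exact mul_le_mul (hB _) (hC w (by simpa using hw)) (norm_nonneg _) hC0

lemma funk_hecke_pole {d : ℕ} (hd : 1 ≤ d) {κ : ℝ → ℝ} (hκ : Measurable κ) {B : ℝ} (hB : ∀ x, |κ x| ≤ B)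
    (N : ℕ) {p q : ℕ} {h : Pol (d+1)} (hh : HP p q h) :
    ∫ w, (Kk κ N (w 0) : ℂ) * ev h w ∂(sig (d+1)) = FHlam d κ N p q * ev h (EuclideanSpace.single 0 1) := by
  classical
  have hcont : ∀ P : Pol (d+1), Continuous (ev P) := fun P => continuous_ev P
  have hkt : Continuous (fun w : EuclideanSpace ℂ (Fin (d+1)) => (ktR N (w 0) : ℂ)) :=
    Complex.continuous_ofReal.comp ((continuous_ktR N).comp (by fun_prop))
  have hintg : ∀ P : Pol (d+1), Integrable (fun w => (Kk κ N (w 0) : ℂ) * ev P w) (sig (d+1)) := by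
    intro P
    have := integrable_sig_bdd (n := d+1) (by omega) hκ hB 0 (hkt.mul (hcont P))
    refine this.congr (Filter.Eventually.of_forall fun w => ?_)
    simp only [Kk, Pi.mul_apply]; push_cast; ring
  let L : Pol (d+1) →ₗ[ℂ] ℂ :=
    { toFun := fun P => ∫ w, (Kk κ N (w 0) : ℂ) * ev P w ∂(sig (d+1))
      map_add' := fun P Q => by
        rw [← integral_add (hintg P) (hintg Q)]
        refine integral_congr_ae (Filter.Eventually.of_forall fun w => ?_)
        simp only [ev_add]; ring
      map_smul' := fun c P => by
        simp only [RingHom.id_apply, smul_eq_mul]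
        rw [← integral_const_mul]
        refine integral_congr_ae (Filter.Eventually.of_forall fun w => ?_)
        have : ev (c • P) w = c * ev P w := (evL w).map_smul c P
        simp only [this]; ring }
  refine funk_hecke_abs hh L (fun j => ∑ i ∈ Finset.range N, ∑ i' ∈ Finset.range N,
    if i + p = i' + q then (1/N : ℂ) * vint d κ (i + p - j) j else 0) ?_
  intro m c hp hq
  change ∫ w, (Kk κ N (w 0) : ℂ) * ev _ w ∂(sig (d+1)) = _
  set m' : ℕ → ℕ → (Fin (d+1) ⊕ Fin (d+1) →₀ ℕ) := fun i i' => m + Finsupp.single (Sum.inl 0) i + Finsupp.single (Sum.inr 0) i' with hm'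
  have e1 : ∀ w : EuclideanSpace ℂ (Fin (d+1)), (Kk κ N (w 0) : ℂ) * ev (MvPolynomial.monomial m c) w
     = ∑ i ∈ Finset.range N, ∑ i' ∈ Finset.range N, (c * (1/N : ℂ)) * ((κ ‖w 0‖ : ℂ) * ((∏ k, w k ^ m' i i' (Sum.inl k)) * ∏ k, (starRingEnd ℂ) (w k) ^ m' i i' (Sum.inr k))) := by
    intro w
    rw [ev_monomial, Kk]; push_cast; rw [ktR_eq, Finset.mul_sum, Finset.sum_mul]
    refine Finset.sum_congr rfl fun i _ => ?_
    rw [Finset.mul_sum, Finset.sum_mul]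
    refine Finset.sum_congr rfl fun i' _ => ?_
    have p1 : ∏ k, w k ^ m' i i' (Sum.inl k) = w 0 ^ i * ∏ k, w k ^ m (Sum.inl k) := by
      rw [Fin.prod_univ_succ, Fin.prod_univ_succ]
      simp [hm', pow_add]; ring
    have p2 : ∏ k, (starRingEnd ℂ) (w k) ^ m' i i' (Sum.inr k) = (starRingEnd ℂ) (w 0) ^ i' * ∏ k, (starRingEnd ℂ) (w k) ^ m (Sum.inr k) := by
      rw [Fin.prod_univ_succ, Fin.prod_univ_succ]
      simp [hm', pow_add]; ring
    rw [p1, p2]; ring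
  have hint2 : ∀ i i', Integrable (fun w : EuclideanSpace ℂ (Fin (d+1)) => (c * (1/N : ℂ)) * ((κ ‖w 0‖ : ℂ) * ((∏ k, w k ^ m' i i' (Sum.inl k)) * ∏ k, (starRingEnd ℂ) (w k) ^ m' i i' (Sum.inr k)))) (sig (d+1)) := by
    intro i i'
    refine Integrable.const_mul ?_ _
    refine integrable_sig_bdd (n := d+1) (by omega) hκ hB 0 ?_
    have := hcont (MvPolynomial.monomial (m' i i') 1)
    refine this.congr fun w => ?_
    rw [ev_monomial, one_mul]
  simp only [e1]
  rw [integral_finsetSum _ (fun i _ => integrable_finsetSum _ fun i' _ => hint2 i i')]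
  simp only [integral_finsetSum _ (fun i' _ => hint2 _ i')]
  simp only [integral_const_mul, mono_int hd κ hκ]
  set j := ∑ i : Fin d, m (Sum.inl i.succ) with hj
  by_cases hs : ∀ i : Fin d, m (Sum.inl i.succ) = m (Sum.inr i.succ)
  swap
  · have : ∀ j, wS j m = 0 := by
      intro j; unfold wS; rw [if_neg]; rintro ⟨a, b⟩; exact hs a
    simp only [this, mul_zero, Finset.sum_const_zero]
    refine Finset.sum_eq_zero fun i _ => Finset.sum_eq_zero fun i' _ => ?_
    rw [if_neg, mul_zero]
    intro hall
    apply hs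
    intro k
    have := hall k.succ
    simpa [hm'] using this
  have hpj : m (Sum.inl 0) + j = p := by rw [← hp, Fin.sum_univ_succ]
  have hqj : m (Sum.inr 0) + j = q := by rw [← hq, Fin.sum_univ_succ, hj]; simp [hs]
  have hsing : ∀ A : ℕ → ℂ, ∑ j' ∈ Finset.range (p+1), A j' * wS j' m = A j * wS j m := by
    intro A
    refine Finset.sum_eq_single j ?_ ?_
    · intro j' _ hne
      have : wS j' m = 0 := by
        unfold wS; rw [if_neg]; rintro ⟨a, b⟩; exact hne (b.symm.trans hj.symm)
      rw [this, mul_zero]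
    · intro hh
      exact absurd (Finset.mem_range.2 (by omega)) hh
  rw [hsing]
  have hw : wS j m = ∏ i : Fin d, ((m (Sum.inl i.succ)).factorial : ℂ) := by
    unfold wS; rw [if_pos ⟨hs, hj.symm⟩]
  rw [hw, Finset.sum_mul, Finset.mul_sum]
  refine Finset.sum_congr rfl fun i _ => ?_
  rw [Finset.sum_mul, Finset.mul_sum]
  refine Finset.sum_congr rfl fun i' _ => ?_
  have hiff : (∀ k, m' i i' (Sum.inl k) = m' i i' (Sum.inr k)) ↔ i + p = i' + q := by
    rw [Fin.forall_fin_succ]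
    have : ∀ k : Fin d, m' i i' (Sum.inl k.succ) = m' i i' (Sum.inr k.succ) := by
      intro k; simp [hm', hs k]
    simp only [this, implies_true, and_true]
    simp [hm']
    omega
  have g1 : ∀ k : Fin d, m' i i' (Sum.inl k.succ) = m (Sum.inl k.succ) := by intro k; simp [hm']
  have g2 : m' i i' (Sum.inl 0) = i + p - j := by simp [hm']; omega
  simp only [hiff, g1, g2, ← hj]
  split_ifs
  · ring
  · simp

/-- unitary taking the pole to a given point. -/
lemma exists_unitary {d : ℕ} (y : EuclideanSpace ℂ (Fin (d+1))) (hy : ‖y‖ = 1) :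
    ∃ u : EuclideanSpace ℂ (Fin (d+1)) ≃ₗᵢ[ℂ] EuclideanSpace ℂ (Fin (d+1)), u (EuclideanSpace.single 0 1) = y := by
  have hv : Orthonormal ℂ (({0} : Set (Fin (d+1))).domRestrict (fun _ => y)) := by
    constructor
    · intro i; exact hy
    · intro i j hij; exact absurd (Subsingleton.elim i j) hij
  obtain ⟨b, hb⟩ := Orthonormal.exists_orthonormalBasis_extension_of_card_eq (ι := Fin (d+1)) (𝕜 := ℂ)
    (by simp) hv
  refine ⟨b.repr.symm, ?_⟩
  rw [OrthonormalBasis.repr_symm_single]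
  exact hb 0 rfl

lemma funk_hecke {d : ℕ} (hd : 1 ≤ d) {κ : ℝ → ℝ} (hκ : Measurable κ) {B : ℝ} (hB : ∀ x, |κ x| ≤ B)
    (N : ℕ) {p q : ℕ} {h : Pol (d+1)} (hh : HP p q h) (y : EuclideanSpace ℂ (Fin (d+1))) (hy : ‖y‖ = 1) :
    ∫ w, (Kk κ N (inner ℂ y w) : ℂ) * ev h w ∂(sig (d+1)) = FHlam d κ N p q * ev h y := by
  obtain ⟨u, hu⟩ := exists_unitary y hy
  rw [← integral_sig_comp u]
  have := funk_hecke_pole hd hκ hB N (hh.subst u)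
  rw [ev_subst, hu] at this
  rw [← this]
  refine integral_congr_ae (Filter.Eventually.of_forall fun w => ?_)
  simp only [ev_subst]
  rw [← hu, LinearIsometryEquiv.inner_map_map, EuclideanSpace.inner_single_left]
  simp

end

section

/-- exponentials of even frequency -/
def Ee (m : ℤ) (t : ℝ) : ℂ := Complex.exp (((2 * m * t : ℝ) : ℂ) * Complex.I)

lemma Ee_zero : Ee 0 = 1 := by ext t; simp [Ee]

lemma Ee_add (a b : ℤ) : Ee (a + b) = Ee a * Ee b := by
  ext t; simp only [Ee, Pi.mul_apply]; rw [← Complex.exp_add]; congr 1; push_cast; ring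

lemma Ee_at (m : ℤ) : Ee m 0 = 1 := by simp [Ee]

lemma Ee_cont (m : ℤ) : Continuous (Ee m) := by unfold Ee; fun_prop

lemma Ee_scale (m u : ℤ) (t : ℝ) : Ee u (m * t) = Ee (m * u) t := by
  unfold Ee; congr 2; push_cast; ring

lemma Ee_int (m : ℤ) : ∫ t in (0:ℝ)..Real.pi, Ee m t = if m = 0 then (Real.pi : ℂ) else 0 := by
  split_ifs with h
  · subst h; rw [Ee_zero]; simp
  · have hc : (2 * m * Complex.I : ℂ) ≠ 0 := by
      simp [h]
    have : ∀ t : ℝ, Ee m t = Complex.exp ((2 * m * Complex.I) * t) := by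
      intro t; unfold Ee; congr 1; push_cast; ring
    simp_rw [this]
    rw [integral_exp_mul_complex hc]
    have : Complex.exp (2 * m * Complex.I * (Real.pi : ℂ)) = 1 := by
      rw [← Complex.exp_int_mul_two_pi_mul_I m]; congr 1; ring
    rw [this]; simp

/-- trigonometric polynomials -/
def TT (k : ℕ) : Submodule ℂ (ℝ → ℂ) := Submodule.span ℂ {g | ∃ m : ℤ, |m| ≤ k ∧ g = Ee m}

lemma TT_Ee {k : ℕ} {m : ℤ} (h : |m| ≤ k) : Ee m ∈ TT k := Submodule.subset_span ⟨m, h, rfl⟩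

lemma TT_mono {k k' : ℕ} (h : k ≤ k') : TT k ≤ TT k' := by
  refine Submodule.span_mono ?_
  rintro g ⟨m, hm, rfl⟩
  exact ⟨m, hm.trans (by exact_mod_cast h), rfl⟩

lemma TT_one : (1 : ℝ → ℂ) ∈ TT 0 := by rw [← Ee_zero]; exact TT_Ee (by simp)

lemma TT_mul {k k' : ℕ} {f g : ℝ → ℂ} (hf : f ∈ TT k) (hg : g ∈ TT k') : f * g ∈ TT (k + k') := by
  induction hf using Submodule.span_induction with
  | mem f hf =>
    obtain ⟨m, hm, rfl⟩ := hf
    induction hg using Submodule.span_induction with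
    | mem g hg =>
      obtain ⟨m', hm', rfl⟩ := hg
      rw [← Ee_add]
      refine TT_Ee ((abs_add_le _ _).trans ?_)
      push_cast; exact add_le_add hm hm'
    | zero => rw [mul_zero]; exact Submodule.zero_mem _
    | add a b _ _ ha hb => rw [mul_add]; exact Submodule.add_mem _ ha hb
    | smul c a _ ha => rw [mul_smul_comm]; exact Submodule.smul_mem _ _ ha
  | zero => rw [zero_mul]; exact Submodule.zero_mem _
  | add a b _ _ ha hb => rw [add_mul]; exact Submodule.add_mem _ ha hb
  | smul c a _ ha => rw [smul_mul_assoc]; exact Submodule.smul_mem _ _ ha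

lemma TT_pow {k : ℕ} {f : ℝ → ℂ} (hf : f ∈ TT k) (e : ℕ) : f ^ e ∈ TT (e * k) := by
  induction e with
  | zero => simpa using TT_one
  | succ e ih => rw [pow_succ, Nat.add_mul, one_mul]; exact TT_mul ih hf

lemma TT_cont {k : ℕ} {f : ℝ → ℂ} (hf : f ∈ TT k) : Continuous f := by
  induction hf using Submodule.span_induction with
  | mem f hf => obtain ⟨m, hm, rfl⟩ := hf; exact Ee_cont m
  | zero => exact continuous_zero
  | add a b _ _ ha hb => exact ha.add hb
  | smul c a _ ha => exact ha.const_smul c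

/-- Dirichlet kernel -/
def Dk (L : ℕ) (t : ℝ) : ℝ := 1 + ∑ i ∈ Finset.range L, 2 * Real.cos (2 * (i + 1) * t)

lemma Dk_cont (L : ℕ) : Continuous (Dk L) := by unfold Dk; fun_prop

lemma Dk_sin (L : ℕ) (t : ℝ) : Dk L t * Real.sin t = Real.sin ((2 * L + 1) * t) := by
  unfold Dk
  induction L with
  | zero => simp
  | succ L ih =>
    rw [Finset.sum_range_succ, ← add_assoc, add_mul, ih]
    have e1 : ((2 * (L:ℝ) + 1) * t) = (2 * ((L:ℝ) + 1) * t) - t := by ring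
    have e2 : ((2 * ((L + 1 : ℕ):ℝ) + 1) * t) = (2 * ((L:ℝ) + 1) * t) + t := by push_cast; ring
    rw [e1, e2, Real.sin_sub, Real.sin_add]; ring

lemma two_cos (m : ℤ) (t : ℝ) : ((2 * Real.cos (2 * m * t) : ℝ) : ℂ) = Ee m t + Ee (-m) t := by
  unfold Ee
  have : (((2 * ((-m : ℤ) : ℝ) * t : ℝ) : ℂ) * Complex.I) = -(((2 * m * t : ℝ) : ℂ)) * Complex.I := by push_cast; ring
  rw [this, Complex.ofReal_mul, Complex.ofReal_cos, Complex.cos]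
  push_cast; ring

lemma Dk_eq (L : ℕ) (t : ℝ) : (Dk L t : ℂ) = Ee 0 t + ∑ i ∈ Finset.range L, (Ee (i+1) t + Ee (-(i+1)) t) := by
  unfold Dk
  rw [Complex.ofReal_add, Complex.ofReal_sum]
  congr 1
  · simp [Ee]
  · refine Finset.sum_congr rfl fun i _ => ?_
    rw [← two_cos]; push_cast; rfl

lemma Dk_int (L : ℕ) (m : ℤ) : ∫ t in (0:ℝ)..Real.pi, (Dk L t : ℂ) * Ee m t = if |m| ≤ L then (Real.pi : ℂ) else 0 := by
  have hii : ∀ a : ℤ, IntervalIntegrable (Ee a) volume 0 Real.pi := fun a => (Ee_cont a).intervalIntegrable _ _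
  have : ∀ t, (Dk L t : ℂ) * Ee m t = Ee m t + ∑ i ∈ Finset.range L, (Ee (i+1+m) t + Ee (-(i+1)+m) t) := by
    intro t
    rw [Dk_eq, add_mul, Finset.sum_mul]
    congr 1
    · rw [Ee_zero]; simp
    · refine Finset.sum_congr rfl fun i _ => ?_
      rw [Ee_add (i+1) m, Ee_add (-(i+1)) m]; simp only [Pi.mul_apply]; ring
  simp_rw [this]
  rw [intervalIntegral.integral_add (hii m) ?_, intervalIntegral.integral_finsetSum]
  rotate_left
  · intro i _; exact (hii _).add (hii _)
  · have h3 : Continuous (fun t => ∑ i ∈ Finset.range L, (Ee (i+1+m) t + Ee (-(i+1)+m) t)) :=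
      continuous_finsetSum _ fun i _ => (Ee_cont _).add (Ee_cont _)
    exact h3.intervalIntegrable _ _
  have : ∀ i ∈ Finset.range L, ∫ t in (0:ℝ)..Real.pi, (Ee (i+1+m) t + Ee (-(i+1)+m) t)
     = if i = m.natAbs - 1 ∧ m ≠ 0 then (Real.pi : ℂ) else 0 := by
    intro i _
    rw [intervalIntegral.integral_add (hii _) (hii _), Ee_int, Ee_int]
    by_cases h1 : (i:ℤ) + 1 + m = 0
    · rw [if_pos h1, if_neg (by omega), if_pos (by omega), add_zero]
    · by_cases h2 : -((i:ℤ) + 1) + m = 0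
      · rw [if_neg h1, if_pos h2, if_pos (by omega), zero_add]
      · rw [if_neg h1, if_neg h2, if_neg (by omega), zero_add]
  rw [Finset.sum_congr rfl this, Ee_int]
  by_cases hm : m = 0
  · subst hm; simp
  · simp only [hm, if_false, ne_eq, not_false_eq_true, and_true, zero_add]
    rw [Finset.sum_ite_eq']
    rw [Int.abs_eq_natAbs]
    by_cases h : (m.natAbs : ℤ) ≤ L
    · rw [if_pos h, if_pos (by rw [Finset.mem_range]; omega)]
    · rw [if_neg h, if_neg (by rw [Finset.mem_range]; omega)]

lemma repro (L d' : ℕ) {s g : ℝ → ℂ} (hs : s ∈ TT d') (hg : g ∈ TT L) :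
    ∫ t in (0:ℝ)..Real.pi, (Dk L t : ℂ) * (s ((2 * L + 1) * t) * g t) = (∫ t in (0:ℝ)..Real.pi, s t) * g 0 := by
  have hD : Continuous (fun t => (Dk L t : ℂ)) := Complex.continuous_ofReal.comp (Dk_cont L)
  induction hs using Submodule.span_induction with
  | mem s hs =>
    obtain ⟨u, hu, rfl⟩ := hs
    have hsc : Continuous (fun t : ℝ => Ee u ((2 * L + 1) * t)) := (Ee_cont u).comp (by fun_prop)
    induction hg using Submodule.span_induction with
    | mem g hg =>
      obtain ⟨m, hm, rfl⟩ := hg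
      have : ∀ t : ℝ, Ee u ((2 * L + 1) * t) * Ee m t = Ee ((2 * L + 1) * u + m) t := by
        intro t
        rw [Ee_add, Pi.mul_apply, ← Ee_scale]; push_cast; rfl
      simp_rw [this]
      rw [Dk_int, Ee_int, Ee_at, mul_one]
      by_cases hu0 : u = 0
      · subst hu0; simp [hm]
      · rw [if_neg hu0, if_neg]
        intro hcon
        have h1 := abs_le.1 hm
        have h2 := abs_le.1 hcon
        rcases lt_or_gt_of_ne hu0 with h | h
        · nlinarith [h1.1, h1.2, h2.1, h2.2]
        · nlinarith [h1.1, h1.2, h2.1, h2.2]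
    | zero => simp
    | add a b ha hb iha ihb =>
      have ca := TT_cont ha
      have cb := TT_cont hb
      simp only [Pi.add_apply, mul_add]
      rw [intervalIntegral.integral_add, iha, ihb]
      · exact (hD.mul (hsc.mul ca)).intervalIntegrable _ _
      · exact (hD.mul (hsc.mul cb)).intervalIntegrable _ _
    | smul c a ha iha =>
      simp only [Pi.smul_apply, smul_eq_mul]
      rw [show (fun t : ℝ => (Dk L t : ℂ) * (Ee u ((2 * L + 1) * t) * (c * a t))) = fun t => c * ((Dk L t : ℂ) * (Ee u ((2 * L + 1) * t) * a t)) by ext t; ring]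
      rw [intervalIntegral.integral_const_mul, iha]; ring
  | zero => simp
  | add a b ha hb iha ihb =>
    have ca : Continuous (fun t : ℝ => a ((2 * L + 1) * t)) := (TT_cont ha).comp (by fun_prop)
    have cb : Continuous (fun t : ℝ => b ((2 * L + 1) * t)) := (TT_cont hb).comp (by fun_prop)
    have cg := TT_cont hg
    simp only [Pi.add_apply]
    rw [show (fun t : ℝ => (Dk L t : ℂ) * ((a ((2 * L + 1) * t) + b ((2 * L + 1) * t)) * g t)) = fun t => (Dk L t : ℂ) * (a ((2 * L + 1) * t) * g t) + (Dk L t : ℂ) * (b ((2 * L + 1) * t) * g t) by ext t; ring]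
    rw [intervalIntegral.integral_add, iha, ihb, intervalIntegral.integral_add, add_mul]
    · exact (TT_cont ha).intervalIntegrable _ _
    · exact (TT_cont hb).intervalIntegrable _ _
    · exact (hD.mul (ca.mul cg)).intervalIntegrable _ _
    · exact (hD.mul (cb.mul cg)).intervalIntegrable _ _
  | smul c a ha iha =>
    simp only [Pi.smul_apply, smul_eq_mul]
    rw [show (fun t : ℝ => (Dk L t : ℂ) * (c * a ((2 * L + 1) * t) * g t)) = fun t => c * ((Dk L t : ℂ) * (a ((2 * L + 1) * t) * g t)) by ext t; ring]
    rw [intervalIntegral.integral_const_mul, iha, intervalIntegral.integral_const_mul]; ring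

lemma cos_sq_TT : (fun t : ℝ => ((Real.cos t ^ 2 : ℝ) : ℂ)) ∈ TT 1 := by
  have : (fun t : ℝ => ((Real.cos t ^ 2 : ℝ) : ℂ)) = (1/2 : ℂ) • Ee 0 + ((1/4 : ℂ) • Ee 1 + (1/4 : ℂ) • Ee (-1)) := by
    ext t
    have h := two_cos 1 t
    simp only [Pi.add_apply, Pi.smul_apply, smul_eq_mul, Ee_zero, Pi.one_apply, ← mul_add, ← h]
    rw [Real.cos_sq]; push_cast; ring
  rw [this]
  refine Submodule.add_mem _ (Submodule.smul_mem _ _ (TT_Ee (by simp))) (Submodule.add_mem _ (Submodule.smul_mem _ _ (TT_Ee (by simp))) (Submodule.smul_mem _ _ (TT_Ee (by simp))))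

lemma sin_sq_TT : (fun t : ℝ => ((Real.sin t ^ 2 : ℝ) : ℂ)) ∈ TT 1 := by
  have : (fun t : ℝ => ((Real.sin t ^ 2 : ℝ) : ℂ)) = 1 - (fun t : ℝ => ((Real.cos t ^ 2 : ℝ) : ℂ)) := by
    ext t; simp only [Pi.sub_apply, Pi.one_apply]; rw [Real.sin_sq]; push_cast; ring
  rw [this]
  exact Submodule.sub_mem _ (TT_mono (by omega) TT_one) cos_sq_TT

/-- squared normalised Dirichlet sum -/
def Om (N : ℕ) (t : ℝ) : ℝ := ktR N (Ee 1 t) / N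

lemma Om_cont (N : ℕ) : Continuous (Om N) := by
  unfold Om; exact ((continuous_ktR N).comp (Ee_cont 1)).div_const _

lemma Ee_pow (t : ℝ) (i : ℕ) : Ee 1 t ^ i = Ee i t := by
  induction i with
  | zero => simp [Ee_zero]
  | succ i ih => rw [pow_succ, ih]; push_cast; rw [Ee_add]; rfl

lemma Ee_conj (m : ℤ) (t : ℝ) : (starRingEnd ℂ) (Ee m t) = Ee (-m) t := by
  unfold Ee; rw [← Complex.exp_conj, map_mul, Complex.conj_ofReal, Complex.conj_I]; congr 1; push_cast; ring

lemma Om_TT {N : ℕ} : (fun t : ℝ => (Om N t : ℂ)) ∈ TT (N - 1) := by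
  have : (fun t : ℝ => (Om N t : ℂ)) = ∑ i ∈ Finset.range N, ∑ i' ∈ Finset.range N, (1/N/N : ℂ) • Ee ((i:ℤ) - i') := by
    ext t
    unfold Om
    push_cast
    rw [ktR_eq, Finset.sum_apply, Finset.sum_div]
    refine Finset.sum_congr rfl fun i _ => ?_
    rw [Finset.sum_apply, Finset.sum_div]
    refine Finset.sum_congr rfl fun i' _ => ?_
    rw [← map_pow, Ee_pow, Ee_pow, Ee_conj, sub_eq_add_neg, Ee_add]
    simp only [Pi.smul_apply, Pi.mul_apply, smul_eq_mul]; ring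
  rw [this]
  refine Submodule.sum_mem _ fun i hi => Submodule.sum_mem _ fun i' hi' => Submodule.smul_mem _ _ (TT_Ee ?_)
  rw [Finset.mem_range] at hi hi'
  rw [abs_le]; omega

lemma Om_zero {N : ℕ} (hN : 1 ≤ N) : Om N 0 = 1 := by
  unfold Om ktR
  have : (N:ℝ) ≠ 0 := by positivity
  simp [Ee]; field_simp

lemma half_int {F : ℝ → ℂ} (hF : Continuous F) (hs : ∀ t, F (Real.pi - t) = F t) :
    ∫ t in (0:ℝ)..Real.pi, F t = 2 * ∫ t in (0:ℝ)..Real.pi/2, F t := by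
  rw [← intervalIntegral.integral_add_adjacent_intervals (b := Real.pi/2) (hF.intervalIntegrable _ _) (hF.intervalIntegrable _ _)]
  have : ∫ t in (Real.pi/2)..Real.pi, F t = ∫ t in (0:ℝ)..Real.pi/2, F t := by
    have h := intervalIntegral.integral_comp_sub_left (a := Real.pi/2) (b := Real.pi) F Real.pi
    simp only [hs] at h
    rw [h]; congr 1 <;> ring
  rw [this]; ring

/-- the constant `∫ sin^{2d}` -/
def Wd (d : ℕ) : ℝ := ∫ t in (0:ℝ)..Real.pi/2, Real.sin t ^ (2*d)

lemma Wd_pos (d : ℕ) : 0 < Wd d := by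
  unfold Wd
  refine intervalIntegral.intervalIntegral_pos_of_pos_on ((by fun_prop : Continuous _).intervalIntegrable _ _) ?_ (by positivity)
  intro t ht
  exact pow_pos (Real.sin_pos_of_pos_of_lt_pi ht.1 (by linarith [ht.2, Real.pi_pos])) _

lemma repro_half (L d : ℕ) {g : ℝ → ℝ} (hg : (fun t => (g t : ℂ)) ∈ TT L) (hs : ∀ t, g (Real.pi - t) = g t) :
    ∫ t in (0:ℝ)..Real.pi/2, Dk L t ^ (2*d+1) * Real.sin t ^ (2*d) * g t = Wd d * g 0 := by
  have hsd : (fun t : ℝ => ((Real.sin t ^ 2 : ℝ) : ℂ)) ^ d ∈ TT (d * 1) := TT_pow sin_sq_TT d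
  have h := repro L _ hsd hg
  have gc : Continuous (fun t => (g t : ℂ)) := TT_cont hg
  have hDs : ∀ t, Dk L (Real.pi - t) = Dk L t := by
    intro t; unfold Dk; congr 1
    refine Finset.sum_congr rfl fun i _ => ?_
    congr 1
    rw [← Real.cos_neg (2 * (i+1) * t), ← Real.cos_add_nat_mul_two_pi (-(2 * (i+1) * t)) (i+1)]
    congr 1; push_cast; ring
  have e1 : ∀ t : ℝ, (Dk L t : ℂ) * (((fun t : ℝ => ((Real.sin t ^ 2 : ℝ) : ℂ)) ^ d) ((2 * L + 1) * t) * g t)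
      = ((Dk L t ^ (2*d+1) * Real.sin t ^ (2*d) * g t : ℝ) : ℂ) := by
    intro t
    simp only [Pi.pow_apply]
    rw [← Dk_sin]; push_cast; rw [← pow_mul]; ring
  simp only [e1] at h
  have hDc := Dk_cont L
  have gcr : Continuous g := by
    have := Complex.continuous_re.comp gc
    exact this
  rw [half_int (by fun_prop) (fun t => by rw [hDs, hs, Real.sin_pi_sub]), half_int (TT_cont hsd) (fun t => by simp only [Pi.pow_apply, Real.sin_pi_sub])] at h
  have e2 : ∀ t : ℝ, ((fun t : ℝ => ((Real.sin t ^ 2 : ℝ) : ℂ)) ^ d) t = ((Real.sin t ^ (2*d) : ℝ) : ℂ) := by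
    intro t; simp only [Pi.pow_apply]; push_cast; rw [← pow_mul]
  simp only [e2] at h
  rw [intervalIntegral.integral_ofReal, intervalIntegral.integral_ofReal] at h
  have h' : (2 * ∫ t in (0:ℝ)..Real.pi/2, Dk L t ^ (2*d+1) * Real.sin t ^ (2*d) * g t) = 2 * (∫ t in (0:ℝ)..Real.pi/2, Real.sin t ^ (2*d)) * g 0 := by exact_mod_cast h
  unfold Wd; linarith

end

section

/-- radial profile in the angle -/
def kapT (d R N : ℕ) (t : ℝ) : ℝ :=
  1 / ((gC d 0).toReal * Wd d) * (Real.cos t * Real.sin t * Om N t ^ (d+2) * Dk (R*N) t ^ (2*d+1))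

/-- radial profile -/
def kap (d R N : ℕ) (x : ℝ) : ℝ := kapT d R N (Real.arccos x)

lemma kapT_cont (d R N : ℕ) : Continuous (kapT d R N) := by
  have h1 := Om_cont N
  have h2 := Dk_cont (R*N)
  unfold kapT; fun_prop

lemma kap_cont (d R N : ℕ) : Continuous (kap d R N) := (kapT_cont d R N).comp Real.continuous_arccos

lemma kap_bdd (d R N : ℕ) : ∃ B, ∀ x, |kap d R N x| ≤ B := by
  obtain ⟨B, hB⟩ := (isCompact_Icc (a := (0:ℝ)) (b := Real.pi)).exists_bound_of_continuousOn (kapT_cont d R N).continuousOn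
  exact ⟨B, fun x => hB _ ⟨Real.arccos_nonneg x, Real.arccos_le_pi x⟩⟩

lemma Om_symm (N : ℕ) (t : ℝ) : Om N (Real.pi - t) = Om N t := by
  have : Ee 1 (Real.pi - t) = (starRingEnd ℂ) (Ee 1 t) := by
    rw [Ee_conj]; unfold Ee
    rw [← Complex.exp_periodic.int_mul 1 (((2 * ((-1:ℤ):ℝ) * t : ℝ) : ℂ) * Complex.I)]
    congr 1; push_cast; ring
  unfold Om; rw [this, ktR_conj]

lemma vint_kap {d R N a j : ℕ} (hd : 1 ≤ d) (hN : 1 ≤ N) (h : (d+2) * (N-1) + a + 1 + j ≤ R * N) :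
    vint d (kap d R N) a j = if j = 0 then 1 else 0 := by
  unfold vint
  have e : ∀ t ∈ Ioo 0 (Real.pi/2), ((kap d R N (Real.cos t) * Real.cos t ^ (2*a) : ℝ) : ℂ) * ((Real.cos t * Real.sin t ^ (2*d-1+2*j) : ℝ) : ℂ)
     = ((1 / ((gC d 0).toReal * Wd d) * (Dk (R*N) t ^ (2*d+1) * Real.sin t ^ (2*d) * (Om N t ^ (d+2) * (Real.cos t ^ 2) ^ (a+1) * (Real.sin t ^ 2) ^ j)) : ℝ) : ℂ) := by
    intro t ht
    rw [← Complex.ofReal_mul]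
    congr 1
    have : Real.arccos (Real.cos t) = t := Real.arccos_cos ht.1.le (by linarith [ht.2, Real.pi_pos])
    unfold kap kapT
    rw [this]
    have h2 : Real.sin t ^ (2*d) = Real.sin t ^ (2*d-1) * Real.sin t := by
      rw [← pow_succ]; congr 1; omega
    rw [h2, ← pow_mul, ← pow_mul, pow_add _ (2*d-1)]
    ring
  rw [setIntegral_congr_fun measurableSet_Ioo e, ← integral_Ioc_eq_integral_Ioo, ← intervalIntegral.integral_of_le (by positivity)]
  rw [intervalIntegral.integral_ofReal, intervalIntegral.integral_const_mul]
  have hTT : (fun t => ((Om N t ^ (d+2) * (Real.cos t ^ 2) ^ (a+1) * (Real.sin t ^ 2) ^ j : ℝ) : ℂ)) ∈ TT (R*N) := by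
    have h1 := TT_mul (TT_mul (TT_pow (Om_TT (N := N)) (d+2)) (TT_pow cos_sq_TT (a+1))) (TT_pow sin_sq_TT j)
    have h2 := TT_mono (k' := R*N) (by omega) h1
    convert h2 using 1
    ext t; simp only [Pi.mul_apply, Pi.pow_apply]; push_cast; rfl
  rw [repro_half (R*N) d hTT (fun t => by rw [Om_symm, Real.cos_pi_sub, Real.sin_pi_sub, neg_sq])]
  rw [Om_zero hN]
  have hW := (Wd_pos d).ne'
  have hG : (gC d 0).toReal ≠ 0 := ENNReal.toReal_ne_zero.2 ⟨gC_ne_zero _ _, gC_ne_top _ _⟩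
  split_ifs with hj
  · subst hj
    rw [← Complex.ofReal_mul, ← Complex.ofReal_one]; congr 1
    simp; field_simp
  · simp [hj]

/-- multiplier -/
def kcoef (N p q : ℕ) : ℂ := ∑ i ∈ Finset.range N, ∑ i' ∈ Finset.range N, if i + p = i' + q then (1/N : ℂ) else 0

lemma kcoef_eq_zero {N p q : ℕ} (h : p ≥ q + N ∨ q ≥ p + N) : kcoef N p q = 0 := by
  unfold kcoef
  refine Finset.sum_eq_zero fun i hi => Finset.sum_eq_zero fun i' hi' => ?_
  rw [Finset.mem_range] at hi hi'
  rw [if_neg (by omega)]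

lemma kcoef_ne_zero {N p q : ℕ} (h : p < q + N) (h' : q < p + N) : kcoef N p q ≠ 0 := by
  have hN : (0:ℝ) < N := by
    have : 0 < N := by omega
    exact_mod_cast this
  have e : kcoef N p q = ((∑ i ∈ Finset.range N, ∑ i' ∈ Finset.range N, if i + p = i' + q then (1/N : ℝ) else 0 : ℝ) : ℂ) := by
    unfold kcoef; push_cast
    refine Finset.sum_congr rfl fun i hi => Finset.sum_congr rfl fun i' hi' => ?_
    split_ifs <;> push_cast <;> rfl
  rw [e]
  have nn : ∀ i i', (0:ℝ) ≤ if i + p = i' + q then (1/N : ℝ) else 0 := by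
    intro i i'; split_ifs <;> positivity
  refine Complex.ofReal_ne_zero.2 (ne_of_gt ?_)
  have h1 := Finset.single_le_sum (f := fun i => ∑ i' ∈ Finset.range N, if i + p = i' + q then (1/N : ℝ) else 0) (fun i _ => Finset.sum_nonneg fun i' _ => nn i i') (Finset.mem_range.2 (show q - p < N by omega))
  have h2 := Finset.single_le_sum (f := fun i' => if q - p + p = i' + q then (1/N : ℝ) else 0) (fun i' _ => nn _ i') (Finset.mem_range.2 (show p - q < N by omega))
  rw [if_pos (by omega)] at h2
  have : (0:ℝ) < 1 / N := by positivity
  linarith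

lemma FHlam_zero {d N p q : ℕ} (κ : ℝ → ℝ) (h : p ≥ q + N ∨ q ≥ p + N) : FHlam d κ N p q = 0 := by
  unfold FHlam
  refine Finset.sum_eq_zero fun j _ => ?_
  rw [Finset.sum_eq_zero, zero_mul]
  refine fun i hi => Finset.sum_eq_zero fun i' hi' => ?_
  rw [Finset.mem_range] at hi hi'
  rw [if_neg (by omega)]

lemma FHlam_kap {d R C N p q : ℕ} (hd : 1 ≤ d) (hN : 1 ≤ N) (hR : R = C + (d + 3)) (h : p + q ≤ C * N) :
    FHlam d (kap d R N) N p q = kcoef N p q := by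
  unfold FHlam kcoef
  rw [Finset.sum_eq_single 0]
  · rw [show rhoPQ p q 0 = 1 from rfl, mul_one]
    refine Finset.sum_congr rfl fun i hi => Finset.sum_congr rfl fun i' hi' => ?_
    split_ifs with h1
    · rw [vint_kap hd hN ?_, if_pos rfl, mul_one]
      rw [Finset.mem_range] at hi
      obtain ⟨N', rfl⟩ : ∃ N', N = N' + 1 := ⟨N - 1, by omega⟩
      subst hR
      simp only [Nat.add_sub_cancel, Nat.sub_zero]
      nlinarith
    · rfl
  · intro j hj hj0
    rw [Finset.sum_eq_zero, zero_mul]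
    intro i hi
    refine Finset.sum_eq_zero fun i' hi' => ?_
    split_ifs with h1
    · rw [vint_kap hd hN ?_, if_neg hj0, mul_zero]
      rw [Finset.mem_range] at hi hj
      obtain ⟨N', rfl⟩ : ∃ N', N = N' + 1 := ⟨N - 1, by omega⟩
      subst hR
      simp only [Nat.add_sub_cancel]
      have : i + p - j + 1 + j = i + p + 1 := by omega
      nlinarith
    · rfl
  · intro h; simp at h

end

section

lemma pow_sub_norm {c c' : ℂ} (hc : ‖c‖ ≤ 1) (hc' : ‖c'‖ ≤ 1) (i : ℕ) : ‖c^i - c'^i‖ ≤ i * ‖c - c'‖ := by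
  induction i with
  | zero => simp
  | succ i ih =>
    have : c^(i+1) - c'^(i+1) = c^i * (c - c') + (c^i - c'^i) * c' := by ring
    rw [this]
    refine (norm_add_le _ _).trans ?_
    rw [norm_mul, norm_mul, norm_pow]
    have h1 : ‖c‖^i ≤ 1 := pow_le_one₀ (norm_nonneg _) hc
    have h2 := norm_nonneg (c - c')
    have h3 := norm_nonneg (c^i - c'^i)
    push_cast
    nlinarith [norm_nonneg c']

lemma geo_norm {c : ℂ} (hc : ‖c‖ ≤ 1) (N : ℕ) : ‖∑ i ∈ Finset.range N, c^i‖ ≤ N := by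
  refine (norm_sum_le _ _).trans ?_
  refine (Finset.sum_le_sum (g := fun _ => (1:ℝ)) fun i _ => ?_).trans (by simp)
  rw [norm_pow]; exact pow_le_one₀ (norm_nonneg _) hc

lemma geo_sub_norm {c c' : ℂ} (hc : ‖c‖ ≤ 1) (hc' : ‖c'‖ ≤ 1) (N : ℕ) :
    |‖∑ i ∈ Finset.range N, c^i‖ - ‖∑ i ∈ Finset.range N, c'^i‖| ≤ N * N * ‖c - c'‖ := by
  refine (abs_norm_sub_norm_le _ _).trans ?_
  rw [← Finset.sum_sub_distrib]
  refine (norm_sum_le _ _).trans ?_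
  refine (Finset.sum_le_sum (g := fun _ => (N:ℝ) * ‖c - c'‖) fun i hi => ?_).trans (by simp [mul_assoc])
  refine (pow_sub_norm hc hc' i).trans ?_
  rw [Finset.mem_range] at hi
  have : (i:ℝ) ≤ N := by exact_mod_cast hi.le
  gcongr

lemma ktR_nonneg (N : ℕ) (c : ℂ) : 0 ≤ ktR N c := by unfold ktR; positivity

lemma ktR_le {c : ℂ} (hc : ‖c‖ ≤ 1) (N : ℕ) : ktR N c ≤ N := by
  unfold ktR
  rcases Nat.eq_zero_or_pos N with h | h
  · subst h; simp
  have hN : (0:ℝ) < N := by exact_mod_cast h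
  rw [div_le_iff₀ hN]
  have := geo_norm hc N
  nlinarith [norm_nonneg (∑ i ∈ Finset.range N, c^i)]

lemma ktR_lip {c c' : ℂ} (hc : ‖c‖ ≤ 1) (hc' : ‖c'‖ ≤ 1) (N : ℕ) :
    |ktR N c - ktR N c'| ≤ 2 * N^2 * ‖c - c'‖ := by
  unfold ktR
  rcases Nat.eq_zero_or_pos N with h | h
  · subst h; simp
  have hN : (0:ℝ) < N := by exact_mod_cast h
  have h1 := geo_norm hc N
  have h2 := geo_norm hc' N
  have h3 := geo_sub_norm hc hc' N
  set a := ‖∑ i ∈ Finset.range N, c^i‖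
  set b := ‖∑ i ∈ Finset.range N, c'^i‖
  have ha : 0 ≤ a := norm_nonneg _
  have hb : 0 ≤ b := norm_nonneg _
  have e : a^2/N - b^2/N = (a - b) * ((a + b)/N) := by ring
  rw [e, abs_mul, abs_of_nonneg (by positivity : 0 ≤ (a+b)/N)]
  have h4 : (a+b)/N ≤ 2 := by rw [div_le_iff₀ hN]; linarith
  calc |a - b| * ((a+b)/N) ≤ (N * N * ‖c - c'‖) * 2 := mul_le_mul h3 h4 (by positivity) (by positivity)
    _ = _ := by ring

/-- square root of `Om` -/
def uu (N : ℕ) (t : ℝ) : ℝ := ‖∑ i ∈ Finset.range N, Ee 1 t ^ i‖ / N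

lemma Om_uu (N : ℕ) (t : ℝ) : Om N t = uu N t ^ 2 := by
  unfold Om uu ktR; rw [div_pow, pow_two (N:ℝ), div_div]

lemma Ee_norm (m : ℤ) (t : ℝ) : ‖Ee m t‖ = 1 := by unfold Ee; rw [Complex.norm_exp_ofReal_mul_I]

lemma uu_nonneg (N : ℕ) (t : ℝ) : 0 ≤ uu N t := by unfold uu; positivity

lemma uu_le_one (N : ℕ) (t : ℝ) : uu N t ≤ 1 := by
  unfold uu
  rcases Nat.eq_zero_or_pos N with h | h
  · subst h; simp
  have hN : (0:ℝ) < N := by exact_mod_cast h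
  rw [div_le_one hN]; exact geo_norm (Ee_norm 1 t).le N

lemma Ee_lip (t t' : ℝ) : ‖Ee 1 t - Ee 1 t'‖ ≤ 2 * |t - t'| := by
  have : Ee 1 t - Ee 1 t' = Ee 1 t' * (Complex.exp (Complex.I * ((2 * (t - t') : ℝ) : ℂ)) - 1) := by
    unfold Ee; rw [mul_sub, mul_one, ← Complex.exp_add]; congr 2; push_cast; ring
  rw [this, norm_mul, Ee_norm, one_mul]
  refine (Real.norm_exp_I_mul_ofReal_sub_one_le).trans ?_
  rw [Real.norm_eq_abs, abs_mul]; simp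

lemma uu_lip (N : ℕ) (t t' : ℝ) : |uu N t - uu N t'| ≤ 2 * (N * |t - t'|) := by
  unfold uu
  rcases Nat.eq_zero_or_pos N with h | h
  · subst h; simp
  have hN : (0:ℝ) < N := by exact_mod_cast h
  rw [← sub_div, abs_div, abs_of_pos hN, div_le_iff₀ hN]
  have h1 := geo_sub_norm (Ee_norm 1 t).le (Ee_norm 1 t').le N
  have h2 := Ee_lip t t'
  calc _ ≤ N * N * ‖Ee 1 t - Ee 1 t'‖ := h1
    _ ≤ N * N * (2 * |t - t'|) := by gcongr
    _ = _ := by ring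

lemma Ee_sub_one (t : ℝ) : ‖Ee 1 t - 1‖ = 2 * |Real.sin t| := by
  unfold Ee
  have : (((2 * ((1:ℤ):ℝ) * t : ℝ) : ℂ) * Complex.I) = Complex.I * ((2 * t : ℝ) : ℂ) := by push_cast; ring
  rw [this, Complex.norm_exp_I_mul_ofReal_sub_one, Real.norm_eq_abs, abs_mul]
  congr 1
  · simp
  · congr 2; ring

lemma uu_decay {N : ℕ} (hN : 1 ≤ N) {t : ℝ} (ht : 0 ≤ Real.sin t) : uu N t * (1 + N * Real.sin t) ≤ 2 := by
  have h1 := uu_le_one N t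
  have h2 : uu N t * (N * Real.sin t) ≤ 1 := by
    unfold uu
    have hN' : (N:ℝ) ≠ 0 := by positivity
    have e : ‖∑ i ∈ Finset.range N, Ee 1 t ^ i‖ / N * (N * Real.sin t) = (‖∑ i ∈ Finset.range N, Ee 1 t ^ i‖ * ‖Ee 1 t - 1‖) / 2 := by
      rw [Ee_sub_one, abs_of_nonneg ht]; field_simp
    rw [e, ← norm_mul, geom_sum_mul]
    have := norm_sub_le (Ee 1 t ^ N) 1
    rw [norm_pow, Ee_norm, one_pow, norm_one] at this
    linarith
  linarith

lemma Dk_abs (R : ℕ) {N : ℕ} (hN : 1 ≤ N) (t : ℝ) : |Dk (R*N) t / N| ≤ 2 * R + 1 := by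
  have hN' : (1:ℝ) ≤ N := by exact_mod_cast hN
  rw [abs_div, abs_of_pos (by positivity : (0:ℝ) < N), div_le_iff₀ (by positivity)]
  unfold Dk
  have h1 : |∑ i ∈ Finset.range (R*N), 2 * Real.cos (2 * (i + 1) * t)| ≤ ∑ i ∈ Finset.range (R*N), (2:ℝ) := by
    refine (Finset.abs_sum_le_sum_abs _ _).trans (Finset.sum_le_sum fun i _ => ?_)
    rw [abs_mul, abs_two]
    linarith [Real.abs_cos_le_one (2 * (i+1) * t)]
  rw [Finset.sum_const, Finset.card_range, nsmul_eq_mul] at h1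
  refine (abs_add_le _ _).trans ?_
  rw [abs_one]
  push_cast at h1
  nlinarith

lemma cos_lip (a b : ℝ) : |Real.cos a - Real.cos b| ≤ |a - b| := by
  have := Real.abs_cos_sub_cos_le a b
  exact this

lemma Dk_lip (R : ℕ) {N : ℕ} (hN : 1 ≤ N) (t t' : ℝ) : |Dk (R*N) t / N - Dk (R*N) t' / N| ≤ 4 * R^2 * (N * |t - t'|) := by
  have hN' : (1:ℝ) ≤ N := by exact_mod_cast hN
  rw [← sub_div, abs_div, abs_of_pos (by positivity : (0:ℝ) < N), div_le_iff₀ (by positivity)]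
  unfold Dk
  rw [add_sub_add_left_eq_sub, ← Finset.sum_sub_distrib]
  refine (Finset.abs_sum_le_sum_abs _ _).trans ?_
  refine (Finset.sum_le_sum (g := fun _ => 4 * ((R * N : ℕ) : ℝ) * |t - t'|) fun i hi => ?_).trans ?_
  · rw [Finset.mem_range] at hi
    have hi' : (i:ℝ) + 1 ≤ (R * N : ℕ) := by exact_mod_cast hi
    rw [← mul_sub, abs_mul, abs_two]
    have := cos_lip (2 * (i+1) * t) (2 * (i+1) * t')
    rw [← mul_sub, abs_mul, abs_of_nonneg (by positivity : (0:ℝ) ≤ 2 * (i+1))] at this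
    have h3 : 2 * ((i:ℝ)+1) * |t - t'| ≤ 2 * ((R * N : ℕ):ℝ) * |t - t'| := by gcongr
    linarith
  · rw [Finset.sum_const, Finset.card_range, nsmul_eq_mul]; push_cast
    apply le_of_eq; ring

lemma prod_reg {d : ℕ} {A δ Q c c' r r' u u' v v' : ℝ} (hA : 1 ≤ A) (hδ : 0 ≤ δ) (hQ0 : 0 ≤ Q) (hQ : Q ≤ 1)
    (hc : |c| ≤ 1) (hc' : |c'| ≤ 1) (hcc : |c - c'| ≤ A * δ)
    (hr : |r| * Q ≤ A) (hr' : |r'| * Q ≤ A) (hrr : |r - r'| ≤ A * δ)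
    (hu : |u| ≤ A * Q) (hu' : |u'| ≤ A * Q) (huu : |u - u'| ≤ A * δ)
    (hv : |v| ≤ A) (hv' : |v'| ≤ A) (hvv : |v - v'| ≤ A * δ) :
    |c * r * u^(2*d+4) * v^(2*d+1) - c' * r' * u'^(2*d+4) * v'^(2*d+1)| ≤ (4*d+7) * A^(4*d+7) * δ * Q^(2*d+1)
    ∧ |c' * r' * u'^(2*d+4) * v'^(2*d+1)| ≤ A^(4*d+7) * Q^(2*d+1) := by
  have hX' : |c' * r'| * Q ≤ A := by
    rw [abs_mul]; nlinarith [mul_nonneg (abs_nonneg r') hQ0, abs_nonneg c']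
  have hXX : |c * r - c' * r'| * Q ≤ 2 * A^2 * δ := by
    have e : c * r - c' * r' = (c - c') * r + c' * (r - r') := by ring
    rw [e]
    have h1 : |(c - c') * r + c' * (r - r')| * Q ≤ (|c - c'| * |r| + |c'| * |r - r'|) * Q := by
      gcongr; rw [← abs_mul, ← abs_mul]; exact abs_add_le _ _
    have h2 : |c - c'| * (|r| * Q) ≤ (A * δ) * A := mul_le_mul hcc hr (by positivity) (by positivity)
    have h3 : |c'| * (|r - r'| * Q) ≤ 1 * (A * δ) := by
      refine mul_le_mul hc' ?_ (by positivity) (by norm_num)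
      calc |r - r'| * Q ≤ |r - r'| * 1 := by gcongr
        _ ≤ A * δ := by linarith
    nlinarith [mul_nonneg (mul_nonneg (by linarith : 0 ≤ A) hδ) (by linarith : 0 ≤ A - 1)]
  have pu : ∀ k, |u^k| ≤ A^k * Q^k := fun k => by rw [abs_pow, ← mul_pow]; gcongr
  have pu' : ∀ k, |u'^k| ≤ A^k * Q^k := fun k => by rw [abs_pow, ← mul_pow]; gcongr
  have pv : ∀ k, |v^k| ≤ A^k := fun k => by rw [abs_pow]; gcongr
  have pv' : ∀ k, |v'^k| ≤ A^k := fun k => by rw [abs_pow]; gcongr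
  have duu : |u^(2*d+4) - u'^(2*d+4)| ≤ (2*d+4) * (A * δ) * (A^(2*d+3) * Q^(2*d+3)) := by
    refine (abs_pow_sub_pow_le _ _ _).trans ?_
    rw [← mul_pow, mul_comm (2*(d:ℝ)+4)]
    push_cast

    gcongr
    exact max_le hu hu'
  have dvv : |v^(2*d+1) - v'^(2*d+1)| ≤ (2*d+1) * (A * δ) * A^(2*d) := by
    refine (abs_pow_sub_pow_le _ _ _).trans ?_
    rw [mul_comm (2*(d:ℝ)+1)]
    push_cast

    gcongr
    exact max_le hv hv'
  have A0 : 0 ≤ A := by linarith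
  have Q1 : Q^(2*d+3) ≤ Q^(2*d+1) := pow_le_pow_of_le_one hQ0 hQ (by omega)
  have Q2 : Q^(2*d+2) ≤ Q^(2*d+1) := pow_le_pow_of_le_one hQ0 hQ (by omega)
  have qe : Q^(2*d+4) = Q * Q^(2*d+3) := by ring
  have qe' : Q^(2*d+3) = Q * Q^(2*d+2) := by ring
  constructor
  · have e : c * r * u^(2*d+4) * v^(2*d+1) - c' * r' * u'^(2*d+4) * v'^(2*d+1)
      = (c * r - c' * r') * u^(2*d+4) * v^(2*d+1) + (c' * r') * (u^(2*d+4) - u'^(2*d+4)) * v^(2*d+1)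
        + (c' * r') * u'^(2*d+4) * (v^(2*d+1) - v'^(2*d+1)) := by ring
    rw [e]
    have t1 : |(c * r - c' * r') * u^(2*d+4) * v^(2*d+1)| ≤ 2 * A^(4*d+7) * δ * Q^(2*d+1) := by
      rw [abs_mul, abs_mul]
      calc _ ≤ |c * r - c' * r'| * (A^(2*d+4) * Q^(2*d+4)) * A^(2*d+1) := by gcongr; exacts [pu _, pv _]
        _ = (|c * r - c' * r'| * Q) * (A^(4*d+5) * Q^(2*d+3)) := by ring
        _ ≤ (2 * A^2 * δ) * (A^(4*d+5) * Q^(2*d+1)) := by gcongr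
        _ = _ := by ring
    have t2 : |(c' * r') * (u^(2*d+4) - u'^(2*d+4)) * v^(2*d+1)| ≤ (2*d+4) * A^(4*d+7) * δ * Q^(2*d+1) := by
      rw [abs_mul, abs_mul]
      calc _ ≤ |c' * r'| * ((2*d+4) * (A * δ) * (A^(2*d+3) * Q^(2*d+3))) * A^(2*d+1) := by gcongr; exact pv _
        _ = (|c' * r'| * Q) * ((2*d+4) * (A^(4*d+5) * δ * Q^(2*d+2))) := by rw [qe']; ring
        _ ≤ A * ((2*d+4) * (A^(4*d+5) * δ * Q^(2*d+1))) := by gcongr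
        _ = (2*d+4) * A^(4*d+6) * δ * Q^(2*d+1) := by ring
        _ ≤ _ := by gcongr <;> omega
    have t3 : |(c' * r') * u'^(2*d+4) * (v^(2*d+1) - v'^(2*d+1))| ≤ (2*d+1) * A^(4*d+7) * δ * Q^(2*d+1) := by
      rw [abs_mul, abs_mul]
      calc _ ≤ |c' * r'| * (A^(2*d+4) * Q^(2*d+4)) * ((2*d+1) * (A * δ) * A^(2*d)) := by gcongr; exact pu' _
        _ = (|c' * r'| * Q) * ((2*d+1) * (A^(4*d+5) * δ * Q^(2*d+3))) := by rw [qe]; ring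
        _ ≤ A * ((2*d+1) * (A^(4*d+5) * δ * Q^(2*d+1))) := by gcongr
        _ = (2*d+1) * A^(4*d+6) * δ * Q^(2*d+1) := by ring
        _ ≤ _ := by gcongr <;> omega
    refine (abs_add_three _ _ _).trans ?_
    calc _ ≤ _ := add_le_add (add_le_add t1 t2) t3
      _ = _ := by ring
  · rw [abs_mul, abs_mul]
    calc _ ≤ |c' * r'| * (A^(2*d+4) * Q^(2*d+4)) * A^(2*d+1) := by gcongr; exacts [pu' _, pv' _]
      _ = (|c' * r'| * Q) * (A^(4*d+5) * Q^(2*d+3)) := by rw [qe]; ring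
      _ ≤ A * (A^(4*d+5) * Q^(2*d+1)) := by gcongr
      _ = A^(4*d+6) * Q^(2*d+1) := by ring
      _ ≤ _ := by gcongr <;> omega

end

section

/-- sine of the Fubini-Study distance -/
def xx {n : ℕ} (y w : EuclideanSpace ℂ (Fin n)) : ℝ := Real.sqrt (1 - ‖inner ℂ y w‖^2)

variable {n : ℕ}

lemma inner_le_one {y w : EuclideanSpace ℂ (Fin n)} (hy : ‖y‖ = 1) (hw : ‖w‖ = 1) : ‖inner ℂ y w‖ ≤ 1 := by
  have := norm_inner_le_norm (𝕜 := ℂ) y w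
  rwa [hy, hw, one_mul] at this

lemma proj_norm {y w : EuclideanSpace ℂ (Fin n)} (hw : ‖w‖ = 1) :
    ‖y - (inner ℂ w y) • w‖^2 = ‖y‖^2 - ‖inner ℂ y w‖^2 := by
  rw [@norm_sub_sq ℂ, inner_smul_right, norm_smul, hw, mul_one, norm_inner_symm y w, ← inner_conj_symm y w]
  rw [Complex.mul_conj']
  have : RCLike.re ((‖inner ℂ w y‖:ℂ)^2) = ‖inner ℂ w y‖^2 := by
    rw [← Complex.ofReal_pow]; exact Complex.ofReal_re _
  rw [this]; ring

lemma xx_eq {y w : EuclideanSpace ℂ (Fin n)} (hy : ‖y‖ = 1) (hw : ‖w‖ = 1) :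
    xx y w = ‖y - (inner ℂ w y) • w‖ := by
  unfold xx
  rw [← Real.sqrt_sq (norm_nonneg (y - (inner ℂ w y) • w)), proj_norm hw, hy]; simp

lemma xx_symm (y w : EuclideanSpace ℂ (Fin n)) : xx y w = xx w y := by
  unfold xx; rw [norm_inner_symm]

lemma xx_nonneg (y w : EuclideanSpace ℂ (Fin n)) : 0 ≤ xx y w := Real.sqrt_nonneg _

lemma xx_lip {y y' w : EuclideanSpace ℂ (Fin n)} (hy : ‖y‖ = 1) (hy' : ‖y'‖ = 1) (hw : ‖w‖ = 1) :
    |xx y w - xx y' w| ≤ ‖y - y'‖ := by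
  rw [xx_eq hy hw, xx_eq hy' hw]
  refine (abs_norm_sub_norm_le _ _).trans ?_
  have e : y - inner ℂ w y • w - (y' - inner ℂ w y' • w) = (y - y') - inner ℂ w (y - y') • w := by
    rw [inner_sub_right, sub_smul]; abel
  rw [e]
  have := proj_norm (y := y - y') hw
  refine (sq_le_sq₀ (norm_nonneg _) (norm_nonneg _)).1 ?_
  rw [this]; nlinarith [sq_nonneg ‖inner ℂ (y - y') w‖]

lemma inner_lip {y y' w : EuclideanSpace ℂ (Fin n)} (hw : ‖w‖ = 1) :
    ‖inner ℂ y w - inner ℂ y' w‖ ≤ ‖y - y'‖ := by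
  rw [← inner_sub_left]
  have := norm_inner_le_norm (𝕜 := ℂ) (y - y') w
  rwa [hw, mul_one] at this

/-- the angle -/
def tt (y w : EuclideanSpace ℂ (Fin n)) : ℝ := Real.arccos ‖inner ℂ y w‖

lemma tt_mem {y w : EuclideanSpace ℂ (Fin n)} : 0 ≤ tt y w ∧ tt y w ≤ Real.pi/2 :=
  ⟨Real.arccos_nonneg _, Real.arccos_le_pi_div_two.2 (norm_nonneg _)⟩

lemma sin_tt (y w : EuclideanSpace ℂ (Fin n)) : Real.sin (tt y w) = xx y w := by
  unfold tt xx; rw [Real.sin_arccos]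

lemma cos_tt {y w : EuclideanSpace ℂ (Fin n)} (hy : ‖y‖ = 1) (hw : ‖w‖ = 1) : Real.cos (tt y w) = ‖inner ℂ y w‖ := by
  unfold tt; rw [Real.cos_arccos (by linarith [norm_nonneg (inner ℂ y w)]) (inner_le_one hy hw)]

lemma xx_le_one (y w : EuclideanSpace ℂ (Fin n)) : xx y w ≤ 1 := by rw [← sin_tt]; exact Real.sin_le_one _

lemma tt_lip {y y' w : EuclideanSpace ℂ (Fin n)} (hy : ‖y‖ = 1) (hy' : ‖y'‖ = 1) (hw : ‖w‖ = 1) :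
    |tt y w - tt y' w| ≤ 4 * ‖y - y'‖ := by
  have h1 := xx_lip hy hy' hw
  have h2 : |‖inner ℂ y w‖ - ‖inner ℂ y' w‖| ≤ ‖y - y'‖ := (abs_norm_sub_norm_le _ _).trans (inner_lip hw)
  have m1 := tt_mem (y := y) (w := w)
  have m2 := tt_mem (y := y') (w := w)
  have hs : |Real.sin (tt y w - tt y' w)| ≤ 2 * ‖y - y'‖ := by
    rw [Real.sin_sub, sin_tt, sin_tt, cos_tt hy hw, cos_tt hy' hw]
    have e : xx y w * ‖inner ℂ y' w‖ - ‖inner ℂ y w‖ * xx y' w = (xx y w - xx y' w) * ‖inner ℂ y' w‖ - xx y' w * (‖inner ℂ y w‖ - ‖inner ℂ y' w‖) := by ring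
    rw [e]
    refine (abs_sub _ _).trans ?_
    rw [abs_mul, abs_mul, abs_of_nonneg (norm_nonneg _), abs_of_nonneg (xx_nonneg _ _)]
    have a1 := inner_le_one hy' hw
    have a2 := xx_le_one y' w
    have := mul_le_mul h1 a1 (norm_nonneg _) (norm_nonneg _)
    have := mul_le_mul a2 h2 (abs_nonneg _) (by norm_num)
    linarith
  have h3 := Real.mul_abs_le_abs_sin (x := tt y w - tt y' w) (by rw [abs_le]; constructor <;> linarith)
  have hp := Real.pi_pos
  have hp4 := Real.pi_le_four
  have : 2 / Real.pi * |tt y w - tt y' w| ≤ 2 * ‖y - y'‖ := h3.trans hs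
  rw [div_mul_eq_mul_div, div_le_iff₀ hp] at this
  nlinarith [norm_nonneg (y - y')]

lemma Kk_kap (d R N : ℕ) (y w : EuclideanSpace ℂ (Fin n)) :
    Kk (kap d R N) N (inner ℂ y w) = kapT d R N (tt y w) * ktR N (inner ℂ y w) := rfl

lemma kapT_eq (d R : ℕ) {N : ℕ} (hN : 1 ≤ N) (t : ℝ) : kapT d R N t = 1 / ((gC d 0).toReal * Wd d) * N^(2*d) *
    (Real.cos t * (N * Real.sin t) * uu N t ^ (2*d+4) * (Dk (R*N) t / N)^(2*d+1)) := by
  unfold kapT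
  have : (N:ℝ) ≠ 0 := by positivity
  rw [Om_uu, ← pow_mul, show 2*(d+2) = 2*d+4 by ring, div_pow]
  field_simp
  ring

set_option maxHeartbeats 1600000 in
theorem Kreg (n d R : ℕ) : ∃ C : ℝ, 0 < C ∧ ∀ N : ℕ, 1 ≤ N → ∀ y y' w : EuclideanSpace ℂ (Fin n), ‖y‖ = 1 → ‖y'‖ = 1 → ‖w‖ = 1 →
    N * ‖y - y'‖ ≤ 1 →
    |Kk (kap d R N) N (inner ℂ y w) - Kk (kap d R N) N (inner ℂ y' w)| ≤
      C * N^(2*d+1) * (N * ‖y - y'‖) * ((1 + N * xx y w)⁻¹)^(2*d+1) := by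
  set c0 : ℝ := 1 / ((gC d 0).toReal * Wd d) with hc0
  have hG : 0 < (gC d 0).toReal := ENNReal.toReal_pos (gC_ne_zero _ _) (gC_ne_top _ _)
  have hc0p : 0 < c0 := by have := Wd_pos d; positivity
  set A : ℝ := 16 * R^2 + 2 * R + 21 with hA
  refine ⟨c0 * (((4*d+7) * A^(4*d+7)) + 2 * A^(4*d+7)), by positivity, ?_⟩
  intro N hN y y' w hy hy' hw hdel
  have hN' : (1:ℝ) ≤ N := by exact_mod_cast hN
  set δ := N * ‖y - y'‖ with hδ
  have hδ0 : 0 ≤ δ := by positivity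
  have htl : N * |tt y w - tt y' w| ≤ 4 * δ := by
    have := tt_lip hy hy' hw
    rw [hδ]; nlinarith
  have htl1 : |tt y w - tt y' w| ≤ 4 * δ := le_trans (by nlinarith [abs_nonneg (tt y w - tt y' w)]) htl
  have x0 := xx_nonneg y w
  have x0' := xx_nonneg y' w
  have hxl : |N * xx y w - N * xx y' w| ≤ δ := by
    rw [← mul_sub, abs_mul, abs_of_nonneg (by positivity)]
    have := xx_lip hy hy' hw
    rw [hδ]; gcongr
  have hxl' := abs_le.1 hxl
  set P := 1 + N * xx y w with hP
  have nx : 0 ≤ N * xx y w := by positivity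
  have nx' : 0 ≤ N * xx y' w := by positivity
  have hP1 : 1 ≤ P := by rw [hP]; linarith
  have hP0 : 0 < P := by linarith
  have hA1 : (21:ℝ) ≤ A := by rw [hA]; nlinarith [sq_nonneg (R:ℝ)]
  have hR2 : (0:ℝ) ≤ R := by positivity
  have dd := uu_decay hN (t := tt y w) (by rw [sin_tt]; exact x0)
  have dd' := uu_decay hN (t := tt y' w) (by rw [sin_tt]; exact x0')
  rw [sin_tt] at dd dd'
  have u0 := uu_nonneg N (tt y w)
  have u0' := uu_nonneg N (tt y' w)
  obtain ⟨k1, k2⟩ := prod_reg (d := d) (A := A) (δ := δ) (Q := P⁻¹) (c := Real.cos (tt y w)) (c' := Real.cos (tt y' w))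
    (r := N * Real.sin (tt y w)) (r' := N * Real.sin (tt y' w)) (u := uu N (tt y w)) (u' := uu N (tt y' w))
    (v := Dk (R*N) (tt y w) / N) (v' := Dk (R*N) (tt y' w) / N)
    (by linarith) hδ0 (by positivity) (inv_le_one_of_one_le₀ hP1)
    (Real.abs_cos_le_one _) (Real.abs_cos_le_one _) ((cos_lip _ _).trans (by nlinarith))
    (by
      rw [sin_tt, abs_of_nonneg nx, ← div_eq_mul_inv, div_le_iff₀ hP0]; nlinarith)
    (by
      rw [sin_tt, abs_of_nonneg nx', ← div_eq_mul_inv, div_le_iff₀ hP0]; nlinarith)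
    (by rw [sin_tt, sin_tt]; nlinarith)
    (by
      rw [abs_of_nonneg u0, ← div_eq_mul_inv, le_div_iff₀ hP0]; linarith)
    (by
      rw [abs_of_nonneg u0', ← div_eq_mul_inv, le_div_iff₀ hP0]
      have h1 : P ≤ 2 * (1 + N * xx y' w) := by rw [hP]; linarith
      nlinarith)
    ((uu_lip _ _ _).trans (by nlinarith))
    ((Dk_abs R hN _).trans (by rw [hA]; nlinarith [sq_nonneg (R:ℝ)]))
    ((Dk_abs R hN _).trans (by rw [hA]; nlinarith [sq_nonneg (R:ℝ)]))
    ((Dk_lip R hN _ _).trans (by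
      rw [hA]
      have : 4 * (R:ℝ)^2 * (N * |tt y w - tt y' w|) ≤ 4 * (R:ℝ)^2 * (4 * δ) := by gcongr
      nlinarith))
  rw [Kk_kap, Kk_kap]
  have kt1 := ktR_le (inner_le_one hy hw) N
  have kt0 := ktR_nonneg N (inner ℂ y w)
  have ktl := (ktR_lip (inner_le_one hy hw) (inner_le_one hy' hw) N).trans
    (mul_le_mul_of_nonneg_left (inner_lip (y := y) (y' := y') hw) (by positivity))
  rw [kapT_eq d R hN, kapT_eq d R hN, ← hc0]
  set X := Real.cos (tt y w) * (N * Real.sin (tt y w)) * uu N (tt y w) ^ (2*d+4) * (Dk (R*N) (tt y w) / N)^(2*d+1)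
  set X' := Real.cos (tt y' w) * (N * Real.sin (tt y' w)) * uu N (tt y' w) ^ (2*d+4) * (Dk (R*N) (tt y' w) / N)^(2*d+1)
  set k := ktR N (inner ℂ y w)
  set k' := ktR N (inner ℂ y' w)
  have e : c0 * N^(2*d) * X * k - c0 * N^(2*d) * X' * k' = c0 * N^(2*d) * ((X - X') * k + X' * (k - k')) := by ring
  rw [e, abs_mul, abs_of_nonneg (by positivity)]
  have b1 : |(X - X') * k + X' * (k - k')| ≤ ((4*d+7) * A^(4*d+7) * δ * P⁻¹^(2*d+1)) * N + (A^(4*d+7) * P⁻¹^(2*d+1)) * (2 * N^2 * ‖y - y'‖) := by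
    refine (abs_add_le _ _).trans ?_
    rw [abs_mul, abs_mul, abs_of_nonneg kt0]
    exact add_le_add (mul_le_mul k1 kt1 kt0 (by positivity)) (mul_le_mul k2 ktl (abs_nonneg _) (by positivity))
  calc _ ≤ c0 * N^(2*d) * (((4*d+7) * A^(4*d+7) * δ * P⁻¹^(2*d+1)) * N + (A^(4*d+7) * P⁻¹^(2*d+1)) * (2 * N^2 * ‖y - y'‖)) := by gcongr
    _ = _ := by rw [hδ]; ring

end

section

variable {n : ℕ}

lemma continuous_xx : Continuous (fun p : EuclideanSpace ℂ (Fin n) × EuclideanSpace ℂ (Fin n) => xx p.1 p.2) := by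
  unfold xx; fun_prop

lemma continuous_xx_right (y : EuclideanSpace ℂ (Fin n)) : Continuous (xx y) := by
  unfold xx; fun_prop

lemma tube_int {d : ℕ} (τ : Measure (EuclideanSpace ℂ (Fin n))) (y : EuclideanSpace ℂ (Fin n)) {A : ℝ} (hA : 0 ≤ A)
    (h : ∀ r, 0 < r → τ {w | xx y w < r} ≤ ENNReal.ofReal (A * r^(2*d))) {N : ℕ} (hN : 1 ≤ N) :
    ∫⁻ w, ENNReal.ofReal (((1 + N * xx y w)⁻¹)^(2*d+1)) ∂τ ≤ ENNReal.ofReal (2^(2*d+1) * A / N^(2*d)) := by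
  have hN' : (0:ℝ) < N := by positivity
  have hms : ∀ r, MeasurableSet {w | xx y w < r} := fun r => measurableSet_lt (continuous_xx_right y).measurable measurable_const
  have key : ∀ w, ENNReal.ofReal (((1 + N * xx y w)⁻¹)^(2*d+1)) ≤
      ∑' k : ℕ, ENNReal.ofReal (((2:ℝ)⁻¹^k)^(2*d+1)) * ({w | xx y w < 2^(k+1)/N}).indicator 1 w := by
    intro w
    have x0 := xx_nonneg y w
    obtain ⟨k, hk1, hk2⟩ := exists_nat_pow_near (show (1:ℝ) ≤ 1 + N * xx y w by nlinarith [mul_nonneg hN'.le x0]) (one_lt_two)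
    refine le_trans ?_ (ENNReal.le_tsum k)
    have hmem : w ∈ {w | xx y w < 2^(k+1)/N} := by
      simp only [mem_setOf_eq]; rw [lt_div_iff₀ hN']; linarith
    rw [indicator_of_mem hmem, Pi.one_apply, mul_one]
    refine ENNReal.ofReal_le_ofReal ?_
    rw [inv_pow (2:ℝ)]
    gcongr
  refine (lintegral_mono key).trans ?_
  rw [lintegral_tsum]
  swap
  · intro k; exact ((measurable_one.indicator (hms _)).const_mul _).aemeasurable
  have h2 : ∀ k : ℕ, ∫⁻ w, ENNReal.ofReal (((2:ℝ)⁻¹^k)^(2*d+1)) * ({w | xx y w < 2^(k+1)/N}).indicator 1 w ∂τ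
      ≤ ENNReal.ofReal (2^(2*d) * A / N^(2*d) * (2:ℝ)⁻¹^k) := by
    intro k
    rw [lintegral_const_mul _ (measurable_one.indicator (hms _)), lintegral_indicator_one (hms _)]
    refine (mul_le_mul_right (h _ (by positivity)) _).trans ?_
    rw [← ENNReal.ofReal_mul (by positivity)]
    refine ENNReal.ofReal_le_ofReal (le_of_eq ?_)
    rw [div_pow, ← pow_mul, ← pow_mul, inv_pow, inv_pow]
    field_simp
    ring
  refine (ENNReal.tsum_le_tsum h2).trans ?_
  have hs : Summable (fun k : ℕ => 2^(2*d) * A / N^(2*d) * (2:ℝ)⁻¹^k) := (summable_geometric_of_lt_one (by norm_num) (by norm_num)).mul_left _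
  rw [← ENNReal.ofReal_tsum_of_nonneg (fun k => by positivity) hs, tsum_mul_left, tsum_geometric_of_lt_one (by norm_num) (by norm_num)]
  refine ENNReal.ofReal_le_ofReal (le_of_eq ?_)
  ring

/-- the mollified function -/
def GG (κ : ℝ → ℝ) (N : ℕ) (τ : Measure (EuclideanSpace ℂ (Fin n))) (φ : EuclideanSpace ℂ (Fin n) → ℂ) (y : EuclideanSpace ℂ (Fin n)) : ℂ :=
  ∫ w, (Kk κ N (inner ℂ y w) : ℂ) * φ w ∂τ

lemma Kk_bdd {κ : ℝ → ℝ} {B : ℝ} (hB : ∀ x, |κ x| ≤ B) (N : ℕ) {c : ℂ} (hc : ‖c‖ ≤ 1) : |Kk κ N c| ≤ B * N := by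
  unfold Kk
  have hB0 : 0 ≤ B := (abs_nonneg _).trans (hB 0)
  rw [abs_mul, abs_of_nonneg (ktR_nonneg N c)]
  exact mul_le_mul (hB _) (ktR_le hc N) (ktR_nonneg _ _) hB0

lemma GG_integrable {κ : ℝ → ℝ} (hκ : Measurable κ) {B : ℝ} (hB : ∀ x, |κ x| ≤ B) (N : ℕ) (τ : Measure (EuclideanSpace ℂ (Fin n))) [IsFiniteMeasure τ]
    (hτ : ∀ᵐ w ∂τ, ‖w‖ = 1) {φ : EuclideanSpace ℂ (Fin n) → ℂ} (hφ : Measurable φ) (hφ1 : ∀ w, ‖φ w‖ ≤ 1) {y : EuclideanSpace ℂ (Fin n)} (hy : ‖y‖ = 1) :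
    Integrable (fun w => (Kk κ N (inner ℂ y w) : ℂ) * φ w) τ := by
  refine Integrable.of_bound (C := B * N) ?_ ?_
  · have h1 : Measurable (fun w : EuclideanSpace ℂ (Fin n) => inner ℂ y w) := (by fun_prop : Continuous _).measurable
    have h2 : Measurable (fun w : EuclideanSpace ℂ (Fin n) => (Kk κ N (inner ℂ y w) : ℂ)) :=
      Complex.measurable_ofReal.comp ((measurable_Kk hκ N).comp h1)
    exact (h2.mul hφ).aestronglyMeasurable
  · filter_upwards [hτ] with w hw
    have h1 := Kk_bdd hB N (inner_le_one hy hw)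
    rw [norm_mul, Complex.norm_real, Real.norm_eq_abs]
    calc _ ≤ (B * N) * 1 := mul_le_mul h1 (hφ1 w) (norm_nonneg _) ((abs_nonneg _).trans h1)
      _ = _ := by ring

theorem Greg (n d R : ℕ) : ∃ C : ℝ, 0 < C ∧ ∀ (τ : Measure (EuclideanSpace ℂ (Fin n))) [IsFiniteMeasure τ]
    (_ : ∀ᵐ w ∂τ, ‖w‖ = 1) (φ : EuclideanSpace ℂ (Fin n) → ℂ) (_ : Measurable φ) (_ : ∀ w, ‖φ w‖ ≤ 1)
    (A : ℝ) (_ : 0 ≤ A) (N : ℕ) (_ : 1 ≤ N) (y y' : EuclideanSpace ℂ (Fin n)) (_ : ‖y‖ = 1) (_ : ‖y'‖ = 1)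
    (_ : ∀ r, 0 < r → τ {w | xx y w < r} ≤ ENNReal.ofReal (A * r^(2*d))) (_ : N * ‖y - y'‖ ≤ 1),
    ‖GG (kap d R N) N τ φ y - GG (kap d R N) N τ φ y'‖ ≤ C * A * N * (N * ‖y - y'‖) := by
  obtain ⟨C, hC, hK⟩ := Kreg n d R
  refine ⟨C * 2^(2*d+1), by positivity, ?_⟩
  intro τ _ hτ φ hφ hφ1 A hA N hN y y' hy hy' htube hdel
  obtain ⟨B, hB⟩ := kap_bdd d R N
  have hκ := (kap_cont d R N).measurable
  unfold GG
  rw [← integral_sub (GG_integrable hκ hB N τ hτ hφ hφ1 hy) (GG_integrable hκ hB N τ hτ hφ hφ1 hy')]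
  have hN' : (0:ℝ) < N := by positivity
  have h1 := tube_int (d := d) τ y hA htube hN
  have hb : ∀ᵐ w ∂τ, ‖(Kk (kap d R N) N (inner ℂ y w) : ℂ) * φ w - (Kk (kap d R N) N (inner ℂ y' w) : ℂ) * φ w‖ₑ ≤
     ENNReal.ofReal (C * N^(2*d+1) * (N * ‖y - y'‖)) * ENNReal.ofReal (((1 + N * xx y w)⁻¹)^(2*d+1)) := by
    filter_upwards [hτ] with w hw
    rw [← ENNReal.ofReal_mul (by positivity), ← ofReal_norm_eq_enorm, ← sub_mul, norm_mul, ← Complex.ofReal_sub, Complex.norm_real, Real.norm_eq_abs]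
    refine ENNReal.ofReal_le_ofReal ?_
    have := hK N hN y y' w hy hy' hw hdel
    calc _ ≤ |Kk (kap d R N) N (inner ℂ y w) - Kk (kap d R N) N (inner ℂ y' w)| * 1 := by gcongr; exact hφ1 w
      _ ≤ _ := by rw [mul_one]; exact this
  have h2 := enorm_integral_le_lintegral_enorm (μ := τ) (fun w => (Kk (kap d R N) N (inner ℂ y w) : ℂ) * φ w - (Kk (kap d R N) N (inner ℂ y' w) : ℂ) * φ w)
  have h3 := h2.trans (lintegral_mono_ae hb)
  rw [lintegral_const_mul' _ _ ENNReal.ofReal_ne_top] at h3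
  have h4 := h3.trans (mul_le_mul_right h1 _)
  rw [← ENNReal.ofReal_mul (by positivity), ← ofReal_norm_eq_enorm, ENNReal.ofReal_le_ofReal_iff (by positivity)] at h4
  refine h4.trans (le_of_eq ?_)
  field_simp
  ring

end

section

/-- Stone-Weierstrass in polynomial form. -/
lemma dens0 {ι : Type*} (K : Set (ι → ℂ)) (hK : IsCompact K) (s : ι → ι)
    (hs : ∀ x ∈ K, ∀ i, (starRingEnd ℂ) (x i) = x (s i)) (ψ : (ι → ℂ) → ℂ) (hψ : Continuous ψ)
    (ε : ℝ) (hε : 0 < ε) : ∃ P : MvPolynomial ι ℂ, ∀ x ∈ K, ‖MvPolynomial.eval x P - ψ x‖ < ε := by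
  haveI : CompactSpace K := isCompact_iff_compactSpace.1 hK
  let F : ι → C(K, ℂ) := fun i => ⟨fun x => x.1 i, (continuous_apply i).comp continuous_subtype_val⟩
  have hev : ∀ (P : MvPolynomial ι ℂ) (x : K), (MvPolynomial.aeval F P) x = MvPolynomial.eval x.1 P := by
    intro P x
    induction P using MvPolynomial.induction_on with
    | C a => simp [MvPolynomial.algebraMap_eq]
    | add p q hp hq => simp [hp, hq]
    | mul_X p i hp => simp [hp, F]
  let A : StarSubalgebra ℂ C(K, ℂ) :=
    { (MvPolynomial.aeval F : MvPolynomial ι ℂ →ₐ[ℂ] C(K, ℂ)).range with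
      star_mem' := by
        rintro _ ⟨P, rfl⟩
        refine ⟨MvPolynomial.rename s (MvPolynomial.map (starRingEnd ℂ) P), ?_⟩
        ext x
        change (MvPolynomial.aeval F _) x = star ((MvPolynomial.aeval F P) x)
        rw [hev, hev]
        induction P using MvPolynomial.induction_on with
        | C a => simp
        | add p q hp hq => simp [hp, hq]
        | mul_X p i hp => simp [hp]; left; exact (hs x.1 x.2 i).symm }
  have hA : A.topologicalClosure = ⊤ := by
    refine ContinuousMap.starSubalgebra_topologicalClosure_eq_top_of_separatesPoints A ?_
    intro x y hxy
    obtain ⟨i, hi⟩ : ∃ i, x.1 i ≠ y.1 i := by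
      by_contra! h
      exact hxy (Subtype.ext (funext h))
    exact ⟨_, ⟨F i, ⟨MvPolynomial.X i, by simp⟩, rfl⟩, hi⟩
  let Ψ : C(K, ℂ) := ⟨fun x => ψ x.1, by fun_prop⟩
  have hmem : Ψ ∈ A.topologicalClosure := by rw [hA]; trivial
  have hmem2 : Ψ ∈ closure (A : Set C(K, ℂ)) := hmem
  rw [Metric.mem_closure_iff] at hmem2
  obtain ⟨b, ⟨P, hP⟩, hb⟩ := hmem2 ε hε
  refine ⟨P, fun x hx => ?_⟩
  have h1 := ContinuousMap.dist_apply_le_dist (f := Ψ) (g := b) (⟨x, hx⟩ : K)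
  have h2 : b ⟨x, hx⟩ = MvPolynomial.eval x P := by rw [← hP]; exact hev P ⟨x, hx⟩
  rw [h2, dist_comm, dist_eq_norm] at h1
  exact h1.trans_lt hb

lemma ev_dense {n : ℕ} (ψ : EuclideanSpace ℂ (Fin n) → ℂ) (hψ : Continuous ψ) (ε : ℝ) (hε : 0 < ε) :
    ∃ P : Pol n, ∀ z, ‖z‖ = 1 → ‖ev P z - ψ z‖ < ε := by
  have hc : Continuous (evPt : EuclideanSpace ℂ (Fin n) → _) := by
    refine continuous_pi fun i => ?_
    rcases i with i | i
    · simp only [evPt, Sum.elim_inl]; fun_prop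
    · simp only [evPt, Sum.elim_inr]
      exact Complex.continuous_conj.comp (by fun_prop)
  have hcomp : IsCompact (evPt '' (Metric.sphere (0 : EuclideanSpace ℂ (Fin n)) 1)) :=
    (isCompact_sphere _ _).image hc
  obtain ⟨P, hP⟩ := dens0 _ hcomp Sum.swap (by
    rintro _ ⟨z, hz, rfl⟩ i
    rcases i with i | i <;> simp [evPt]) (fun x => ψ (WithLp.toLp 2 fun i => x (Sum.inl i))) (by fun_prop) ε hε
  refine ⟨P, fun z hz => ?_⟩
  exact hP (evPt z) ⟨z, by simpa using hz, rfl⟩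

lemma int_cont {n : ℕ} {ρ : Measure (EuclideanSpace ℂ (Fin n))} (hρ : ∀ᵐ w ∂ρ, ‖w‖ = 1)
    {F g : EuclideanSpace ℂ (Fin n) → ℂ} (hF : Continuous F) (hg : Integrable g ρ) :
    Integrable (fun z => (starRingEnd ℂ) (F z) * g z) ρ := by
  obtain ⟨B, hB⟩ := (isCompact_sphere (0 : EuclideanSpace ℂ (Fin n)) 1).exists_bound_of_continuousOn hF.continuousOn
  refine hg.bdd_mul (c := B) (Complex.continuous_conj.comp hF).aestronglyMeasurable ?_
  filter_upwards [hρ] with w hw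
  simpa using hB w (by simpa using hw)

/-- limit passage: if F approximable on the sphere by functions with zero pairing. -/
lemma pair_approx {n : ℕ} {ρ : Measure (EuclideanSpace ℂ (Fin n))} (hρ : ∀ᵐ w ∂ρ, ‖w‖ = 1)
    {ρ' : Measure (EuclideanSpace ℂ (Fin n))} (hρ' : ∀ᵐ w ∂ρ', ‖w‖ = 1)
    {F g g' : EuclideanSpace ℂ (Fin n) → ℂ} (hF : Continuous F) (hg : Integrable g ρ) (hg' : Integrable g' ρ')
    (h : ∀ ε > 0, ∃ P : EuclideanSpace ℂ (Fin n) → ℂ, Continuous P ∧ (∀ z, ‖z‖ = 1 → ‖P z - F z‖ < ε) ∧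
      ∫ z, (starRingEnd ℂ) (P z) * g z ∂ρ = ∫ z, (starRingEnd ℂ) (P z) * g' z ∂ρ') :
    ∫ z, (starRingEnd ℂ) (F z) * g z ∂ρ = ∫ z, (starRingEnd ℂ) (F z) * g' z ∂ρ' := by
  have key : ∀ (ρ : Measure (EuclideanSpace ℂ (Fin n))) (hρ : ∀ᵐ w ∂ρ, ‖w‖ = 1) (g : EuclideanSpace ℂ (Fin n) → ℂ) (hg : Integrable g ρ)
      (ε : ℝ) (P : EuclideanSpace ℂ (Fin n) → ℂ) (hP : Continuous P) (hPF : ∀ z, ‖z‖ = 1 → ‖P z - F z‖ < ε),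
      ‖∫ z, (starRingEnd ℂ) (P z) * g z ∂ρ - ∫ z, (starRingEnd ℂ) (F z) * g z ∂ρ‖ ≤ ε * ∫ z, ‖g z‖ ∂ρ := by
    intro ρ hρ g hg ε P hP hPF
    rw [← integral_sub (int_cont hρ hP hg) (int_cont hρ hF hg), ← integral_const_mul]
    refine norm_integral_le_of_norm_le (hg.norm.const_mul ε) ?_
    filter_upwards [hρ] with w hw
    rw [← sub_mul, ← map_sub, norm_mul, RCLike.norm_conj]
    gcongr
    exact (hPF w hw).le
  have hle : ∀ ε > 0, ‖∫ z, (starRingEnd ℂ) (F z) * g z ∂ρ - ∫ z, (starRingEnd ℂ) (F z) * g' z ∂ρ'‖ ≤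
      0 + ε * (∫ z, ‖g z‖ ∂ρ + ∫ z, ‖g' z‖ ∂ρ') := by
    intro ε hε
    obtain ⟨P, hP, hPF, he⟩ := h ε hε
    have h1 := key ρ hρ g hg ε P hP hPF
    have h2 := key ρ' hρ' g' hg' ε P hP hPF
    rw [he] at h1
    rw [norm_sub_rev] at h1
    have := norm_sub_le_norm_sub_add_norm_sub (∫ z, (starRingEnd ℂ) (F z) * g z ∂ρ) (∫ z, (starRingEnd ℂ) (P z) * g' z ∂ρ') (∫ z, (starRingEnd ℂ) (F z) * g' z ∂ρ')
    linarith
  set M := ∫ z, ‖g z‖ ∂ρ + ∫ z, ‖g' z‖ ∂ρ'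
  have hM : 0 ≤ M := add_nonneg (integral_nonneg fun _ => norm_nonneg _) (integral_nonneg fun _ => norm_nonneg _)
  rw [← sub_eq_zero, ← norm_le_zero_iff]
  refine le_of_forall_pos_le_add fun δ hδ => ?_
  refine (hle (δ / (M+1)) (by positivity)).trans ?_
  gcongr
  rw [div_mul_eq_mul_div, div_le_iff₀ (by positivity)]
  nlinarith

/-- the submodule of continuous functions with a prescribed pairing identity -/
def pairT {n : ℕ} {ρ : Measure (EuclideanSpace ℂ (Fin n))} (hρ : ∀ᵐ w ∂ρ, ‖w‖ = 1)
    {ρ' : Measure (EuclideanSpace ℂ (Fin n))} (hρ' : ∀ᵐ w ∂ρ', ‖w‖ = 1)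
    {g g' : EuclideanSpace ℂ (Fin n) → ℂ} (hg : Integrable g ρ) (hg' : Integrable g' ρ') :
    Submodule ℂ (EuclideanSpace ℂ (Fin n) → ℂ) where
  carrier := {F | Continuous F ∧ ∫ z, (starRingEnd ℂ) (F z) * g z ∂ρ = ∫ z, (starRingEnd ℂ) (F z) * g' z ∂ρ'}
  add_mem' := by
    rintro a b ⟨ha, ha2⟩ ⟨hb, hb2⟩
    refine ⟨ha.add hb, ?_⟩
    simp only [Pi.add_apply, map_add, add_mul]
    rw [integral_add (int_cont hρ ha hg) (int_cont hρ hb hg), integral_add (int_cont hρ' ha hg') (int_cont hρ' hb hg'), ha2, hb2]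
  zero_mem' := ⟨continuous_const, by simp⟩
  smul_mem' := by
    rintro c a ⟨ha, ha2⟩
    refine ⟨ha.const_smul c, ?_⟩
    simp only [Pi.smul_apply, smul_eq_mul, map_mul, mul_assoc]
    rw [integral_const_mul, integral_const_mul, ha2]

lemma pair_congr {n : ℕ} {ρ : Measure (EuclideanSpace ℂ (Fin n))} (hρ : ∀ᵐ w ∂ρ, ‖w‖ = 1)
    {F F' g : EuclideanSpace ℂ (Fin n) → ℂ} (h : ∀ z, ‖z‖ = 1 → F z = F' z) :
    ∫ z, (starRingEnd ℂ) (F z) * g z ∂ρ = ∫ z, (starRingEnd ℂ) (F' z) * g z ∂ρ := by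
  refine integral_congr_ae ?_
  filter_upwards [hρ] with w hw
  rw [h w hw]

/-- density: vanishing of all harmonic moments -/
lemma dens {n : ℕ} (hn : 1 ≤ n) {ρ : Measure (EuclideanSpace ℂ (Fin n))} [IsFiniteMeasure ρ] (hρ : ∀ᵐ w ∂ρ, ‖w‖ = 1)
    {g : EuclideanSpace ℂ (Fin n) → ℂ} (hg : Integrable g ρ)
    (h : ∀ p q (h : Pol n), HP p q h → ∫ z, (starRingEnd ℂ) (ev h z) * g z ∂ρ = 0) : ∀ᵐ z ∂ρ, g z = 0 := by
  have hz : Integrable (fun _ : EuclideanSpace ℂ (Fin n) => (0:ℂ)) ρ := by simp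
  have hP : ∀ P : Pol n, ∫ z, (starRingEnd ℂ) (ev P z) * g z ∂ρ = 0 := by
    intro P
    obtain ⟨F, ⟨hF, hF2⟩, hF3⟩ := pol_span hn (pairT hρ hρ hg hz) (fun p q h' hh => ⟨continuous_ev h', by simp [h p q h' hh]⟩) P
    rw [pair_congr hρ hF3, hF2]; simp
  have hψ : ∀ ψ : EuclideanSpace ℂ (Fin n) → ℂ, Continuous ψ → ∫ z, (starRingEnd ℂ) (ψ z) * g z ∂ρ = 0 := by
    intro ψ hψ
    have := pair_approx hρ hρ hψ hg hz (fun ε hε => by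
      obtain ⟨P, hP'⟩ := ev_dense ψ hψ ε hε
      exact ⟨ev P, continuous_ev P, hP', by simp [hP P]⟩)
    rw [this]; simp
  refine ae_eq_zero_of_integral_contDiff_smul_eq_zero hg.locallyIntegrable fun k hk _ => ?_
  have := hψ (fun z => (k z : ℂ)) (Complex.continuous_ofReal.comp hk.continuous)
  rw [← this]
  refine integral_congr_ae (Filter.Eventually.of_forall fun w => ?_)
  simp

/-- Weight-tracking version of `bihom_span`. -/
lemma bihom_span' {n : ℕ} (hn : 1 ≤ n) (T : Submodule ℂ (EuclideanSpace ℂ (Fin n) → ℂ)) (m : ℤ)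
    (hT : ∀ (p q : ℕ) (h : Pol n), (p:ℤ) - q = m → HP p q h → ev h ∈ T)
    (p : ℕ) : ∀ (q : ℕ) (P : Pol n), (p:ℤ) - q = m → Bihom p q P →
      ∃ g ∈ T, ∀ z, ‖z‖ = 1 → ev P z = g z := by
  induction p with
  | zero => intro q P hm hP; exact ⟨ev P, hT 0 q P hm ⟨hP, hP.lapD_zero (Or.inl rfl)⟩, fun _ _ => rfl⟩
  | succ p ih =>
    intro q P hm hP
    rcases q with _ | q
    · exact ⟨ev P, hT _ 0 P hm ⟨hP, hP.lapD_zero (Or.inr rfl)⟩, fun _ _ => rfl⟩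
    obtain ⟨R, hR, hR2⟩ := solveD p q ((n + p + q : ℕ) : ℝ) (by positivity) (lapD P) hP.lapD
    obtain ⟨g, hg, hg2⟩ := ih q R (by push_cast at hm; linarith) hR
    have hXR : Bihom (p+1) (q+1) (Xsq n * R) := by
      have := Bihom.Xsq.mul hR
      rwa [add_comm 1 p, add_comm 1 q] at this
    refine ⟨ev (P - Xsq n * R) + g, T.add_mem (hT (p+1) (q+1) _ hm ⟨hP.sub hXR, ?_⟩) hg, ?_⟩
    · rw [lapD_sub, lapD_Xsq_mul hR, ← hR2]
      simp
    · intro z hz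
      simp [ev_sub, ev_mul, ev_Xsq z hz, hg2 z hz]

end

section

/-- The normalized core situation. -/
structure Core (d C : ℕ) (τ : Measure (EuclideanSpace ℂ (Fin (d+1)))) (φ : EuclideanSpace ℂ (Fin (d+1)) → ℂ) : Prop where
  hd : 1 ≤ d
  fin : IsFiniteMeasure τ
  sph : ∀ᵐ w ∂τ, ‖w‖ = 1
  meas : Measurable φ
  one : ∀ w, ‖φ w‖ = 1
  spec : ∀ (N p q : ℕ) (h : Pol (d+1)), HP p q h → p < q + N → q < p + N → C * N < p + q →
    ∫ z, (starRingEnd ℂ) (ev h z) * φ z ∂τ = 0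

def GN (d C N : ℕ) (τ : Measure (EuclideanSpace ℂ (Fin (d+1)))) (φ : EuclideanSpace ℂ (Fin (d+1)) → ℂ) :
    EuclideanSpace ℂ (Fin (d+1)) → ℂ := GG (kap d (C+(d+3)) N) N τ φ

section
variable {d C : ℕ} {τ : Measure (EuclideanSpace ℂ (Fin (d+1)))} {φ : EuclideanSpace ℂ (Fin (d+1)) → ℂ}

lemma Core.int_φ (H : Core d C τ φ) : Integrable φ τ := by
  haveI := H.fin
  exact Integrable.of_bound H.meas.aestronglyMeasurable 1 (Filter.Eventually.of_forall fun w => (H.one w).le)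

lemma measurable_Kin {κ : ℝ → ℝ} (hκ : Measurable κ) (N : ℕ) :
    Measurable (fun z : EuclideanSpace ℂ (Fin (d+1)) × EuclideanSpace ℂ (Fin (d+1)) => (Kk κ N (inner ℂ z.1 z.2) : ℂ)) := by
  have h1 : Measurable (fun z : EuclideanSpace ℂ (Fin (d+1)) × EuclideanSpace ℂ (Fin (d+1)) => inner ℂ z.1 z.2) :=
    (by fun_prop : Continuous _).measurable
  exact Complex.measurable_ofReal.comp ((measurable_Kk hκ N).comp h1)

lemma Core.GN_meas (H : Core d C τ φ) (N : ℕ) : Measurable (GN d C N τ φ) := by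
  haveI := H.fin
  have hm : Measurable (fun z : EuclideanSpace ℂ (Fin (d+1)) × EuclideanSpace ℂ (Fin (d+1)) => (Kk (kap d (C+(d+3)) N) N (inner ℂ z.1 z.2) : ℂ) * φ z.2) :=
    (measurable_Kin (kap_cont _ _ _).measurable N).mul (H.meas.comp measurable_snd)
  exact (hm.stronglyMeasurable.integral_prod_right (ν := τ)).measurable

lemma Core.GN_bdd (H : Core d C τ φ) (N : ℕ) : ∃ B, ∀ y, ‖y‖ = 1 → ‖GN d C N τ φ y‖ ≤ B := by
  haveI := H.fin
  obtain ⟨B, hB⟩ := kap_bdd d (C+(d+3)) N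
  refine ⟨B * N * τ.real univ, fun y hy => ?_⟩
  refine norm_integral_le_of_norm_le_const ?_
  filter_upwards [H.sph] with w hw
  rw [norm_mul, H.one, mul_one, Complex.norm_real]
  exact Kk_bdd hB N (inner_le_one hy hw)

lemma Core.GN_int (H : Core d C τ φ) (N : ℕ) : Integrable (GN d C N τ φ) (sig (d+1)) := by
  obtain ⟨B, hB⟩ := H.GN_bdd N
  refine Integrable.of_bound (H.GN_meas N).aestronglyMeasurable B ?_
  filter_upwards [sig_ae_norm (n := d+1) (by omega)] with w hw using hB w hw

lemma continuous_Kk {κ : ℝ → ℝ} (hκ : Continuous κ) (N : ℕ) : Continuous (Kk κ N) :=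
  (hκ.comp continuous_norm).mul (continuous_ktR N)

lemma Core.GN_cont (H : Core d C τ φ) (N : ℕ) : ContinuousOn (GN d C N τ φ) (Metric.sphere 0 1) := by
  haveI := H.fin
  obtain ⟨B, hB⟩ := kap_bdd d (C+(d+3)) N
  refine continuousOn_of_dominated (bound := fun _ => B * N) ?_ ?_ (integrable_const _) ?_
  · intro y hy
    exact (GG_integrable (kap_cont _ _ _).measurable hB N τ H.sph H.meas (fun w => (H.one w).le) (by simpa using hy)).1
  · intro y hy
    filter_upwards [H.sph] with w hw
    rw [norm_mul, H.one, mul_one, Complex.norm_real]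
    exact Kk_bdd hB N (inner_le_one (by simpa using hy) hw)
  · refine Filter.Eventually.of_forall fun w => Continuous.continuousOn ?_
    have := continuous_Kk (kap_cont d (C+(d+3)) N) N
    exact (Complex.continuous_ofReal.comp (this.comp (by fun_prop))).mul continuous_const

lemma kcoef_conj (N p q : ℕ) : (starRingEnd ℂ) (kcoef N p q) = kcoef N p q := by
  simp only [kcoef, map_sum]
  refine Finset.sum_congr rfl fun i _ => Finset.sum_congr rfl fun j _ => ?_
  split_ifs <;> simp

lemma Core.moment (H : Core d C τ φ) {N : ℕ} (hN : 1 ≤ N) {p q : ℕ} {h : Pol (d+1)} (hh : HP p q h) :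
    ∫ y, (starRingEnd ℂ) (ev h y) * GN d C N τ φ y ∂(sig (d+1)) = kcoef N p q * ∫ z, (starRingEnd ℂ) (ev h z) * φ z ∂τ := by
  haveI := H.fin
  obtain ⟨B, hB⟩ := kap_bdd d (C+(d+3)) N
  set κ := kap d (C+(d+3)) N with hκd
  have hκ : Measurable κ := (kap_cont _ _ _).measurable
  have hσ := sig_ae_norm (n := d+1) (by omega)
  obtain ⟨M, hM⟩ := (isCompact_sphere (0 : EuclideanSpace ℂ (Fin (d+1))) 1).exists_bound_of_continuousOn (continuous_ev h).continuousOn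
  have hm : Measurable (fun z : EuclideanSpace ℂ (Fin (d+1)) × EuclideanSpace ℂ (Fin (d+1)) =>
      (starRingEnd ℂ) (ev h z.1) * ((Kk κ N (inner ℂ z.1 z.2) : ℂ) * φ z.2)) :=
    ((Complex.continuous_conj.comp ((continuous_ev h).comp continuous_fst)).measurable).mul ((measurable_Kin hκ N).mul (H.meas.comp measurable_snd))
  have hintg : Integrable (fun z : EuclideanSpace ℂ (Fin (d+1)) × EuclideanSpace ℂ (Fin (d+1)) =>
      (starRingEnd ℂ) (ev h z.1) * ((Kk κ N (inner ℂ z.1 z.2) : ℂ) * φ z.2)) ((sig (d+1)).prod τ) := by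
    refine Integrable.of_bound hm.aestronglyMeasurable (M * (B * N)) ?_
    filter_upwards [Measure.quasiMeasurePreserving_fst.ae hσ, Measure.quasiMeasurePreserving_snd.ae H.sph] with z h1 h2
    rw [norm_mul, norm_mul, H.one, mul_one, Complex.norm_real, RCLike.norm_conj]
    have h3 := hM z.1 (by simpa using h1)
    exact mul_le_mul h3 (Kk_bdd hB N (inner_le_one h1 h2)) (norm_nonneg _) ((norm_nonneg _).trans h3)
  have e1 : ∫ y, (starRingEnd ℂ) (ev h y) * GN d C N τ φ y ∂(sig (d+1)) = (starRingEnd ℂ) (FHlam d κ N p q) * ∫ z, (starRingEnd ℂ) (ev h z) * φ z ∂τ := by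
    have e2 : ∀ y, (starRingEnd ℂ) (ev h y) * GN d C N τ φ y = ∫ w, (starRingEnd ℂ) (ev h y) * ((Kk κ N (inner ℂ y w) : ℂ) * φ w) ∂τ := by
      intro y
      rw [integral_const_mul]; rfl
    simp_rw [e2]
    rw [integral_integral_swap hintg]
    rw [← integral_const_mul]
    refine integral_congr_ae ?_
    filter_upwards [H.sph] with w hw
    have := congrArg (starRingEnd ℂ) (funk_hecke H.hd hκ hB N hh w hw)
    rw [← integral_conj, map_mul] at this
    rw [← mul_assoc, ← this, ← integral_mul_const]
    refine integral_congr_ae (Filter.Eventually.of_forall fun y => ?_)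
    simp only [map_mul, Complex.conj_ofReal]
    rw [← inner_conj_symm, Kk_conj]
    ring
  rw [e1]
  by_cases h1 : p ≥ q + N ∨ q ≥ p + N
  · rw [FHlam_zero κ h1, kcoef_eq_zero h1]; simp
  · push Not at h1
    by_cases h2 : p + q ≤ C * N
    · rw [hκd, FHlam_kap H.hd hN rfl h2, kcoef_conj]
    · rw [H.spec N p q h hh h1.1 h1.2 (by omega)]; simp

/-- coordinates of the Hopf map -/
def hopf {n : ℕ} (z : EuclideanSpace ℂ (Fin n)) : Fin n × Fin n → ℂ := fun i => z i.1 * (starRingEnd ℂ) (z i.2)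

lemma continuous_hopf {n : ℕ} : Continuous (hopf (n := n)) := by
  refine continuous_pi fun i => ?_
  exact (by fun_prop : Continuous fun z : EuclideanSpace ℂ (Fin n) => z i.1).mul
    (Complex.continuous_conj.comp (by fun_prop))

lemma kcoef_shift (N p q : ℕ) : kcoef N (p+1) (q+1) = kcoef N p q := by
  simp only [kcoef]
  refine Finset.sum_congr rfl fun i _ => Finset.sum_congr rfl fun j _ => ?_
  congr 1
  simp only [eq_iff_iff]; omega

lemma kcoef_diff {N p q p' q' : ℕ} (h : (p:ℤ) - q = p' - q') : kcoef N p q = kcoef N p' q' := by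
  simp only [kcoef]
  refine Finset.sum_congr rfl fun i _ => Finset.sum_congr rfl fun j _ => ?_
  congr 1
  simp only [eq_iff_iff]; omega

lemma Core.moment_bihom (H : Core d C τ φ) {N : ℕ} (hN : 1 ≤ N) {p q : ℕ} {h : Pol (d+1)} (hh : Bihom p q h) :
    ∫ y, (starRingEnd ℂ) (ev h y) * GN d C N τ φ y ∂(sig (d+1)) = ∫ z, (starRingEnd ℂ) (ev h z) * (kcoef N p q * φ z) ∂τ := by
  have hσ := sig_ae_norm (n := d+1) (by omega)
  obtain ⟨F, ⟨hF, hF2⟩, hF3⟩ := bihom_span' (by omega) (pairT hσ H.sph (H.GN_int N) (H.int_φ.const_mul (kcoef N p q))) (p - q) (by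
    intro p' q' h' hm hh'
    refine ⟨continuous_ev h', ?_⟩
    rw [H.moment hN hh', ← integral_const_mul, kcoef_diff hm]
    refine integral_congr_ae (Filter.Eventually.of_forall fun y => ?_)
    ring) p q h rfl hh
  rw [pair_congr hσ hF3, hF2, pair_congr H.sph hF3]

lemma Core.moment_hopf (H : Core d C τ φ) {N : ℕ} (hN : 1 ≤ N) {p q : ℕ} {h : Pol (d+1)} (hh : Bihom p q h)
    {g : (Fin (d+1) × Fin (d+1) → ℂ) → ℂ} (hg : Continuous g) :
    ∫ y, (starRingEnd ℂ) (ev h y * g (hopf y)) * GN d C N τ φ y ∂(sig (d+1)) = ∫ z, (starRingEnd ℂ) (ev h z * g (hopf z)) * (kcoef N p q * φ z) ∂τ := by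
  have hσ := sig_ae_norm (n := d+1) (by omega)
  set T := pairT hσ H.sph (H.GN_int N) (H.int_φ.const_mul (kcoef N p q)) with hT
  have hpol : ∀ P : MvPolynomial (Fin (d+1) × Fin (d+1)) ℂ, ∀ p' q' h', Bihom p' q' h' → (p':ℤ) - q' = p - q →
      (fun y => ev h' y * MvPolynomial.eval (hopf y) P) ∈ T := by
    intro P
    induction P using MvPolynomial.induction_on with
    | C a =>
      intro p' q' h' hh' hm
      have h1 : ev h' ∈ T := ⟨continuous_ev h', by rw [H.moment_bihom hN hh', kcoef_diff hm]⟩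
      convert T.smul_mem a h1 using 1
      ext y; simp [mul_comm]
    | add P Q hP hQ =>
      intro p' q' h' hh' hm
      convert T.add_mem (hP p' q' h' hh' hm) (hQ p' q' h' hh' hm) using 1
      ext y; simp [mul_add]
    | mul_X P i hP =>
      intro p' q' h' hh' hm
      have hb : Bihom (p'+1) (q'+1) (h' * (MvPolynomial.X (Sum.inl i.1) * MvPolynomial.X (Sum.inr i.2))) :=
        hh'.mul (by simpa using (Bihom.Xl i.1).mul (Bihom.Xr i.2))
      convert hP _ _ _ hb (by push_cast; linarith) using 1
      ext y
      simp [ev, hopf, evPt]; ring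
  have hc : Continuous (fun y => ev h y * g (hopf y)) := (continuous_ev h).mul (hg.comp continuous_hopf)
  refine pair_approx hσ H.sph hc (H.GN_int N) (H.int_φ.const_mul (kcoef N p q)) ?_
  intro ε hε
  obtain ⟨M, hM⟩ := (isCompact_sphere (0 : EuclideanSpace ℂ (Fin (d+1))) 1).exists_bound_of_continuousOn (continuous_ev h).continuousOn
  have hcomp : IsCompact (hopf '' (Metric.sphere (0 : EuclideanSpace ℂ (Fin (d+1))) 1)) :=
    (isCompact_sphere _ _).image continuous_hopf
  obtain ⟨P, hP⟩ := dens0 _ hcomp Prod.swap (by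
    rintro _ ⟨z, hz, rfl⟩ i
    simp [hopf, mul_comm]) g hg (ε / (|M| + 1)) (by positivity)
  refine ⟨fun y => ev h y * MvPolynomial.eval (hopf y) P, (hpol P p q h hh rfl).1, ?_, (hpol P p q h hh rfl).2⟩
  intro z hz
  rw [← mul_sub, norm_mul]
  have h1 := hP (hopf z) ⟨z, by simpa using hz, rfl⟩
  have h2 := (hM z (by simpa using hz)).trans (le_abs_self M)
  calc _ ≤ |M| * (ε / (|M| + 1)) := by gcongr
    _ < ε := by rw [mul_div_assoc', div_lt_iff₀ (by positivity)]; nlinarith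

end

end

section

section
variable {d C : ℕ} {τ : Measure (EuclideanSpace ℂ (Fin (d+1)))} {φ : EuclideanSpace ℂ (Fin (d+1)) → ℂ}

lemma lim_ind {n : ℕ} {ρ : Measure (EuclideanSpace ℂ (Fin n))} (hρ : ∀ᵐ w ∂ρ, ‖w‖ = 1)
    {g : EuclideanSpace ℂ (Fin n) → ℂ} (hg : Integrable g ρ) (h : Pol n) {K : Set (Fin n × Fin n → ℂ)} (hK : IsClosed K) :
    Filter.Tendsto (fun k => ∫ y, (starRingEnd ℂ) (ev h y * ((hK.apprSeq k (hopf y) : ℝ≥0) : ℂ)) * g y ∂ρ) Filter.atTop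
      (nhds (∫ y, (starRingEnd ℂ) (ev h y) * (hopf ⁻¹' K).indicator g y ∂ρ)) := by
  refine tendsto_integral_of_dominated_convergence (fun y => ‖(starRingEnd ℂ) (ev h y) * g y‖) ?_ (int_cont hρ (continuous_ev h) hg).norm ?_ ?_
  · intro k
    have hc : Continuous (fun y => ev h y * ((hK.apprSeq k (hopf y) : ℝ≥0) : ℂ)) := by
      refine (continuous_ev h).mul (Complex.continuous_ofReal.comp (NNReal.continuous_coe.comp ((hK.apprSeq k).continuous.comp continuous_hopf)))
    exact (int_cont hρ hc hg).1
  · intro k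
    refine Filter.Eventually.of_forall fun y => ?_
    rw [norm_mul, norm_mul, RCLike.norm_conj, RCLike.norm_conj, norm_mul]
    have : ‖((hK.apprSeq k (hopf y) : ℝ≥0) : ℂ)‖ ≤ 1 := by
      rw [Complex.norm_real, Real.norm_of_nonneg (NNReal.coe_nonneg _)]
      exact_mod_cast HasOuterApproxClosed.apprSeq_apply_le_one hK k (hopf y)
    calc _ ≤ ‖ev h y‖ * 1 * ‖g y‖ := by gcongr
      _ = _ := by ring
  · refine Filter.Eventually.of_forall fun y => ?_
    have h1 := (tendsto_pi_nhds.1 (HasOuterApproxClosed.tendsto_apprSeq hK)) (hopf y)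
    have h2 : Filter.Tendsto (fun k => (starRingEnd ℂ) (ev h y * ((hK.apprSeq k (hopf y) : ℝ≥0) : ℂ)) * g y) Filter.atTop
      (nhds ((starRingEnd ℂ) (ev h y * ((K.indicator (fun _ => (1:ℝ≥0)) (hopf y) : ℝ≥0) : ℂ)) * g y)) := by
      refine Filter.Tendsto.mul_const _ ?_
      refine (Complex.continuous_conj.tendsto _).comp ?_
      refine Filter.Tendsto.const_mul _ ?_
      exact (Complex.continuous_ofReal.tendsto _).comp ((NNReal.continuous_coe.tendsto _).comp h1)
    convert h2 using 2
    by_cases hy : hopf y ∈ K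
    · rw [indicator_of_mem (by exact hy), indicator_of_mem hy]; simp
    · rw [indicator_of_notMem (by exact hy), indicator_of_notMem hy]; simp

lemma Core.AC_compact (H : Core d C τ φ) {K : Set (Fin (d+1) × Fin (d+1) → ℂ)} (hK : IsClosed K)
    (h0 : sig (d+1) (hopf ⁻¹' K) = 0) : τ (hopf ⁻¹' K) = 0 := by
  haveI := H.fin
  have hσ := sig_ae_norm (n := d+1) (by omega)
  have hmK : MeasurableSet (hopf (n := d+1) ⁻¹' K) := continuous_hopf.measurable hK.measurableSet
  have h := dens (n := d+1) (by omega) H.sph (H.int_φ.indicator hmK) (fun p q h hh => by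
    have hN : 1 ≤ p + q + 1 := by omega
    have e1 := lim_ind hσ (H.GN_int (p+q+1)) h hK
    have e2 := lim_ind H.sph (H.int_φ.const_mul (kcoef (p+q+1) p q)) h hK
    have e3 : ∀ k, ∫ y, (starRingEnd ℂ) (ev h y * ((hK.apprSeq k (hopf y) : ℝ≥0) : ℂ)) * GN d C (p+q+1) τ φ y ∂(sig (d+1)) =
      ∫ z, (starRingEnd ℂ) (ev h z * ((hK.apprSeq k (hopf z) : ℝ≥0) : ℂ)) * (kcoef (p+q+1) p q * φ z) ∂τ := by
      intro k
      exact H.moment_hopf hN hh.1 (g := fun b => ((hK.apprSeq k b : ℝ≥0) : ℂ))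
        (Complex.continuous_ofReal.comp (NNReal.continuous_coe.comp (hK.apprSeq k).continuous))
    simp_rw [e3] at e1
    have e4 := tendsto_nhds_unique e1 e2
    have e5 : ∫ y, (starRingEnd ℂ) (ev h y) * (hopf ⁻¹' K).indicator (GN d C (p+q+1) τ φ) y ∂(sig (d+1)) = 0 := by
      rw [integral_eq_zero_of_ae]
      have : ∀ᵐ y ∂(sig (d+1)), y ∉ hopf ⁻¹' K := measure_eq_zero_iff_ae_notMem.1 h0
      filter_upwards [this] with y hy
      rw [indicator_of_notMem hy]; simp
    rw [e5] at e4
    have e6 : ∫ y, (starRingEnd ℂ) (ev h y) * (hopf ⁻¹' K).indicator (fun z => kcoef (p+q+1) p q * φ z) y ∂τ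
      = kcoef (p+q+1) p q * ∫ y, (starRingEnd ℂ) (ev h y) * (hopf ⁻¹' K).indicator φ y ∂τ := by
      rw [← integral_const_mul]
      refine integral_congr_ae (Filter.Eventually.of_forall fun y => ?_)
      by_cases hy : y ∈ hopf ⁻¹' K
      · simp only [indicator_of_mem hy]; ring
      · simp only [indicator_of_notMem hy]; ring
    rw [e6] at e4
    have := kcoef_ne_zero (N := p+q+1) (p := p) (q := q) (by omega) (by omega)
    exact (mul_eq_zero.1 e4.symm).resolve_left this)
  rw [measure_eq_zero_iff_ae_notMem]
  filter_upwards [h] with z hz hzK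
  rw [indicator_of_mem hzK] at hz
  have := H.one z
  rw [hz] at this; simp at this

lemma Core.AC (H : Core d C τ φ) : τ.map hopf ≪ (sig (d+1)).map hopf := by
  haveI := H.fin
  have hm : Measurable (hopf (n := d+1)) := continuous_hopf.measurable
  refine Measure.AbsolutelyContinuous.mk fun A hA h0 => ?_
  by_contra hne
  obtain ⟨K, hKA, hK, hlt⟩ := hA.exists_lt_isCompact (μ := τ.map hopf) (r := 0) (pos_iff_ne_zero.2 hne)
  rw [Measure.map_apply hm hK.measurableSet, H.AC_compact hK.isClosed] at hlt
  · exact lt_irrefl _ hlt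
  · rw [← Measure.map_apply hm hK.measurableSet]
    exact measure_mono_null hKA h0
end

end

section

section
open ProbabilityTheory

abbrev VV (d : ℕ) := EuclideanSpace ℂ (Fin (d+1))
abbrev BB (d : ℕ) := Fin (d+1) × Fin (d+1) → ℂ

variable {d C : ℕ} {τ : Measure (VV d)} {φ : VV d → ℂ}

lemma measurable_hg (d : ℕ) : Measurable (fun z : VV d => (hopf z, z)) := continuous_hopf.measurable.prodMk measurable_id

/-- Disintegration of `τ` over the Hopf map. -/
structure Dis (d : ℕ) (τ : Measure (VV d)) (m : Kernel (BB d) (VV d)) : Prop where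
  sf : IsSFiniteKernel m
  fin : ∀ b, IsFiniteMeasure (m b)
  conc : ∀ b, ∀ᵐ z ∂(m b), hopf z = b ∧ ‖z‖ = 1
  cp : ((sig (d+1)).map hopf).compProd m = τ.map (fun z => (hopf z, z))

lemma Core.exists_dis (H : Core d C τ φ) : ∃ m, Dis d τ m := by
  haveI := H.fin
  have hm : Measurable (hopf (n := d+1)) := continuous_hopf.measurable
  set lam := τ.map hopf with hlam
  set sb := (sig (d+1)).map hopf with hsb
  haveI : IsFiniteMeasure lam := Measure.isFiniteMeasure_map τ hopf
  haveI : IsFiniteMeasure sb := Measure.isFiniteMeasure_map _ hopf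
  set κ : Kernel (BB d) (VV d) := condDistrib (id : VV d → VV d) hopf τ with hκ
  have hcp : lam.compProd κ = τ.map (fun z => (hopf z, z)) := compProd_map_condDistrib aemeasurable_id
  set l0 : BB d → ℝ≥0∞ := lam.rnDeriv sb with hl0
  have hl0m : Measurable l0 := Measure.measurable_rnDeriv _ _
  set l : BB d → ℝ≥0∞ := fun b => if l0 b = ⊤ then 0 else l0 b with hl
  have hlm : Measurable l := Measurable.ite (hl0m (measurableSet_singleton _)) measurable_const hl0m
  have hlt : ∀ b, l b ≠ ⊤ := by
    intro b; simp only [hl]; split_ifs with h <;> simp [h]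
  have hll : l0 =ᵐ[sb] l := by
    filter_upwards [Measure.rnDeriv_lt_top lam sb] with b hb
    simp only [hl]; rw [if_neg hb.ne]
  have hw : lam = sb.withDensity l := by
    have hac : lam ≪ sb := H.AC
    haveI : lam.HaveLebesgueDecomposition sb := Measure.haveLebesgueDecomposition_of_sigmaFinite lam sb
    rw [← withDensity_congr_ae hll, Measure.withDensity_rnDeriv_eq _ _ hac]
  set D : Set (BB d × VV d) := {x | hopf x.2 = x.1 ∧ ‖x.2‖ = 1} with hD
  have hDm : MeasurableSet D :=
    ((isClosed_eq (continuous_hopf.comp continuous_snd) continuous_fst).inter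
      (isClosed_eq (continuous_norm.comp continuous_snd) continuous_const)).measurableSet
  set f : BB d → VV d → ℝ≥0∞ := fun b z => D.indicator (fun x => l x.1) (b, z) with hf
  have hfm : Measurable (Function.uncurry f) := (hlm.comp measurable_fst).indicator hDm
  have hfl : ∀ b z, f b z ≤ l b := by
    intro b z
    simp only [hf]
    by_cases h : (b, z) ∈ D
    · rw [indicator_of_mem h]
    · rw [indicator_of_notMem h]; exact zero_le
  have hft : ∀ b z, f b z ≠ ⊤ := fun b z => ne_top_of_le_ne_top (hlt b) (hfl b z)
  haveI hsf : IsSFiniteKernel (κ.withDensity f) := Kernel.IsSFiniteKernel.withDensity κ hft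
  refine ⟨κ.withDensity f, hsf, ?_, ?_, ?_⟩
  · intro b
    rw [Kernel.withDensity_apply _ hfm]
    refine isFiniteMeasure_withDensity (ne_top_of_le_ne_top (hlt b) ?_)
    calc ∫⁻ z, f b z ∂(κ b) ≤ ∫⁻ _, l b ∂(κ b) := lintegral_mono (hfl b)
      _ = l b := by simp
  · intro b
    rw [Kernel.withDensity_apply _ hfm, ae_withDensity_iff (hfm.of_uncurry_left (x := b))]
    refine Filter.Eventually.of_forall fun z hz => ?_
    by_contra h
    exact hz (indicator_of_notMem (s := D) (a := (b, z)) h _)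
  · ext s hs
    have h1 : (τ.map (fun z => (hopf z, z))) s = (τ.map (fun z => (hopf z, z))) (s ∩ D) := by
      rw [Measure.map_apply (measurable_hg d) hs, Measure.map_apply (measurable_hg d) (hs.inter hDm)]
      refine measure_congr ?_
      filter_upwards [H.sph] with z hz
      have : z ∈ (fun z => (hopf z, z)) ⁻¹' D := ⟨rfl, hz⟩
      refine propext ⟨fun h => ⟨h, this⟩, fun h => h.1⟩
    rw [h1, ← hcp, Measure.compProd_apply hs, Measure.compProd_apply (hs.inter hDm), hw,
      lintegral_withDensity_eq_lintegral_mul _ hlm (Kernel.measurable_kernel_prodMk_left (hs.inter hDm))]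
    refine lintegral_congr fun b => ?_
    rw [Kernel.withDensity_apply' _ hfm, Pi.mul_apply, ← lintegral_indicator (measurable_prodMk_left hs)]
    have : ∀ z, (Prod.mk b ⁻¹' s).indicator (fun z => f b z) z = (Prod.mk b ⁻¹' (s ∩ D)).indicator (fun _ => l b) z := by
      intro z
      by_cases h1 : (b, z) ∈ s
      · rw [indicator_of_mem (by exact h1)]
        by_cases h2 : (b, z) ∈ D
        · rw [indicator_of_mem (by exact ⟨h1, h2⟩)]; simp only [hf]; rw [indicator_of_mem h2]
        · rw [indicator_of_notMem (fun h => h2 h.2)]; simp only [hf]; rw [indicator_of_notMem h2]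
      · rw [indicator_of_notMem (by exact h1), indicator_of_notMem (fun h => h1 h.1)]
    simp_rw [this]
    rw [lintegral_indicator (measurable_prodMk_left (hs.inter hDm)), setLIntegral_const]

variable {m : Kernel (BB d) (VV d)}

lemma Dis.lint (D : Dis d τ m) {F : BB d × VV d → ℝ≥0∞} (hF : Measurable F) :
    ∫⁻ y, ∫⁻ z, F (hopf y, z) ∂(m (hopf y)) ∂(sig (d+1)) = ∫⁻ z, F (hopf z, z) ∂τ := by
  have hm : Measurable (hopf (n := d+1)) := continuous_hopf.measurable
  haveI := D.sf
  haveI : IsFiniteMeasure ((sig (d+1)).map hopf) := Measure.isFiniteMeasure_map _ hopf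
  have := Measure.lintegral_compProd (μ := (sig (d+1)).map hopf) (κ := m) hF
  rw [D.cp, lintegral_map hF (measurable_hg d), lintegral_map hF.lintegral_kernel_prod_right' hm] at this
  exact this.symm

lemma Dis.int (D : Dis d τ m) {F : BB d × VV d → ℂ} (hFm : Measurable F) (hF : Integrable (fun z => F (hopf z, z)) τ) :
    ∫ y, ∫ z, F (hopf y, z) ∂(m (hopf y)) ∂(sig (d+1)) = ∫ z, F (hopf z, z) ∂τ := by
  have hm : Measurable (hopf (n := d+1)) := continuous_hopf.measurable
  haveI := D.sf
  haveI : IsFiniteMeasure ((sig (d+1)).map hopf) := Measure.isFiniteMeasure_map _ hopf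
  have hi : Integrable F (((sig (d+1)).map hopf).compProd m) := by
    rw [D.cp, integrable_map_measure hFm.aestronglyMeasurable (measurable_hg d).aemeasurable]
    exact hF
  have := Measure.integral_compProd hi
  rw [D.cp, integral_map (measurable_hg d).aemeasurable hFm.aestronglyMeasurable,
    integral_map hm.aemeasurable (hFm.stronglyMeasurable.integral_kernel_prod_right').aestronglyMeasurable] at this
  exact this.symm

lemma hopf_smul {n : ℕ} (u : ℂ) (hu : ‖u‖ = 1) (y : EuclideanSpace ℂ (Fin n)) : hopf (u • y) = hopf y := by
  ext i
  simp only [hopf, PiLp.smul_apply, smul_eq_mul, map_mul]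
  have : u * (starRingEnd ℂ) u = 1 := by rw [Complex.mul_conj, Complex.normSq_eq_norm_sq, hu]; simp
  linear_combination (y i.1 * (starRingEnd ℂ) (y i.2)) * this

lemma hopf_fiber {n : ℕ} {y z : EuclideanSpace ℂ (Fin n)} (hy : ‖y‖ = 1) (hz : ‖z‖ = 1) (h : hopf z = hopf y) :
    ‖(inner ℂ y z : ℂ)‖ = 1 ∧ z = (inner ℂ y z : ℂ) • y := by
  have h1 : z = (inner ℂ y z : ℂ) • y := by
    ext i
    simp only [PiLp.smul_apply, smul_eq_mul]
    have h2 : ∀ j, z i * (starRingEnd ℂ) (z j) * z j = y i * (starRingEnd ℂ) (y j) * z j := by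
      intro j
      have := congrFun h (i, j)
      simp only [hopf] at this
      rw [this]
    have h3 := Finset.sum_congr (rfl : (Finset.univ : Finset (Fin n)) = Finset.univ) (fun j _ => h2 j)
    simp_rw [mul_assoc] at h3
    rw [← Finset.mul_sum, ← Finset.mul_sum] at h3
    have e1 : ∑ j, (starRingEnd ℂ) (z j) * z j = 1 := by
      have := inner_self_eq_norm_sq_to_K (𝕜 := ℂ) z
      rw [hz] at this
      simp only [PiLp.inner_apply, RCLike.inner_apply] at this
      simp_rw [mul_comm]
      simpa using this
    have e2 : ∑ j, (starRingEnd ℂ) (y j) * z j = inner ℂ y z := by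
      simp only [PiLp.inner_apply, RCLike.inner_apply, mul_comm]
    rw [e1, e2, mul_one] at h3
    rw [h3, mul_comm]
  refine ⟨?_, h1⟩
  have := congrArg norm h1
  rw [norm_smul, hy, hz, mul_one] at this
  exact this.symm
end

end

section

section
open ProbabilityTheory
variable {d C : ℕ} {τ : Measure (VV d)} {φ : VV d → ℂ} {m : Kernel (BB d) (VV d)}

def Gam (d : ℕ) (m : Kernel (BB d) (VV d)) (φ : VV d → ℂ) (N : ℕ) (y : VV d) : ℂ :=
  ∫ z, φ z * (ktR N (inner ℂ y z) : ℂ) ∂(m (hopf y))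

def Fii (d : ℕ) (m : Kernel (BB d) (VV d)) (φ : VV d → ℂ) (i j : ℕ) (y : VV d) : ℂ :=
  ∫ z, φ z * ((inner ℂ y z : ℂ)^i * (starRingEnd ℂ) (inner ℂ y z : ℂ)^j) ∂(m (hopf y))

lemma measurable_kint (D : Dis d τ m) {f : VV d × VV d → ℂ} (hf : Measurable f) :
    Measurable (fun y => ∫ z, f (y, z) ∂(m (hopf y))) := by
  have hm : Measurable (hopf (n := d+1)) := continuous_hopf.measurable
  haveI := D.sf
  exact (hf.stronglyMeasurable.integral_kernel_prod_right' (κ := m.comap hopf hm)).measurable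

lemma Dis.mass (D : Dis d τ m) : ∫⁻ y, m (hopf y) univ ∂(sig (d+1)) = τ univ := by
  have := D.lint (F := fun _ => 1) measurable_const
  simpa using this

lemma Dis.mass_meas (D : Dis d τ m) : Measurable (fun y => m (hopf y) univ) :=
  (Kernel.measurable_coe m MeasurableSet.univ).comp continuous_hopf.measurable

lemma Dis.mass_int (D : Dis d τ m) [IsFiniteMeasure τ] : Integrable (fun y => (m (hopf y)).real univ) (sig (d+1)) := by
  refine integrable_toReal_of_lintegral_ne_top D.mass_meas.aemeasurable ?_
  rw [D.mass]; exact measure_ne_top _ _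

lemma measurable_inner_pair (d : ℕ) : Measurable (fun x : VV d × VV d => (inner ℂ x.1 x.2 : ℂ)) :=
  (by fun_prop : Continuous _).measurable

lemma Core.Fii_int (H : Core d C τ φ) (D : Dis d τ m) (i j : ℕ) : Integrable (Fii d m φ i j) (sig (d+1)) := by
  haveI := H.fin
  have hm : Measurable (fun x : VV d × VV d => φ x.2 * ((inner ℂ x.1 x.2 : ℂ)^i * (starRingEnd ℂ) (inner ℂ x.1 x.2 : ℂ)^j)) :=
    (H.meas.comp measurable_snd).mul (((measurable_inner_pair d).pow_const i).mul
      ((Complex.continuous_conj.measurable.comp (measurable_inner_pair d)).pow_const j))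
  refine D.mass_int.mono' (measurable_kint D hm).aestronglyMeasurable ?_
  filter_upwards [sig_ae_norm (n := d+1) (by omega)] with y hy
  haveI := D.fin (hopf y)
  have := norm_integral_le_of_norm_le_const (C := 1) (μ := m (hopf y)) (f := fun z => φ z * ((inner ℂ y z : ℂ)^i * (starRingEnd ℂ) (inner ℂ y z : ℂ)^j)) (by
    filter_upwards [D.conc (hopf y)] with z hz
    rw [norm_mul, H.one, norm_mul, norm_pow, norm_pow, RCLike.norm_conj, (hopf_fiber hy hz.2 hz.1).1]
    simp)
  rw [one_mul] at this
  exact this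

lemma Gam_eq (H : Core d C τ φ) (D : Dis d τ m) (N : ℕ) {y : VV d} (hy : ‖y‖ = 1) :
    Gam d m φ N y = ∑ i ∈ Finset.range N, ∑ j ∈ Finset.range N, (1/N : ℂ) * Fii d m φ i j y := by
  haveI := D.fin (hopf y)
  have hi : ∀ i j, Integrable (fun z => φ z * ((inner ℂ y z : ℂ)^i * (starRingEnd ℂ) (inner ℂ y z : ℂ)^j)) (m (hopf y)) := by
    intro i j
    have h1 : Continuous (fun z : VV d => (inner ℂ y z : ℂ)) := by fun_prop
    have hm : Measurable (fun z : VV d => φ z * ((inner ℂ y z : ℂ)^i * (starRingEnd ℂ) (inner ℂ y z : ℂ)^j)) :=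
      H.meas.mul ((h1.measurable.pow_const i).mul ((Complex.continuous_conj.comp h1).measurable.pow_const j))
    refine Integrable.of_bound hm.aestronglyMeasurable 1 ?_
    filter_upwards [D.conc (hopf y)] with z hz
    rw [norm_mul, H.one, norm_mul, norm_pow, norm_pow, RCLike.norm_conj, (hopf_fiber hy hz.2 hz.1).1]
    simp
  unfold Gam Fii
  simp_rw [← integral_const_mul]
  have : ∀ z, φ z * (ktR N (inner ℂ y z) : ℂ) = ∑ i ∈ Finset.range N, ∑ j ∈ Finset.range N, (1/N : ℂ) * (φ z * ((inner ℂ y z : ℂ)^i * (starRingEnd ℂ) (inner ℂ y z : ℂ)^j)) := by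
    intro z
    rw [ktR_eq, Finset.mul_sum]
    refine Finset.sum_congr rfl fun i _ => ?_
    rw [Finset.mul_sum]
    refine Finset.sum_congr rfl fun j _ => ?_
    ring
  simp_rw [this]
  rw [integral_finsetSum _ fun i _ => integrable_finsetSum _ fun j _ => (hi i j).const_mul _]
  refine Finset.sum_congr rfl fun i _ => ?_
  rw [integral_finsetSum _ fun j _ => (hi i j).const_mul _]

/-- multiplication by a unimodular scalar -/
def uLIE (n : ℕ) (u : ℂ) (hu : ‖u‖ = 1) : EuclideanSpace ℂ (Fin n) ≃ₗᵢ[ℂ] EuclideanSpace ℂ (Fin n) where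
  toLinearEquiv := LinearEquiv.smulOfNeZero ℂ (EuclideanSpace ℂ (Fin n)) u (by intro h; simp [h] at hu)
  norm_map' := by intro x; simp [norm_smul, hu]

lemma uLIE_apply (n : ℕ) (u : ℂ) (hu : ‖u‖ = 1) (x : EuclideanSpace ℂ (Fin n)) : uLIE n u hu x = u • x := rfl

lemma exists_root (k : ℕ) (hk : 0 < k) : ∃ u : ℂ, ‖u‖ = 1 ∧ u^k = -1 := by
  refine ⟨Complex.exp ((Real.pi / k : ℝ) * Complex.I), Complex.norm_exp_ofReal_mul_I _, ?_⟩
  rw [← Complex.exp_nat_mul, ← Complex.exp_pi_mul_I]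
  congr 1
  have : (k:ℂ) ≠ 0 := by exact_mod_cast hk.ne'
  push_cast
  field_simp

lemma u_conj {u : ℂ} (hu : ‖u‖ = 1) : u * (starRingEnd ℂ) u = 1 := by
  rw [Complex.mul_conj, Complex.normSq_eq_norm_sq, hu]; simp

lemma Fii_smul {u : ℂ} (hu : ‖u‖ = 1) (i j : ℕ) (y : VV d) :
    Fii d m φ i j (u • y) = (starRingEnd ℂ) u ^ i * u ^ j * Fii d m φ i j y := by
  unfold Fii
  rw [hopf_smul u hu, ← integral_const_mul]
  refine integral_congr_ae (Filter.Eventually.of_forall fun z => ?_)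
  simp only [inner_smul_left, map_mul, Complex.conj_conj]
  ring

lemma Core.Fii_moment (H : Core d C τ φ) (D : Dis d τ m) (i j : ℕ) {p q : ℕ} {h : Pol (d+1)} (hh : Bihom p q h) :
    ∫ y, (starRingEnd ℂ) (ev h y) * Fii d m φ i j y ∂(sig (d+1)) = if i + p = j + q then ∫ z, (starRingEnd ℂ) (ev h z) * φ z ∂τ else 0 := by
  have hσ := sig_ae_norm (n := d+1) (by omega)
  split_ifs with hc
  · have hm : Measurable (fun x : BB d × VV d => (starRingEnd ℂ) (ev h x.2) * φ x.2) :=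
      ((Complex.continuous_conj.comp (continuous_ev h)).measurable.comp measurable_snd).mul (H.meas.comp measurable_snd)
    rw [← D.int hm (int_cont H.sph (continuous_ev h) H.int_φ)]
    refine integral_congr_ae ?_
    filter_upwards [hσ] with y hy
    unfold Fii
    rw [← integral_const_mul]
    refine integral_congr_ae ?_
    filter_upwards [D.conc (hopf y)] with z hz
    obtain ⟨h1, h2⟩ := hopf_fiber hy hz.2 hz.1
    set c : ℂ := inner ℂ y z with hcd
    have h3 : ev h z = c^p * (starRingEnd ℂ) c ^ q * ev h y := by
      conv_lhs => rw [h2]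
      exact ev_smul hh c y
    have hc1 := u_conj h1
    have hc0 : c ≠ 0 := by intro h0; simp [h0] at h1
    have hinv : (starRingEnd ℂ) c = c⁻¹ := eq_inv_of_mul_eq_one_right hc1
    rw [h3]
    simp only [map_mul, map_pow, Complex.conj_conj]
    rw [hinv]
    have : c^i * c⁻¹^j = c⁻¹^p * c^q := by
      have h5 : c^i * c^p = c^j * c^q := by rw [← pow_add, ← pow_add, hc]
      rw [inv_pow, inv_pow, mul_inv_eq_iff_eq_mul₀ (pow_ne_zero _ hc0), mul_assoc, eq_inv_mul_iff_mul_eq₀ (pow_ne_zero _ hc0)]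
      linear_combination h5
    linear_combination (φ z * (starRingEnd ℂ) (ev h y)) * this
  · obtain ⟨u, hu, hne⟩ : ∃ u : ℂ, ‖u‖ = 1 ∧ (starRingEnd ℂ) u ^ (i+p) * u^(j+q) ≠ 1 := by
      generalize i + p = a at hc ⊢
      generalize j + q = b at hc ⊢
      rcases lt_or_gt_of_ne hc with hlt | hlt
      · obtain ⟨u, hu, hk⟩ := exists_root (b-a) (by omega)
        refine ⟨u, hu, ?_⟩
        have e : b = a + (b-a) := by omega
        rw [e, pow_add, ← mul_assoc, ← mul_pow, mul_comm _ u, u_conj hu, hk]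
        norm_num
      · obtain ⟨u, hu, hk⟩ := exists_root (a-b) (by omega)
        refine ⟨u, hu, ?_⟩
        have e : a = b + (a-b) := by omega
        rw [e, pow_add, mul_right_comm, ← mul_pow, mul_comm _ u, u_conj hu, ← map_pow, hk]
        norm_num
    have e := integral_sig_comp (uLIE (d+1) u hu) (fun y => (starRingEnd ℂ) (ev h y) * Fii d m φ i j y)
    have e2 : ∀ y, (starRingEnd ℂ) (ev h (uLIE (d+1) u hu y)) * Fii d m φ i j (uLIE (d+1) u hu y) =
       ((starRingEnd ℂ) u ^ (i+p) * u^(j+q)) * ((starRingEnd ℂ) (ev h y) * Fii d m φ i j y) := by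
      intro y
      rw [uLIE_apply, Fii_smul hu, ev_smul hh]
      simp only [map_mul, map_pow, Complex.conj_conj]
      ring
    simp_rw [e2] at e
    rw [integral_const_mul] at e
    by_contra h0
    exact hne (mul_right_cancel₀ h0 (by rw [e, one_mul]))

lemma Core.Gam_ae (H : Core d C τ φ) (D : Dis d τ m) {N : ℕ} (hN : 1 ≤ N) :
    ∀ᵐ y ∂(sig (d+1)), GN d C N τ φ y = Gam d m φ N y := by
  have hσ := sig_ae_norm (n := d+1) (by omega)
  have hI : Integrable (fun y => ∑ i ∈ Finset.range N, ∑ j ∈ Finset.range N, (1/N : ℂ) * Fii d m φ i j y) (sig (d+1)) :=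
    integrable_finsetSum _ fun i _ => integrable_finsetSum _ fun j _ => (H.Fii_int D i j).const_mul _
  have := dens (n := d+1) (by omega) hσ ((H.GN_int N).sub hI) (by
    intro p q h hh
    simp only [Pi.sub_apply, mul_sub]
    rw [integral_sub (int_cont hσ (continuous_ev h) (H.GN_int N)) (int_cont hσ (continuous_ev h) hI), H.moment hN hh, sub_eq_zero]
    have e1 : ∀ y, (starRingEnd ℂ) (ev h y) * ∑ i ∈ Finset.range N, ∑ j ∈ Finset.range N, (1/N : ℂ) * Fii d m φ i j y =
      ∑ i ∈ Finset.range N, ∑ j ∈ Finset.range N, (1/N : ℂ) * ((starRingEnd ℂ) (ev h y) * Fii d m φ i j y) := by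
      intro y
      rw [Finset.mul_sum]
      refine Finset.sum_congr rfl fun i _ => ?_
      rw [Finset.mul_sum]
      refine Finset.sum_congr rfl fun j _ => ?_
      ring
    simp_rw [e1]
    have hi : ∀ i j, Integrable (fun y => (1/N : ℂ) * ((starRingEnd ℂ) (ev h y) * Fii d m φ i j y)) (sig (d+1)) :=
      fun i j => (int_cont hσ (continuous_ev h) (H.Fii_int D i j)).const_mul _
    rw [integral_finsetSum _ fun i _ => integrable_finsetSum _ fun j _ => hi i j, kcoef, Finset.sum_mul]
    refine Finset.sum_congr rfl fun i _ => ?_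
    rw [integral_finsetSum _ fun j _ => hi i j, Finset.sum_mul]
    refine Finset.sum_congr rfl fun j _ => ?_
    rw [integral_const_mul, H.Fii_moment D i j hh.1]
    split_ifs <;> simp)
  filter_upwards [this, hσ] with y hy hy1
  rw [Gam_eq H D N hy1]
  exact sub_eq_zero.1 hy
end

end

section

section
open ProbabilityTheory
variable {d C : ℕ} {τ : Measure (VV d)} {φ : VV d → ℂ} {m : Kernel (BB d) (VV d)}

lemma Dis.transfer (D : Dis d τ m) {P : VV d → Prop} (hP : MeasurableSet {y | P y})
    (hinv : ∀ y z, ‖y‖ = 1 → ‖z‖ = 1 → hopf z = hopf y → P y → P z)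
    (h : ∀ᵐ y ∂(sig (d+1)), P y) : ∀ᵐ z ∂τ, P z := by
  have hF : Measurable (fun x : BB d × VV d => {y | P y}ᶜ.indicator (fun _ => (1:ℝ≥0∞)) x.2) :=
    (measurable_const.indicator hP.compl).comp measurable_snd
  have h1 := D.lint hF
  simp only at h1
  have h2 : ∫⁻ z, {y | P y}ᶜ.indicator (fun _ => (1:ℝ≥0∞)) z ∂τ = 0 := by
    rw [← h1, lintegral_eq_zero_iff' ]
    · filter_upwards [h, sig_ae_norm (n := d+1) (by omega)] with y hy hy1
      have : ∫⁻ z, {y | P y}ᶜ.indicator (fun _ => (1:ℝ≥0∞)) z ∂(m (hopf y)) = ∫⁻ z, 0 ∂(m (hopf y)) := by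
        refine lintegral_congr_ae ?_
        filter_upwards [D.conc (hopf y)] with z hz
        refine indicator_of_notMem ?_ _
        simp only [mem_compl_iff, mem_ofPred_eq, not_not]
        exact hinv y z hy1 hz.2 hz.1 hy
      simpa using this
    · haveI := D.sf
      have : Measurable (fun b => ∫⁻ z, {y | P y}ᶜ.indicator (fun _ => (1:ℝ≥0∞)) z ∂(m b)) :=
        Measurable.lintegral_kernel (measurable_const.indicator hP.compl)
      exact (this.comp continuous_hopf.measurable).aemeasurable
  rw [lintegral_indicator hP.compl] at h2
  rw [lintegral_one, Measure.restrict_apply_univ] at h2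
  exact h2

lemma Core.Gam_meas (H : Core d C τ φ) (D : Dis d τ m) (N : ℕ) : Measurable (Gam d m φ N) := by
  have hm : Measurable (fun x : VV d × VV d => φ x.2 * (ktR N (inner ℂ x.1 x.2) : ℂ)) :=
    (H.meas.comp measurable_snd).mul (Complex.measurable_ofReal.comp ((continuous_ktR N).measurable.comp (measurable_inner_pair d)))
  exact measurable_kint D hm

lemma Core.phases (H : Core d C τ φ) (D : Dis d τ m) :
    ∀ᵐ y ∂τ, ∀ N : ℕ, 1 ≤ N → ∀ u : ℂ, ‖u‖ = 1 → GN d C N τ φ (u • y) = Gam d m φ N (u • y) := by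
  set P : VV d → Prop := fun y => ∀ N : ℕ, ∀ k : ℕ, GN d C (N+1) τ φ ((TopologicalSpace.denseSeq (Metric.sphere (0:ℂ) 1) k:ℂ) • y) = Gam d m φ (N+1) ((TopologicalSpace.denseSeq (Metric.sphere (0:ℂ) 1) k:ℂ) • y) with hPdef
  have key : ∀ y : VV d, ‖y‖ = 1 → P y → ∀ N : ℕ, 1 ≤ N → ∀ u : Metric.sphere (0:ℂ) 1, GN d C N τ φ ((u:ℂ) • y) = Gam d m φ N ((u:ℂ) • y) := by
    intro y hy hP N hN
    obtain ⟨N, rfl⟩ : ∃ M, N = M + 1 := ⟨N - 1, by omega⟩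
    have hc1 : Continuous (fun u : Metric.sphere (0:ℂ) 1 => GN d C (N+1) τ φ ((u:ℂ) • y)) := by
      refine (H.GN_cont (N+1)).comp_continuous (by fun_prop) ?_
      intro u; simp [norm_smul, hy]
    have hc2 : Continuous (fun u : Metric.sphere (0:ℂ) 1 => Gam d m φ (N+1) ((u:ℂ) • y)) := by
      have : (fun u : Metric.sphere (0:ℂ) 1 => Gam d m φ (N+1) ((u:ℂ) • y)) = fun u : Metric.sphere (0:ℂ) 1 => ∑ i ∈ Finset.range (N+1), ∑ j ∈ Finset.range (N+1), (1/(N+1:ℕ) : ℂ) * ((starRingEnd ℂ) (u:ℂ) ^ i * (u:ℂ) ^ j * Fii d m φ i j y) := by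
        funext u
        rw [Gam_eq H D (N+1) (by simp [norm_smul, hy])]
        refine Finset.sum_congr rfl fun i _ => Finset.sum_congr rfl fun j _ => ?_
        rw [Fii_smul (by simp)]
      rw [this]
      have hcc : Continuous (fun u : Metric.sphere (0:ℂ) 1 => (starRingEnd ℂ) (u:ℂ)) := Complex.continuous_conj.comp (by fun_prop)
      refine continuous_finsetSum _ fun i _ => continuous_finsetSum _ fun j _ => ?_
      exact continuous_const.mul (((hcc.pow i).mul ((by fun_prop : Continuous (fun u : Metric.sphere (0:ℂ) 1 => (u:ℂ))).pow j)).mul continuous_const)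
    have := Continuous.ext_on (TopologicalSpace.denseRange_denseSeq (Metric.sphere (0:ℂ) 1)) hc1 hc2 (by
      rintro _ ⟨k, rfl⟩
      exact hP N k)
    exact fun u => congrFun this u
  have h3 : ∀ᵐ y ∂τ, P y := by
    refine D.transfer ?_ ?_ ?_
    · simp only [hPdef, ofPred_forall]
      refine MeasurableSet.iInter fun N => MeasurableSet.iInter fun k => ?_
      have hs : Measurable (fun y : VV d => (TopologicalSpace.denseSeq (Metric.sphere (0:ℂ) 1) k:ℂ) • y) :=
        (continuous_const_smul _).measurable
      exact measurableSet_eq_fun ((H.GN_meas (N+1)).comp hs) ((H.Gam_meas D (N+1)).comp hs)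
    · intro y z hy hz hyz hP N k
      have hf := hopf_fiber hy hz hyz
      have := key y hy hP (N+1) (by omega) ⟨(TopologicalSpace.denseSeq (Metric.sphere (0:ℂ) 1) k : ℂ) * inner ℂ y z, by simp [hf.1]⟩
      rw [hf.2, smul_smul]
      exact this
    · refine ae_all_iff.2 fun N => ae_all_iff.2 fun k => ?_
      have h := H.Gam_ae D (N := N+1) (by omega)
      have hu : ‖(TopologicalSpace.denseSeq (Metric.sphere (0:ℂ) 1) k:ℂ)‖ = 1 := by simp
      rw [← sig_map (uLIE (d+1) _ hu)] at h
      have := ae_of_ae_map (measurable_lie _).aemeasurable h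
      exact this
  filter_upwards [h3, H.sph] with y hy hy1
  intro N hN u hu
  exact key y hy1 hy N hN ⟨u, by simp [hu]⟩

end

end

section

section
open ProbabilityTheory
variable {d C : ℕ} {τ : Measure (VV d)} {φ : VV d → ℂ} {m : Kernel (BB d) (VV d)}

lemma ktR_tail {c : ℂ} (hc : ‖c‖ ≤ 1) {r : ℝ} (hr : 0 < r) (h : r ≤ ‖1 - c‖) (N : ℕ) :
    ktR N c ≤ 4 / (N * r^2) := by
  rcases Nat.eq_zero_or_pos N with rfl | hN
  · simp [ktR]
  have hN' : (0:ℝ) < N := by exact_mod_cast hN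
  have h1 : ‖∑ i ∈ Finset.range N, c^i‖ * ‖1 - c‖ ≤ 2 := by
    rw [← norm_mul, geom_sum_mul_neg]
    calc ‖1 - c^N‖ ≤ ‖(1:ℂ)‖ + ‖c^N‖ := norm_sub_le _ _
      _ ≤ 1 + 1 := by
        gcongr
        · simp
        · rw [norm_pow]; exact pow_le_one₀ (norm_nonneg _) hc
      _ = 2 := by norm_num
  have h2 : ‖∑ i ∈ Finset.range N, c^i‖ * r ≤ 2 := le_trans (by gcongr) h1
  unfold ktR
  rw [div_le_div_iff₀ hN' (by positivity)]
  have h3 : (‖∑ i ∈ Finset.range N, c^i‖ * r)^2 ≤ 2^2 := by gcongr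
  nlinarith

lemma ktR_one (N : ℕ) : ktR N 1 = N := by
  rcases Nat.eq_zero_or_pos N with rfl | hN
  · simp [ktR]
  · have hN' : (0:ℝ) < N := by exact_mod_cast hN
    simp [ktR]; field_simp

lemma fiber_dist {y z : VV d} (hy : ‖y‖ = 1) (h : z = (inner ℂ y z : ℂ) • y) : ‖1 - (inner ℂ y z : ℂ)‖ = dist z y := by
  rw [dist_comm, dist_eq_norm]
  conv_rhs => rw [h]
  rw [show y - (inner ℂ y z : ℂ) • y = (1 - (inner ℂ y z : ℂ)) • y by rw [sub_smul, one_smul], norm_smul, hy, mul_one]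

lemma Gam_near (H : Core d C τ φ) (D : Dis d τ m) {N : ℕ} (hN : 1 ≤ N) {y : VV d} (hy : ‖y‖ = 1) {r : ℝ} (hr : 0 < r)
    (S : Set (VV d)) (hS : S = {y} ∨ S = ∅) :
    ‖Gam d m φ N y / N - ∫ z in S, φ z ∂(m (hopf y))‖ ≤ (m (hopf y)).real (ball y r \ S) + 4 / (N * r)^2 * (m (hopf y)).real univ := by
  haveI := D.fin (hopf y)
  have hN' : (0:ℝ) < N := by exact_mod_cast hN
  have hSm : MeasurableSet S := by
    rcases hS with rfl | rfl
    · exact measurableSet_singleton _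
    · exact MeasurableSet.empty
  have hcm : Continuous (fun z : VV d => ktR N (inner ℂ y z)) := (continuous_ktR N).comp (by fun_prop)
  have hb : ∀ᵐ z ∂(m (hopf y)), 0 ≤ ktR N (inner ℂ y z) ∧ ktR N (inner ℂ y z) ≤ N := by
    filter_upwards [D.conc (hopf y)] with z hz
    exact ⟨ktR_nonneg _ _, ktR_le (hopf_fiber hy hz.2 hz.1).1.le N⟩
  have hI : Integrable (fun z => φ z * (ktR N (inner ℂ y z) : ℂ)) (m (hopf y)) := by
    refine Integrable.of_bound (C := N) (H.meas.mul (Complex.measurable_ofReal.comp hcm.measurable)).aestronglyMeasurable ?_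
    filter_upwards [hb] with z hz
    rw [norm_mul, H.one, one_mul, Complex.norm_real, Real.norm_of_nonneg hz.1]; exact hz.2
  have hI2 : Integrable φ (m (hopf y)) := Integrable.of_bound (C := 1) H.meas.aestronglyMeasurable (Filter.Eventually.of_forall fun z => (H.one z).le)
  have e1 : Gam d m φ N y / N - ∫ z in S, φ z ∂(m (hopf y)) = ∫ z, (φ z * (ktR N (inner ℂ y z) : ℂ) / N - S.indicator φ z) ∂(m (hopf y)) := by
    rw [integral_sub (hI.div_const _) (hI2.indicator hSm), integral_div, integral_indicator hSm]
    rfl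
  rw [e1]
  have hbm : MeasurableSet (ball y r \ S) := measurableSet_ball.diff hSm
  have e2 : (m (hopf y)).real (ball y r \ S) + 4 / (N * r)^2 * (m (hopf y)).real univ = ∫ z, ((ball y r \ S).indicator (fun _ => (1:ℝ)) z + 4 / (N * r)^2) ∂(m (hopf y)) := by
    rw [integral_add ((integrable_const _).indicator hbm) (integrable_const _), integral_indicator hbm]
    simp [mul_comm]
  rw [e2]
  refine norm_integral_le_of_norm_le (((integrable_const _).indicator hbm).add (integrable_const _)) ?_
  filter_upwards [D.conc (hopf y), hb] with z hz hzb
  have hf := hopf_fiber hy hz.2 hz.1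
  have hpos : 0 ≤ 4 / (N * r)^2 := by positivity
  have hn : ‖φ z * (ktR N (inner ℂ y z) : ℂ) / N‖ = ktR N (inner ℂ y z) / N := by
    rw [norm_div, norm_mul, H.one, one_mul, Complex.norm_real, Real.norm_of_nonneg hzb.1, Complex.norm_natCast]
  by_cases hzS : z ∈ S
  · have hzy : z = y := by
      rcases hS with rfl | rfl
      · exact hzS
      · exact absurd hzS (notMem_empty _)
    have h1 : (inner ℂ y z : ℂ) = 1 := by
      rw [hzy, inner_self_eq_norm_sq_to_K, hy]; simp
    rw [h1, ktR_one, indicator_of_mem hzS, indicator_of_notMem (by simp [hzS])]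
    have : φ z * ((N:ℝ):ℂ) / N - φ z = 0 := by
      have : (N:ℂ) ≠ 0 := by exact_mod_cast hN'.ne'
      push_cast; field_simp; ring
    rw [this]; simpa using hpos
  · rw [indicator_of_notMem hzS, sub_zero, hn]
    by_cases hzr : z ∈ ball y r
    · rw [indicator_of_mem (show z ∈ ball y r \ S from ⟨hzr, hzS⟩)]
      have : ktR N (inner ℂ y z) / N ≤ 1 := by rw [div_le_one hN']; exact hzb.2
      linarith
    · rw [indicator_of_notMem (fun h => hzr h.1), zero_add]
      have h2 : r ≤ ‖1 - (inner ℂ y z : ℂ)‖ := by rw [fiber_dist hy hf.2]; simpa using hzr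
      have := ktR_tail hf.1.le hr h2 N
      calc ktR N (inner ℂ y z) / N ≤ 4 / (N * r^2) / N := by gcongr
        _ = 4 / (N*r)^2 := by field_simp

lemma Gam_tail (H : Core d C τ φ) (D : Dis d τ m) {N : ℕ} (hN : 1 ≤ N) {y : VV d} (hy : ‖y‖ = 1) {r : ℝ} (hr : 0 < r) :
    ‖Gam d m φ N y‖ / N ≤ (m (hopf y)).real (ball y r) + 4 / (N * r)^2 * (m (hopf y)).real univ := by
  have := Gam_near H D hN hy hr ∅ (Or.inr rfl)
  simpa using this

lemma Gam_lower (H : Core d C τ φ) (D : Dis d τ m) {N : ℕ} (hN : 1 ≤ N) {y : VV d} (hy : ‖y‖ = 1) {r : ℝ} (hr : 0 < r) :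
    (m (hopf y)).real {y} - (m (hopf y)).real (ball y r \ {y}) - 4 / (N * r)^2 * (m (hopf y)).real univ ≤ ‖Gam d m φ N y‖ / N := by
  have h := Gam_near H D hN hy hr {y} (Or.inl rfl)
  have h1 : ‖∫ z in {y}, φ z ∂(m (hopf y))‖ = (m (hopf y)).real {y} := by
    rw [integral_singleton, norm_smul, H.one, mul_one, Real.norm_of_nonneg measureReal_nonneg]
  have h2 : ‖Gam d m φ N y / N‖ = ‖Gam d m φ N y‖ / N := by simp
  rw [← h1, ← h2]
  have := norm_sub_norm_le (∫ z in {y}, φ z ∂(m (hopf y))) (Gam d m φ N y / N)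
  rw [norm_sub_rev] at this
  linarith

end

end

section

section
open ProbabilityTheory
variable {d C : ℕ} {τ : Measure (VV d)} {φ : VV d → ℂ} {m : Kernel (BB d) (VV d)}

/-- The good points with quantitative parameters `K`, `L`. -/
structure Pc (d C : ℕ) (τ : Measure (VV d)) (φ : VV d → ℂ) (m : Kernel (BB d) (VV d)) (K L : ℕ) (y : VV d) : Prop where
  nrm : ‖y‖ = 1
  ph : ∀ N : ℕ, 1 ≤ N → ∀ u : ℂ, ‖u‖ = 1 → GN d C N τ φ (u • y) = Gam d m φ N (u • y)
  mass : (m (hopf y)).real univ ≤ K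
  tube : ∀ r : ℝ, 0 < r → τ {w | xx y w < r} ≤ ENNReal.ofReal (K * r^(2*d))
  atom : 1 / (K:ℝ) ≤ (m (hopf y)).real {y}
  near : (m (hopf y)).real (ball y (1/(L:ℝ)) \ {y}) ≤ 1 / (8 * (K:ℝ))

lemma cone1 (H : Core d C τ φ) (D : Dis d τ m) {K L : ℕ} (hK : 1 ≤ K) (hL : 1 ≤ L) :
    ∃ c0 : ℝ, 0 < c0 ∧ ∀ y y'' : VV d, Pc d C τ φ m K L y → Pc d C τ φ m K L y'' → ∀ u : ℂ, ‖u‖ = 1 →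
      ‖u • y'' - y''‖ ≤ 1 / (2 * L) → ∀ N : ℕ, 12 * L * K ≤ N → N * ‖y - u • y''‖ ≤ c0 → ‖u • y'' - y''‖ ≤ 6 * K / N := by
  obtain ⟨C0, hC0, hG⟩ := Greg (d+1) d (C+(d+3))
  have hK' : (1:ℝ) ≤ K := by exact_mod_cast hK
  have hL' : (1:ℝ) ≤ L := by exact_mod_cast hL
  refine ⟨min 1 (1 / (4 * C0 * K^2)), by positivity, ?_⟩
  intro y y'' hy hy'' u hu huy N hN hNd
  haveI := H.fin
  have hN12 : 12 * (L:ℝ) * K ≤ N := by exact_mod_cast hN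
  have hLK : (1:ℝ) ≤ L * K := by nlinarith
  have hN0 : (1:ℝ) ≤ N := by nlinarith
  have hN1 : 1 ≤ N := by exact_mod_cast hN0
  have hN' : (0:ℝ) < N := by linarith
  have hy' : ‖u • y''‖ = 1 := by rw [norm_smul, hu, hy''.nrm, one_mul]
  have h1 := hG τ H.sph φ H.meas (fun w => (H.one w).le) K (by positivity) N hN1 y (u • y'') hy.nrm hy' hy.tube (hNd.trans (min_le_left _ _))
  have h2 : ‖GN d C N τ φ y - GN d C N τ φ (u • y'')‖ / N ≤ 1 / (4 * K) := by
    have h3 : N * ‖y - u • y''‖ ≤ 1 / (4 * C0 * K^2) := hNd.trans (min_le_right _ _)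
    rw [div_le_iff₀ hN']
    refine h1.trans ?_
    calc C0 * K * N * (N * ‖y - u • y''‖) ≤ C0 * K * N * (1 / (4 * C0 * K^2)) := by gcongr
      _ = 1 / (4 * K) * N := by field_simp
  have e1 : GN d C N τ φ y = Gam d m φ N y := by simpa using hy.ph N hN1 1 (by simp)
  have e2 := hy''.ph N hN1 u hu
  rw [e1, e2] at h2
  have l1 := Gam_lower H D hN1 hy.nrm (r := 1 / L) (by positivity)
  have l2 := Gam_tail H D hN1 hy' (r := 6 * K / N) (by positivity)
  rw [hopf_smul u hu] at l2
  have l3 : ‖Gam d m φ N y‖ / N - ‖Gam d m φ N (u • y'')‖ / N ≤ 1 / (4 * K) := by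
    rw [← sub_div]
    refine le_trans ?_ h2
    gcongr
    exact norm_sub_norm_le _ _
  have l4 : 4 / (N * (1 / (L:ℝ)))^2 * (m (hopf y)).real univ ≤ 1 / (8 * K) := by
    calc 4 / (N * (1 / (L:ℝ)))^2 * (m (hopf y)).real univ ≤ 4 / (12 * L * K * (1 / (L:ℝ)))^2 * (K:ℝ) := by
          gcongr; exact hy.mass
      _ = 1 / (36 * (K:ℝ)) := by field_simp; norm_num
      _ ≤ 1 / (8 * (K:ℝ)) := by gcongr; norm_num
  have l5 : 4 / (N * (6 * (K:ℝ) / N))^2 * (m (hopf y'')).real univ ≤ 1 / (8 * K) := by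
    calc 4 / (N * (6 * (K:ℝ) / N))^2 * (m (hopf y'')).real univ ≤ 4 / (N * (6 * (K:ℝ) / N))^2 * (K:ℝ) := by
          gcongr; exact hy''.mass
      _ = 1 / (9 * (K:ℝ)) := by field_simp; norm_num
      _ ≤ 1 / (8 * (K:ℝ)) := by gcongr; norm_num
  have l6 := hy.atom
  have l7 := hy.near
  by_contra hcon
  push Not at hcon
  haveI := D.fin (hopf y'')
  have hsub : ball (u • y'') (6 * K / N) ⊆ ball y'' (1 / (L:ℝ)) \ {y''} := by
    intro w hw
    rw [mem_ball] at hw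
    refine ⟨?_, ?_⟩
    · rw [mem_ball]
      have : 6 * (K:ℝ) / N ≤ 1 / (2 * L) := by
        rw [div_le_div_iff₀ hN' (by positivity)]; nlinarith
      calc dist w y'' ≤ dist w (u • y'') + dist (u • y'') y'' := dist_triangle _ _ _
        _ < 1 / (2 * L) + 1 / (2 * L) := by
          rw [dist_eq_norm (u • y'')]; linarith
        _ = 1 / (L:ℝ) := by field_simp; norm_num
    · rintro rfl
      rw [dist_comm, dist_eq_norm] at hw
      linarith
  have l8 : (m (hopf y'')).real (ball (u • y'') (6 * K / N)) ≤ 1 / (8 * K) := (measureReal_mono hsub).trans hy''.near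
  have a1 : 1 / (8 * (K:ℝ)) = (1 / K) / 8 := by field_simp
  have a2 : 1 / (4 * (K:ℝ)) = (1 / K) / 4 := by field_simp
  have a3 : 0 < 1 / (K:ℝ) := by positivity
  rw [a1] at l4 l5 l7 l8
  rw [a2] at l3
  linarith

lemma exists_phase {y z : VV d} (hy : ‖y‖ = 1) (hz : ‖z‖ = 1) : ∃ u : ℂ, ‖u‖ = 1 ∧ ‖y - u • z‖ ≤ 2 * xx y z := by
  have hle := inner_le_one hy hz
  have hx2 : xx y z ^ 2 = 1 - ‖inner ℂ y z‖^2 := by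
    unfold xx; rw [Real.sq_sqrt]; nlinarith [norm_nonneg (inner ℂ y z : ℂ)]
  by_cases hc : (inner ℂ y z : ℂ) = 0
  · refine ⟨1, by simp, ?_⟩
    have : xx y z = 1 := by unfold xx; simp [hc]
    rw [this, one_smul]
    refine (norm_sub_le _ _).trans ?_
    rw [hy, hz]; norm_num
  · have hc' : (‖(inner ℂ y z : ℂ)‖ : ℝ) ≠ 0 := by simpa using hc
    set c : ℂ := inner ℂ y z with hcdef
    have hu : ‖(starRingEnd ℂ) c / (‖c‖ : ℂ)‖ = 1 := by
      rw [norm_div, RCLike.norm_conj, Complex.norm_real, norm_norm, div_self hc']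
    refine ⟨(starRingEnd ℂ) c / (‖c‖ : ℂ), hu, ?_⟩
    refine abs_le_of_sq_le_sq' ?_ (by have := xx_nonneg y z; positivity) |>.2
    have e : (inner ℂ y (((starRingEnd ℂ) c / (‖c‖ : ℂ)) • z) : ℂ) = (‖c‖ : ℂ) := by
      rw [inner_smul_right, ← hcdef, div_mul_eq_mul_div, mul_comm, Complex.mul_conj, Complex.normSq_eq_norm_sq]
      have : (‖c‖ : ℂ) ≠ 0 := by exact_mod_cast hc'
      push_cast; field_simp
    have e2 := norm_sub_sq (𝕜 := ℂ) y (((starRingEnd ℂ) c / (‖c‖ : ℂ)) • z)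
    rw [e, norm_smul, hu, hy, hz] at e2
    have e3 : (2 * xx y z)^2 = 4 * (1 - ‖c‖^2) := by rw [mul_pow, hx2]; norm_num
    have e4 : RCLike.re (‖c‖ : ℂ) = ‖c‖ := by simp
    rw [e2, e3, e4]
    nlinarith [norm_nonneg c]

lemma xx_self {y : VV d} (hy : ‖y‖ = 1) : xx y y = 0 := by
  unfold xx
  rw [inner_self_eq_norm_sq_to_K, hy]; simp

lemma xx_le_dist {y z : VV d} (hy : ‖y‖ = 1) (hz : ‖z‖ = 1) : xx y z ≤ ‖y - z‖ := by
  have := xx_lip hy hz hz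
  rw [xx_self hz, sub_zero] at this
  exact (le_abs_self _).trans this

lemma cone2 (H : Core d C τ φ) (D : Dis d τ m) {K L : ℕ} (hK : 1 ≤ K) (hL : 1 ≤ L) :
    ∃ δ M : ℝ, 0 < δ ∧ 0 < M ∧ ∀ y y'' : VV d, Pc d C τ φ m K L y → Pc d C τ φ m K L y'' →
      ‖y - y''‖ ≤ δ → ‖y - y''‖ ≤ M * xx y y'' := by
  obtain ⟨c0, hc0, h⟩ := cone1 H D hK hL
  have hK' : (1:ℝ) ≤ K := by exact_mod_cast hK
  have hL' : (1:ℝ) ≤ L := by exact_mod_cast hL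
  set N0 : ℕ := 12 * L * K with hN0
  have hLK : (1:ℝ) ≤ L * K := by nlinarith
  have hN0' : (1:ℝ) ≤ N0 := by rw [hN0]; push_cast; nlinarith
  refine ⟨min (1 / (6 * L)) (c0 / (2 * N0)), 2 * (1 + 12 * K / c0), by positivity, by positivity, ?_⟩
  intro y y'' hy hy'' hδ
  obtain ⟨u, hu, hd⟩ := exists_phase hy.nrm hy''.nrm
  have hxx := xx_le_dist hy.nrm hy''.nrm
  have hδ1 : ‖y - y''‖ ≤ 1 / (6 * L) := hδ.trans (min_le_left _ _)
  have hδ2 : ‖y - y''‖ ≤ c0 / (2 * N0) := hδ.trans (min_le_right _ _)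
  have h1 : ‖u • y'' - y''‖ ≤ 1 / (2 * L) := by
    calc ‖u • y'' - y''‖ = ‖(y - y'') - (y - u • y'')‖ := by congr 1; abel
      _ ≤ ‖y - y''‖ + ‖y - u • y''‖ := norm_sub_le _ _
      _ ≤ 3 * (1 / (6 * L)) := by linarith
      _ = 1 / (2 * L) := by field_simp; norm_num
  have h2 := h y y'' hy hy'' u hu h1
  have htri : ‖y - y''‖ ≤ ‖y - u • y''‖ + ‖u • y'' - y''‖ := by
    calc ‖y - y''‖ = ‖(y - u • y'') + (u • y'' - y'')‖ := by congr 1; abel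
      _ ≤ _ := norm_add_le _ _
  rcases eq_or_lt_of_le (norm_nonneg (y - u • y'')) with h0 | h0
  · have h3 : ‖u • y'' - y''‖ ≤ 0 := by
      refine le_of_forall_pos_le_add fun ε hε => ?_
      obtain ⟨N, hN⟩ := exists_nat_gt (6 * K / ε)
      have hNN : (0:ℝ) < (max N N0 : ℕ) := by
        push_cast; exact lt_max_of_lt_right (by linarith)
      refine (h2 (max N N0) (le_max_right _ _) (by rw [← h0]; simpa using hc0.le)).trans ?_
      rw [zero_add, div_le_iff₀ hNN]
      rw [div_lt_iff₀ hε] at hN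
      have : (N:ℝ) ≤ (max N N0 : ℕ) := by exact_mod_cast le_max_left _ _
      nlinarith
    have : ‖y - y''‖ ≤ 0 := by linarith
    refine this.trans ?_
    have := xx_nonneg y y''
    positivity
  · set d0 := ‖y - u • y''‖ with hd0
    have hq : (N0:ℝ) ≤ c0 / d0 := by
      rw [le_div_iff₀ h0]
      have : d0 ≤ c0 / N0 := by
        calc d0 ≤ 2 * ‖y - y''‖ := by linarith
          _ ≤ 2 * (c0 / (2 * N0)) := by linarith
          _ = c0 / N0 := by field_simp
      rw [le_div_iff₀ (by linarith)] at this
      linarith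
    have hf1 : (⌊c0 / d0⌋₊ : ℝ) ≤ c0 / d0 := Nat.floor_le (by positivity)
    have hf2 : N0 ≤ ⌊c0 / d0⌋₊ := Nat.le_floor hq
    have hf3 : c0 / d0 < ⌊c0 / d0⌋₊ + 1 := Nat.lt_floor_add_one _
    have hf4 : (1:ℝ) ≤ ⌊c0 / d0⌋₊ := by
      have : (N0:ℝ) ≤ ⌊c0 / d0⌋₊ := by exact_mod_cast hf2
      linarith
    have h3 := h2 _ hf2 (by rwa [← le_div_iff₀ h0])
    have h4 : 6 * (K:ℝ) / ⌊c0 / d0⌋₊ ≤ 12 * K / c0 * d0 := by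
      have : c0 / (2 * d0) ≤ ⌊c0 / d0⌋₊ := by
        have : c0 / (2 * d0) = c0 / d0 / 2 := by field_simp
        linarith
      calc 6 * (K:ℝ) / ⌊c0 / d0⌋₊ ≤ 6 * K / (c0 / (2 * d0)) := by gcongr
        _ = 12 * K / c0 * d0 := by field_simp; norm_num
    have h5 : (0:ℝ) ≤ 12 * K / c0 := by positivity
    nlinarith

end

end

section

section
variable {d : ℕ}

lemma xx_le_smul {y w : VV d} (hy : ‖y‖ = 1) (hw : ‖w‖ = 1) (t : ℂ) : xx y w ≤ ‖y - t • w‖ := by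
  rw [xx_eq hy hw]
  have e : y - (inner ℂ w y) • w = (y - t • w) - (inner ℂ w (y - t • w)) • w := by
    rw [inner_sub_right, inner_smul_right, inner_self_eq_norm_sq_to_K, hw, sub_smul]
    simp
  rw [e]
  refine abs_le_of_sq_le_sq' ?_ (norm_nonneg _) |>.2
  rw [proj_norm hw]
  nlinarith [norm_nonneg (inner ℂ (y - t • w) w : ℂ)]

def chartW (d : ℕ) (j : Fin (d+1)) (y : VV d) : EuclideanSpace ℂ (Fin d) :=
  WithLp.toLp 2 fun i => y (j.succAbove i) / y j

lemma xx_le_chart {y w : VV d} (hy : ‖y‖ = 1) (hw : ‖w‖ = 1) (j : Fin (d+1)) (hyj : y j ≠ 0) (hwj : w j ≠ 0) :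
    xx y w ≤ ‖chartW d j y - chartW d j w‖ := by
  refine (xx_le_smul hy hw (y j / w j)).trans ?_
  refine abs_le_of_sq_le_sq' ?_ (norm_nonneg _) |>.2
  rw [EuclideanSpace.norm_sq_eq, EuclideanSpace.norm_sq_eq, Fin.sum_univ_succAbove _ j]
  have h0 : ‖(y - (y j / w j) • w).ofLp j‖^2 = 0 := by
    simp [hwj]
  rw [h0, zero_add]
  refine Finset.sum_le_sum fun i _ => ?_
  have e : (y - (y j / w j) • w).ofLp (j.succAbove i) = y j * (chartW d j y - chartW d j w).ofLp i := by
    simp [chartW]; field_simp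
  rw [e, norm_mul, mul_pow]
  have h1 : ‖y j‖ ≤ 1 := by rw [← hy]; exact PiLp.norm_apply_le y j
  have h2 : ‖y j‖^2 ≤ 1 := pow_le_one₀ (norm_nonneg _) h1
  nlinarith [sq_nonneg ‖(chartW d j y - chartW d j w).ofLp i‖]

lemma piece_lip {S : Set (VV d)} {M : ℝ} (hM : 0 < M) (j : Fin (d+1)) (hn : ∀ y ∈ S, ‖y‖ = 1) (hj : ∀ y ∈ S, y j ≠ 0)
    (hS : ∀ y ∈ S, ∀ w ∈ S, ‖y - w‖ ≤ M * xx y w) :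
    ∃ g : EuclideanSpace ℝ (Fin (2*d)) → VV d, (∃ K : ℝ≥0, LipschitzWith K g) ∧ S ⊆ range g := by
  have hfr : Module.finrank ℝ (EuclideanSpace ℂ (Fin d)) = Module.finrank ℝ (EuclideanSpace ℝ (Fin (2*d))) := by
    rw [finrankV]; simp
  let e : EuclideanSpace ℂ (Fin d) ≃L[ℝ] EuclideanSpace ℝ (Fin (2*d)) := ContinuousLinearEquiv.ofFinrankEq hfr
  set Ψ : VV d → EuclideanSpace ℝ (Fin (2*d)) := fun y => e (chartW d j y) with hΨ
  obtain ⟨K1, hK1⟩ : ∃ K : ℝ≥0, LipschitzWith K e.symm := ⟨_, e.symm.lipschitz⟩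
  have hdist : ∀ y ∈ S, ∀ w ∈ S, ‖y - w‖ ≤ M * K1 * dist (Ψ y) (Ψ w) := by
    intro y hy w hw
    have h1 := hK1.dist_le_mul (Ψ y) (Ψ w)
    simp only [hΨ, ContinuousLinearEquiv.symm_apply_apply] at h1
    rw [dist_eq_norm] at h1
    calc ‖y - w‖ ≤ M * xx y w := hS y hy w hw
      _ ≤ M * ‖chartW d j y - chartW d j w‖ := by
        gcongr; exact xx_le_chart (hn y hy) (hn w hw) j (hj y hy) (hj w hw)
      _ ≤ M * (K1 * dist (Ψ y) (Ψ w)) := by gcongr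
      _ = _ := by ring
  classical
  set g0 : EuclideanSpace ℝ (Fin (2*d)) → VV d := Function.invFunOn Ψ S with hg0
  have hg0S : ∀ t ∈ Ψ '' S, g0 t ∈ S ∧ Ψ (g0 t) = t := fun t ht =>
    ⟨Function.invFunOn_mem ht, Function.invFunOn_eq ht⟩
  have hl : LipschitzOnWith (Real.toNNReal (M * K1)) g0 (Ψ '' S) := by
    refine LipschitzOnWith.of_dist_le_mul fun t ht s hs => ?_
    rw [dist_eq_norm]
    have := hdist _ (hg0S t ht).1 _ (hg0S s hs).1
    rw [(hg0S t ht).2, (hg0S s hs).2] at this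
    rwa [Real.coe_toNNReal _ (by positivity)]
  obtain ⟨g, hg, hgeq⟩ := hl.extend_finite_dimension
  refine ⟨g, ⟨_, hg⟩, ?_⟩
  intro y hy
  have hy' : Ψ y ∈ Ψ '' S := mem_image_of_mem _ hy
  refine ⟨Ψ y, ?_⟩
  rw [← hgeq hy']
  have := hdist _ (hg0S _ hy').1 y hy
  rw [(hg0S _ hy').2, dist_self, mul_zero] at this
  exact sub_eq_zero.1 (norm_le_zero_iff.1 this)

end

end

section

section
open ProbabilityTheory
variable {d C : ℕ} {τ : Measure (VV d)} {φ : VV d → ℂ} {m : Kernel (BB d) (VV d)}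

lemma cover (H : Core d C τ φ) (D : Dis d τ m) :
    ∃ g : ℕ → (EuclideanSpace ℝ (Fin (2*d)) → VV d), (∀ i, ∃ K : ℝ≥0, LipschitzWith K (g i)) ∧
      ∀ y, (∃ K L : ℕ, Pc d C τ φ m (K+1) (L+1) y) → y ∈ ⋃ i, range (g i) := by
  have h : ∀ K L : ℕ, ∃ δ M : ℝ, 0 < δ ∧ 0 < M ∧ ∀ y y'' : VV d, Pc d C τ φ m (K+1) (L+1) y → Pc d C τ φ m (K+1) (L+1) y'' →
      ‖y - y''‖ ≤ δ → ‖y - y''‖ ≤ M * xx y y'' := fun K L => cone2 H D (by omega) (by omega)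
  choose δ M hδ hM hc using h
  have hp : ∀ i : ℕ × ℕ × Fin (d+1) × ℕ, ∃ g : EuclideanSpace ℝ (Fin (2*d)) → VV d, (∃ K : ℝ≥0, LipschitzWith K g) ∧
      {y | Pc d C τ φ m (i.1+1) (i.2.1+1) y ∧ y i.2.2.1 ≠ 0 ∧ dist y (TopologicalSpace.denseSeq (VV d) i.2.2.2) ≤ δ i.1 i.2.1 / 2} ⊆ range g := by
    rintro ⟨K, L, j, k⟩
    refine piece_lip (hM K L) j (fun y hy => hy.1.nrm) (fun y hy => hy.2.1) ?_
    intro y hy w hw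
    refine hc K L y w hy.1 hw.1 ?_
    rw [← dist_eq_norm]
    have h1 := dist_triangle_right y w (TopologicalSpace.denseSeq (VV d) k)
    have h2 := hy.2.2
    have h3 := hw.2.2
    simp only at h2 h3
    linarith
  choose g hg hsub using hp
  obtain ⟨s, hs⟩ := exists_surjective_nat (ℕ × ℕ × Fin (d+1) × ℕ)
  refine ⟨fun i => g (s i), fun i => hg _, ?_⟩
  rintro y ⟨K, L, hy⟩
  obtain ⟨j, hj⟩ : ∃ j, y j ≠ 0 := by
    by_contra hcon
    push Not at hcon
    have : y = 0 := by ext i; simpa using hcon i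
    have h1 := hy.nrm
    rw [this] at h1; simp at h1
  obtain ⟨k, hk⟩ := (TopologicalSpace.denseRange_denseSeq (VV d)).exists_dist_lt y (half_pos (hδ K L))
  obtain ⟨i, hi⟩ := hs (K, L, j, k)
  refine mem_iUnion.2 ⟨i, ?_⟩
  simp only [hi]
  exact hsub (K, L, j, k) ⟨hy, hj, hk.le⟩

end

end

section

section
open ProbabilityTheory
variable {d C : ℕ} {τ : Measure (VV d)} {φ : VV d → ℂ} {m : Kernel (BB d) (VV d)}

lemma xx_sq {y w : VV d} (hy : ‖y‖ = 1) (hw : ‖w‖ = 1) : xx y w ^ 2 = 1 - ‖inner ℂ y w‖^2 := by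
  have hle := inner_le_one hy hw
  unfold xx; rw [Real.sq_sqrt]; nlinarith [norm_nonneg (inner ℂ y w : ℂ)]

lemma hopf_dist {y w : VV d} (hy : ‖y‖ = 1) (hw : ‖w‖ = 1) :
    ∑ i : Fin (d+1) × Fin (d+1), ‖hopf y i - hopf w i‖^2 = 2 * xx y w ^ 2 := by
  rw [xx_sq hy hw]
  have hy2 : ∑ i, ‖y i‖^2 = 1 := by rw [← EuclideanSpace.norm_sq_eq, hy]; norm_num
  have hw2 : ∑ i, ‖w i‖^2 = 1 := by rw [← EuclideanSpace.norm_sq_eq, hw]; norm_num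
  have hin : (inner ℂ y w : ℂ) = ∑ i, w i * (starRingEnd ℂ) (y i) := by
    simp [PiLp.inner_apply]
  have e1 : ∀ i : Fin (d+1) × Fin (d+1), ‖hopf y i - hopf w i‖^2 = ‖y i.1‖^2 * ‖y i.2‖^2 + ‖w i.1‖^2 * ‖w i.2‖^2 -
      2 * ((w i.1 * (starRingEnd ℂ) (y i.1)) * (starRingEnd ℂ) (w i.2 * (starRingEnd ℂ) (y i.2))).re := by
    intro i
    simp only [hopf, ← Complex.normSq_eq_norm_sq]
    simp [Complex.normSq_apply]
    ring
  have e2 : ∀ a b : Fin (d+1) → ℝ, ∑ i : Fin (d+1) × Fin (d+1), a i.1 * b i.2 = (∑ i, a i) * ∑ i, b i := by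
    intro a b
    rw [Fintype.sum_prod_type, Finset.sum_mul_sum]
  have e3 : ∑ i : Fin (d+1) × Fin (d+1), ((w i.1 * (starRingEnd ℂ) (y i.1)) * (starRingEnd ℂ) (w i.2 * (starRingEnd ℂ) (y i.2))).re = ‖(inner ℂ y w : ℂ)‖^2 := by
    have : ∑ i : Fin (d+1) × Fin (d+1), ((w i.1 * (starRingEnd ℂ) (y i.1)) * (starRingEnd ℂ) (w i.2 * (starRingEnd ℂ) (y i.2))) = (inner ℂ y w : ℂ) * (starRingEnd ℂ) (inner ℂ y w : ℂ) := by
      rw [hin, map_sum, Finset.sum_mul_sum, Fintype.sum_prod_type]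
    rw [← Complex.re_sum, this, Complex.mul_conj, Complex.ofReal_re, Complex.normSq_eq_norm_sq]
  rw [Finset.sum_congr rfl fun i _ => e1 i, Finset.sum_sub_distrib, Finset.sum_add_distrib, ← Finset.mul_sum, e3,
    e2 (fun i => ‖y i‖^2) (fun i => ‖y i‖^2), e2 (fun i => ‖w i‖^2) (fun i => ‖w i‖^2), hy2, hw2]
  ring

lemma hopf_le_xx {y w : VV d} (hy : ‖y‖ = 1) (hw : ‖w‖ = 1) : dist (hopf y) (hopf w) ≤ 2 * xx y w := by
  have hx := xx_nonneg y w
  refine (dist_pi_le_iff (by positivity)).2 fun i => ?_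
  rw [dist_eq_norm]
  refine abs_le_of_sq_le_sq' ?_ (by positivity) |>.2
  have := Finset.single_le_sum (f := fun i => ‖hopf y i - hopf w i‖^2) (fun i _ => by positivity) (Finset.mem_univ i)
  rw [hopf_dist hy hw] at this
  nlinarith

lemma xx_le_hopf {y w : VV d} (hy : ‖y‖ = 1) (hw : ‖w‖ = 1) : xx y w ≤ (d+1) * dist (hopf y) (hopf w) := by
  refine abs_le_of_sq_le_sq' ?_ (by positivity) |>.2
  have h : 2 * xx y w ^ 2 ≤ ∑ i : Fin (d+1) × Fin (d+1), dist (hopf y) (hopf w) ^ 2 := by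
    rw [← hopf_dist hy hw]
    refine Finset.sum_le_sum fun i _ => ?_
    rw [← dist_eq_norm]
    gcongr
    exact dist_le_pi_dist _ _ i
  rw [Finset.sum_const, Finset.card_univ, Fintype.card_prod, Fintype.card_fin] at h
  simp only [nsmul_eq_mul] at h
  push_cast at h
  nlinarith [sq_nonneg (xx y w)]

lemma hopf_lip {y w : VV d} (hy : ‖y‖ = 1) (hw : ‖w‖ = 1) : dist (hopf y) (hopf w) ≤ 2 * dist y w := by
  refine (hopf_le_xx hy hw).trans ?_
  rw [dist_eq_norm y w]
  have := xx_le_dist hy hw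
  linarith

lemma cap (hd : 1 ≤ d) : ∃ A : ℝ, 0 < A ∧ ∀ y : VV d, ‖y‖ = 1 → ∀ r : ℝ, 0 ≤ r →
    sig (d+1) {w | xx y w ≤ r} ≤ ENNReal.ofReal (A * r^(2*d)) := by
  refine ⟨(gC d 0).toReal * 2 + 1, by positivity, ?_⟩
  intro y hy r hr
  obtain ⟨u, hu⟩ := exists_unitary y hy
  have hmeas : ∀ z : VV d, MeasurableSet {w | xx z w ≤ r} := fun z => (isClosed_le (continuous_xx_right z) continuous_const).measurableSet
  set κ : ℝ → ℝ≥0∞ := fun s => ({s : ℝ | Real.sqrt (1 - s^2) ≤ r}).indicator (fun _ => 1) s with hκ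
  have hκs : MeasurableSet {s : ℝ | Real.sqrt (1 - s^2) ≤ r} := (isClosed_le (by fun_prop) continuous_const).measurableSet
  have hκm : Measurable κ := measurable_const.indicator hκs
  have h1 : sig (d+1) {w | xx y w ≤ r} = ∫⁻ w, κ ‖w 0‖ ∂(sig (d+1)) := by
    rw [← sig_map u, Measure.map_apply (measurable_lie u) (hmeas y), sig_map u]
    rw [← lintegral_indicator_one ((hmeas y).preimage (measurable_lie u))]
    refine lintegral_congr fun w => ?_
    simp only [hκ, indicator]
    have e : xx y (u w) = Real.sqrt (1 - ‖w 0‖^2) := by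
      unfold xx
      rw [← hu, LinearIsometryEquiv.inner_map_map, EuclideanSpace.inner_single_left]
      simp
    simp only [mem_preimage, mem_ofPred_eq, e, Pi.one_apply]
  have h2 := lemmaM hd (fun _ => 0) κ hκm
  simp only [mul_zero, pow_zero, ENNReal.ofReal_one, Finset.prod_const_one, mul_one, Finset.sum_const_zero, Nat.factorial_zero, Nat.cast_one, add_zero] at h2
  rw [h1, h2]
  have h3 : ∫⁻ t in Ioo 0 (Real.pi/2), κ (Real.cos t) * ENNReal.ofReal (Real.cos t * Real.sin t ^ (2*d-1)) ≤ ENNReal.ofReal (2 * r^(2*d)) := by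
    calc ∫⁻ t in Ioo 0 (Real.pi/2), κ (Real.cos t) * ENNReal.ofReal (Real.cos t * Real.sin t ^ (2*d-1))
        ≤ ∫⁻ t in Ioo 0 (Real.pi/2), (Icc 0 (2*r)).indicator (fun _ => ENNReal.ofReal (r^(2*d-1))) t := by
          refine setLIntegral_mono (measurable_const.indicator measurableSet_Icc) fun t ht => ?_
          by_cases hk : Real.cos t ∈ {s : ℝ | Real.sqrt (1 - s^2) ≤ r}
          · have hs0 : 0 ≤ Real.sin t := Real.sin_nonneg_of_nonneg_of_le_pi ht.1.le (by linarith [ht.2, Real.pi_pos])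
            have hs : Real.sin t ≤ r := by
              have e : 1 - Real.cos t ^ 2 = Real.sin t ^ 2 := by rw [← Real.sin_sq_add_cos_sq t]; ring
              have hk' : Real.sqrt (1 - Real.cos t^2) ≤ r := hk
              rwa [e, Real.sqrt_sq hs0] at hk'
            have hj := Real.mul_le_sin ht.1.le ht.2.le
            have ht2 : t ≤ 2 * r := by
              have : t = Real.pi/2 * (2/Real.pi * t) := by field_simp
              have h4 : 0 ≤ 2/Real.pi * t := by have := ht.1.le; positivity
              nlinarith [Real.pi_le_four, Real.pi_pos]
            rw [indicator_of_mem (show t ∈ Icc 0 (2*r) from ⟨ht.1.le, ht2⟩)]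
            simp only [hκ]
            rw [indicator_of_mem hk, one_mul]
            refine ENNReal.ofReal_le_ofReal ?_
            have hc0 : 0 ≤ Real.cos t := Real.cos_nonneg_of_mem_Icc ⟨by linarith [ht.1, Real.pi_pos], ht.2.le⟩
            calc Real.cos t * Real.sin t ^ (2*d-1) ≤ 1 * r^(2*d-1) := by
                  gcongr
                  exact Real.cos_le_one t
              _ = _ := one_mul _
          · simp only [hκ]
            rw [indicator_of_notMem hk, zero_mul]; exact zero_le
      _ ≤ ∫⁻ t, (Icc 0 (2*r)).indicator (fun _ => ENNReal.ofReal (r^(2*d-1))) t := setLIntegral_le_lintegral _ _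
      _ = ENNReal.ofReal (2 * r^(2*d)) := by
        rw [lintegral_indicator measurableSet_Icc, lintegral_const, Measure.restrict_apply_univ, Real.volume_Icc, sub_zero,
          ← ENNReal.ofReal_mul (by positivity)]
        congr 1
        rw [show 2*d = (2*d-1)+1 by omega, pow_succ]
        simp; ring
  calc gC d 0 * ∫⁻ t in Ioo 0 (Real.pi/2), κ (Real.cos t) * ENNReal.ofReal (Real.cos t * Real.sin t ^ (2*d-1))
      ≤ gC d 0 * ENNReal.ofReal (2 * r^(2*d)) := mul_le_mul_right h3 _
    _ = ENNReal.ofReal ((gC d 0).toReal * (2 * r^(2*d))) := by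
      rw [ENNReal.ofReal_mul ENNReal.toReal_nonneg, ENNReal.ofReal_toReal (gC_ne_top d 0)]
    _ ≤ _ := by
      refine ENNReal.ofReal_le_ofReal ?_
      have : 0 ≤ r^(2*d) := by positivity
      nlinarith

/-- Measure of balls under the image of the sphere measure. -/
lemma cap_ball (hd : 1 ≤ d) : ∃ A : ℝ, 0 < A ∧ ∀ y : VV d, ‖y‖ = 1 → ∀ r : ℝ, 0 ≤ r →
    (sig (d+1)).map hopf (closedBall (hopf y) r) ≤ ENNReal.ofReal (A * r^(2*d)) := by
  obtain ⟨A, hA, h⟩ := cap hd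
  refine ⟨A * (d+1)^(2*d), by positivity, ?_⟩
  intro y hy r hr
  rw [Measure.map_apply continuous_hopf.measurable measurableSet_closedBall]
  refine le_trans ?_ ((h y hy ((d+1)*r) (by positivity)).trans (by rw [mul_pow, mul_assoc]))
  refine measure_mono_ae ?_
  filter_upwards [sig_ae_norm (n := d+1) (by omega)] with w hw hwb
  have h1 : dist (hopf w) (hopf y) ≤ r := hwb
  have h2 := xx_le_hopf hy hw
  rw [dist_comm] at h2
  exact h2.trans (by gcongr)

end

end

section

section
open ProbabilityTheory
variable {d C : ℕ} {τ : Measure (VV d)} {φ : VV d → ℂ} {m : Kernel (BB d) (VV d)}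

/-- An almost everywhere property on the base pulls back to `τ`. -/
lemma Core.ae_base (H : Core d C τ φ) {P : BB d → Prop} (h : ∀ᵐ b ∂((sig (d+1)).map hopf), P b) : ∀ᵐ y ∂τ, P (hopf y) :=
  ae_of_ae_map continuous_hopf.measurable.aemeasurable (H.AC.ae_le h)

lemma Core.tube (H : Core d C τ φ) : ∀ᵐ y ∂τ, ∃ K : ℝ, ∀ r : ℝ, 0 < r → τ {w | xx y w < r} ≤ ENNReal.ofReal (K * r^(2*d)) := by
  haveI := H.fin
  set sb := (sig (d+1)).map hopf with hsb
  set lam := τ.map hopf with hlam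
  haveI : IsFiniteMeasure lam := Measure.isFiniteMeasure_map τ hopf
  haveI : IsFiniteMeasure sb := Measure.isFiniteMeasure_map _ hopf
  obtain ⟨A, hA, hcap⟩ := cap_ball H.hd
  have h1 := H.ae_base (Besicovitch.ae_tendsto_rnDeriv lam sb)
  have h2 := H.ae_base (Measure.rnDeriv_lt_top lam sb)
  filter_upwards [h1, h2, H.sph] with y hy1 hy2 hy
  have hlt : lam.rnDeriv sb (hopf y) < lam.rnDeriv sb (hopf y) + 1 := ENNReal.lt_add_right hy2.ne one_ne_zero
  have h3 := hy1.eventually (Iio_mem_nhds hlt)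
  rw [eventually_nhdsWithin_iff, Metric.eventually_nhds_iff] at h3
  obtain ⟨r0, hr0, h3⟩ := h3
  set B : ℝ≥0∞ := lam.rnDeriv sb (hopf y) + 1 with hB
  have hBt : B ≠ ⊤ := by simp [hB, hy2.ne]
  have hball : ∀ r, 0 < r → lam (closedBall (hopf y) r) ≤ ENNReal.ofReal ((B.toReal * A + (lam univ).toReal / r0^(2*d)) * r^(2*d)) := by
    intro r hr
    rcases lt_or_ge r r0 with hlt' | hge
    · have h4 := h3 (y := r) (by rw [Real.dist_eq, sub_zero, abs_of_pos hr]; exact hlt') hr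
      have h5 : lam (closedBall (hopf y) r) ≤ B * sb (closedBall (hopf y) r) := by
        rcases eq_or_ne (sb (closedBall (hopf y) r)) 0 with h0 | h0
        · rw [H.AC h0]; exact zero_le
        · exact (ENNReal.div_le_iff_le_mul (Or.inl h0) (Or.inl (measure_ne_top _ _))).1 (le_of_lt h4)
      calc lam (closedBall (hopf y) r) ≤ B * ENNReal.ofReal (A * r^(2*d)) := h5.trans (mul_le_mul_right (hcap y hy r hr.le) _)
        _ = ENNReal.ofReal (B.toReal * (A * r^(2*d))) := by
          rw [ENNReal.ofReal_mul ENNReal.toReal_nonneg, ENNReal.ofReal_toReal hBt]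
        _ ≤ _ := by
          refine ENNReal.ofReal_le_ofReal ?_
          have : 0 ≤ (lam univ).toReal / r0^(2*d) * r^(2*d) := by positivity
          nlinarith
    · calc lam (closedBall (hopf y) r) ≤ lam univ := measure_mono (subset_univ _)
        _ = ENNReal.ofReal ((lam univ).toReal) := (ENNReal.ofReal_toReal (measure_ne_top _ _)).symm
        _ ≤ _ := by
          refine ENNReal.ofReal_le_ofReal ?_
          have h6 : (lam univ).toReal ≤ (lam univ).toReal / r0^(2*d) * r^(2*d) := by
            rw [div_mul_eq_mul_div, le_div_iff₀ (by positivity)]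
            gcongr
          have : 0 ≤ B.toReal * A * r^(2*d) := by positivity
          nlinarith
  refine ⟨(B.toReal * A + (lam univ).toReal / r0^(2*d)) * 2^(2*d), fun r hr => ?_⟩
  have h7 := hball (2*r) (by positivity)
  rw [mul_pow, ← mul_assoc] at h7
  refine le_trans ?_ h7
  rw [hlam, Measure.map_apply continuous_hopf.measurable measurableSet_closedBall]
  refine measure_mono_ae ?_
  filter_upwards [H.sph] with w hw hwx
  have h8 : xx y w < r := hwx
  have h9 := hopf_le_xx hy hw
  rw [dist_comm] at h9
  change dist (hopf w) (hopf y) ≤ 2 * r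
  linarith

end

end

section

section
open ProbabilityTheory
variable {d C : ℕ} {τ : Measure (VV d)} {φ : VV d → ℂ} {m : Kernel (BB d) (VV d)}

/-- Coverings extracted from finiteness of the Hausdorff measure. -/
lemma haus_cover {X : Type*} [MetricSpace X] [MeasurableSpace X] [BorelSpace X] {s : ℝ} {E : Set X} (h : μH[s] E < ⊤)
    (r : ℝ≥0∞) (hr : 0 < r) : ∃ t : ℕ → Set X, E ⊆ ⋃ n, t n ∧ (∀ n, ediam (t n) ≤ r) ∧
      ∑' n, ⨆ _ : (t n).Nonempty, ediam (t n) ^ s ≤ μH[s] E + 1 := by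
  have h1 : (⨅ (t : ℕ → Set X) (_ : E ⊆ ⋃ n, t n) (_ : ∀ n, ediam (t n) ≤ r),
          ∑' n, ⨆ _ : (t n).Nonempty, ediam (t n) ^ s) ≤ μH[s] E := by
    rw [Measure.hausdorffMeasure_apply]
    exact le_iSup₂ (f := fun (r : ℝ≥0∞) (_ : 0 < r) => ⨅ (t : ℕ → Set X) (_ : E ⊆ ⋃ n, t n) (_ : ∀ n, ediam (t n) ≤ r),
          ∑' n, ⨆ _ : (t n).Nonempty, ediam (t n) ^ s) r hr
  have h2 := h1.trans_lt (ENNReal.lt_add_right h.ne one_ne_zero)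
  simp only [iInf_lt_iff] at h2
  obtain ⟨t, ht1, ht2, ht3⟩ := h2
  exact ⟨t, ht1, ht2, ht3.le⟩

lemma slice (hd : 1 ≤ d) {E : Set (VV d)} (hE : ∀ z ∈ E, ‖z‖ = 1) (hfin : μH[((2*d : ℕ) : ℝ)] E < ⊤) :
    ∀ᵐ b ∂((sig (d+1)).map hopf), {z | z ∈ E ∧ hopf z = b}.Finite := by
  set sb := (sig (d+1)).map hopf with hsb
  obtain ⟨A, hA, hcap⟩ := cap_ball hd
  set rk : ℕ → ℝ≥0∞ := fun k => (((k+1 : ℕ) : ℝ≥0∞))⁻¹ with hrk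
  have hrk0 : ∀ k, 0 < rk k := fun k => ENNReal.inv_pos.2 (ENNReal.natCast_ne_top _)
  have hrkt : ∀ k, rk k ≠ ⊤ := fun k => ENNReal.inv_ne_top.2 (by exact_mod_cast (Nat.succ_ne_zero k))
  have hrkl : Filter.Tendsto rk Filter.atTop (nhds 0) :=
    ENNReal.tendsto_inv_nat_nhds_zero.comp (Filter.tendsto_add_atTop_nat 1)
  choose U hU1 hU2 hU3 using fun k => haus_cover hfin (rk k) (hrk0 k)
  classical
  set T : ℕ → ℕ → Set (BB d) := fun k i => if h : (U k i ∩ E).Nonempty then closedBall (hopf h.some) (2 * diam (U k i)) else ∅ with hT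
  have hTm : ∀ k i, MeasurableSet (T k i) := by
    intro k i; simp only [hT]; split_ifs
    · exact measurableSet_closedBall
    · exact MeasurableSet.empty
  have hUt : ∀ k i, ediam (U k i) ≠ ⊤ := fun k i => ne_top_of_le_ne_top (hrkt k) (hU2 k i)
  have hTb : ∀ k i, sb (T k i) ≤ ENNReal.ofReal (A * 2^(2*d)) * ⨆ _ : (U k i).Nonempty, ediam (U k i) ^ ((2*d : ℕ) : ℝ) := by
    intro k i; simp only [hT]; split_ifs with h
    · have hne : (U k i).Nonempty := h.mono inter_subset_left
      rw [iSup_pos hne, ENNReal.rpow_natCast]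
      refine (hcap _ (hE _ h.some_mem.2) _ (by positivity)).trans ?_
      rw [mul_pow, ← mul_assoc, ENNReal.ofReal_mul (by positivity), ENNReal.ofReal_pow diam_nonneg, diam, ENNReal.ofReal_toReal (hUt k i)]
    · simp
  have hmem : ∀ k i z, z ∈ U k i → z ∈ E → hopf z ∈ T k i := by
    intro k i z hz hzE
    have h : (U k i ∩ E).Nonempty := ⟨z, hz, hzE⟩
    simp only [hT]
    rw [dif_pos h, mem_closedBall]
    refine (hopf_lip (hE z hzE) (hE _ h.some_mem.2)).trans ?_
    gcongr
    exact dist_le_diam_of_mem' (hUt k i) hz h.some_mem.1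
  set G : ℕ → BB d → ℝ≥0∞ := fun k b => ∑' i, (T k i).indicator (fun _ => 1) b with hG
  have hGm : ∀ k, Measurable (G k) := fun k => Measurable.tsum fun i => measurable_const.indicator (hTm k i)
  have hGi : ∀ k, ∫⁻ b, G k b ∂sb ≤ ENNReal.ofReal (A * 2^(2*d)) * (μH[((2*d : ℕ) : ℝ)] E + 1) := by
    intro k
    simp only [hG]
    rw [lintegral_tsum fun i => (measurable_const.indicator (hTm k i)).aemeasurable]
    calc ∑' i, ∫⁻ b, (T k i).indicator (fun _ => 1) b ∂sb
        ≤ ∑' i, ENNReal.ofReal (A * 2^(2*d)) * ⨆ _ : (U k i).Nonempty, ediam (U k i) ^ ((2*d : ℕ) : ℝ) := by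
          refine ENNReal.tsum_le_tsum fun i => ?_
          rw [lintegral_indicator (hTm k i), lintegral_one, Measure.restrict_apply_univ]
          exact hTb k i
      _ ≤ _ := by rw [ENNReal.tsum_mul_left]; exact mul_le_mul_right (hU3 k) _
  have hF : ∫⁻ b, Filter.liminf (fun k => G k b) Filter.atTop ∂sb ≠ ⊤ := by
    refine ne_top_of_le_ne_top ?_ ((lintegral_liminf_le hGm).trans (Filter.liminf_le_of_le (by isBoundedDefault) (a := ENNReal.ofReal (A * 2^(2*d)) * (μH[((2*d : ℕ) : ℝ)] E + 1)) ?_))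
    · exact ENNReal.mul_ne_top ENNReal.ofReal_ne_top (ENNReal.add_ne_top.2 ⟨hfin.ne, ENNReal.one_ne_top⟩)
    · intro b hb
      obtain ⟨k, hk⟩ := hb.exists
      exact hk.trans (hGi k)
  filter_upwards [ae_lt_top (Measurable.liminf hGm) hF] with b hb
  by_contra hinf
  have hinf : {z | z ∈ E ∧ hopf z = b}.Infinite := hinf
  have hbig : ∀ M : ℕ, (M : ℝ≥0∞) ≤ Filter.liminf (fun k => G k b) Filter.atTop := by
    intro M
    obtain ⟨F, hFs, hFc⟩ := hinf.exists_subset_card_eq M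
    refine Filter.le_liminf_of_le (by isBoundedDefault) ?_
    have hev : ∀ᶠ k in Filter.atTop, ∀ z ∈ F, ∀ w ∈ F, z ≠ w → rk k < edist z w := by
      rw [Filter.eventually_all_finset]
      intro z _
      rw [Filter.eventually_all_finset]
      intro w _
      by_cases hzw : z = w
      · exact Filter.Eventually.of_forall fun k h => absurd hzw h
      · filter_upwards [hrkl.eventually (gt_mem_nhds (edist_pos.2 hzw))] with k hk _ using hk
    filter_upwards [hev] with k hk
    have hch : ∀ z : VV d, ∃ i, z ∈ F → z ∈ U k i := by
      intro z
      by_cases hz : z ∈ F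
      · obtain ⟨i, hi⟩ := mem_iUnion.1 (hU1 k (hFs hz).1)
        exact ⟨i, fun _ => hi⟩
      · exact ⟨0, fun h => absurd h hz⟩
    choose ix hix using hch
    have hinj : Set.InjOn ix F := by
      intro z hz w hw hzw
      by_contra hne
      have h1 := hk z hz w hw hne
      have h2 := edist_le_ediam_of_mem (hix z hz) (hzw ▸ hix w hw)
      exact absurd (h2.trans (hU2 k _)) (not_le.2 h1)
    calc (M : ℝ≥0∞) = ∑ i ∈ F.image ix, 1 := by
          rw [Finset.sum_const, Finset.card_image_of_injOn hinj, hFc]; simp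
      _ ≤ ∑ i ∈ F.image ix, (T k i).indicator (fun _ => 1) b := by
          refine Finset.sum_le_sum fun i hi => ?_
          obtain ⟨z, hz, rfl⟩ := Finset.mem_image.1 hi
          have hz' := hFs hz
          have : b ∈ T k (ix z) := by
            rw [← hz'.2]; exact hmem k _ z (hix z hz) hz'.1
          rw [indicator_of_mem this]
      _ ≤ G k b := ENNReal.sum_le_tsum _
  obtain ⟨M, hM⟩ := ENNReal.exists_nat_gt hb.ne
  exact absurd (hbig M) (not_le.2 hM)

lemma measurable_atom (D : Dis d τ m) : Measurable (fun x : BB d × VV d => m x.1 {x.2}) := by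
  haveI := D.sf
  have ht : MeasurableSet {x : (BB d × VV d) × VV d | x.2 = x.1.2} :=
    (isClosed_eq continuous_snd (continuous_snd.comp continuous_fst)).measurableSet
  set k : Kernel (BB d × VV d) (VV d) := m.comap Prod.fst measurable_fst with hk
  have := Kernel.measurable_kernel_prodMk_left (κ := k) ht
  have e : (fun x : BB d × VV d => m x.1 {x.2}) = fun a => k a (Prod.mk a ⁻¹' {x : (BB d × VV d) × VV d | x.2 = x.1.2}) := by
    funext x
    rw [hk, Kernel.comap_apply]
    rfl
  rw [e]; exact this

lemma Core.atoms (H : Core d C τ φ) (D : Dis d τ m) {E : Set (VV d)} (hEm : MeasurableSet E) (hE : ∀ z ∈ E, ‖z‖ = 1)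
    (hfin : μH[((2*d : ℕ) : ℝ)] E < ⊤) : ∀ᵐ y ∂τ, y ∈ E → m (hopf y) {y} ≠ 0 := by
  have hZ : MeasurableSet {x : BB d × VV d | x.2 ∈ E ∧ m x.1 {x.2} = 0} :=
    (hEm.preimage measurable_snd).inter ((measurable_atom D) (measurableSet_singleton 0))
  set Z := {x : BB d × VV d | x.2 ∈ E ∧ m x.1 {x.2} = 0} with hZd
  have hF : Measurable (Z.indicator (fun _ => (1:ℝ≥0∞))) := measurable_const.indicator hZ
  have h1 := D.lint hF
  have h2 : ∫⁻ y, ∫⁻ z, Z.indicator (fun _ => (1:ℝ≥0∞)) (hopf y, z) ∂(m (hopf y)) ∂(sig (d+1)) = 0 := by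
    have : ∀ᵐ y ∂(sig (d+1)), ∫⁻ z, Z.indicator (fun _ => (1:ℝ≥0∞)) (hopf y, z) ∂(m (hopf y)) = 0 := by
      filter_upwards [ae_of_ae_map continuous_hopf.measurable.aemeasurable (slice H.hd hE hfin)] with y hy
      have hnull : m (hopf y) {z | (z ∈ E ∧ hopf z = hopf y) ∧ m (hopf y) {z} = 0} = 0 := by
        have hfi : {z | (z ∈ E ∧ hopf z = hopf y) ∧ m (hopf y) {z} = 0}.Finite := hy.subset fun z hz => hz.1
        rw [← biUnion_of_singleton {z | (z ∈ E ∧ hopf z = hopf y) ∧ m (hopf y) {z} = 0}]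
        refine (measure_biUnion_null_iff hfi.countable).2 fun z hz => hz.2
      have hae : ∀ᵐ z ∂(m (hopf y)), Z.indicator (fun _ => (1:ℝ≥0∞)) (hopf y, z) = 0 := by
        have h3 : ∀ᵐ z ∂(m (hopf y)), ¬ ((z ∈ E ∧ hopf z = hopf y) ∧ m (hopf y) {z} = 0) := by
          rw [ae_iff]; simpa only [not_not] using hnull
        filter_upwards [h3, D.conc (hopf y)] with z hz hz2
        refine indicator_of_notMem ?_ _
        intro hmem
        exact hz ⟨⟨hmem.1, hz2.1⟩, hmem.2⟩
      rw [lintegral_congr_ae hae, lintegral_zero]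
    rw [lintegral_congr_ae this, lintegral_zero]
  have hF2 : Measurable (fun z : VV d => Z.indicator (fun _ => (1:ℝ≥0∞)) (hopf z, z)) := hF.comp (measurable_hg d)
  rw [h1, lintegral_eq_zero_iff hF2] at h2
  filter_upwards [h2] with y hy hyE h0
  have hm : (hopf y, y) ∈ Z := ⟨hyE, h0⟩
  simp only [Pi.zero_apply] at hy
  rw [indicator_of_mem hm] at hy
  exact one_ne_zero hy

end

end

section

section
open ProbabilityTheory
variable {d C : ℕ} {τ : Measure (VV d)} {φ : VV d → ℂ} {m : Kernel (BB d) (VV d)}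

lemma near_small (ρ : Measure (VV d)) [IsFiniteMeasure ρ] (y : VV d) {e : ℝ} (he : 0 < e) :
    ∃ L : ℕ, ρ.real (ball y (1/((L+1:ℕ):ℝ)) \ {y}) ≤ e := by
  have hanti : Antitone (fun L : ℕ => ball y (1/((L+1:ℕ):ℝ)) \ {y}) := by
    intro a b hab
    refine diff_subset_diff_left (ball_subset_ball ?_)
    push_cast
    gcongr
  have hintg : ⋂ L : ℕ, (ball y (1/((L+1:ℕ):ℝ)) \ {y}) = ∅ := by
    ext z
    simp only [mem_iInter, mem_empty_iff_false, iff_false, not_forall]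
    by_cases hz : z = y
    · exact ⟨0, fun h => h.2 hz⟩
    · obtain ⟨L, hL⟩ := exists_nat_one_div_lt (dist_pos.2 hz)
      refine ⟨L, fun h => ?_⟩
      have := mem_ball.1 h.1
      push_cast at this
      linarith
  have ht := tendsto_measure_iInter_atTop (μ := ρ) (s := fun L : ℕ => ball y (1/((L+1:ℕ):ℝ)) \ {y})
    (fun L => (measurableSet_ball.diff (measurableSet_singleton y)).nullMeasurableSet) hanti ⟨0, measure_ne_top _ _⟩
  rw [hintg, measure_empty] at ht
  obtain ⟨L, hL⟩ := (ht.eventually (gt_mem_nhds (ENNReal.ofReal_pos.2 he))).exists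
  refine ⟨L, ?_⟩
  exact ENNReal.toReal_le_of_le_ofReal he.le hL.le

theorem core_main (H : Core d C τ φ) {E : Set (VV d)} (hEm : MeasurableSet E) (hE : ∀ z ∈ E, ‖z‖ = 1)
    (hfin : μH[((2*d : ℕ) : ℝ)] E < ⊤) :
    ∃ g : ℕ → (EuclideanSpace ℝ (Fin (2*d)) → VV d), (∀ i, ∃ K : ℝ≥0, LipschitzWith K (g i)) ∧
      ∀ᵐ y ∂τ, y ∈ E → y ∈ ⋃ i, range (g i) := by
  obtain ⟨m, D⟩ := H.exists_dis
  obtain ⟨g, hg, hcov⟩ := cover H D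
  refine ⟨g, hg, ?_⟩
  filter_upwards [H.sph, H.phases D, H.tube, H.atoms D hEm hE hfin] with y h1 h2 h3 h4 hyE
  apply hcov
  obtain ⟨K1, hK1⟩ := h3
  haveI := D.fin (hopf y)
  have ha : 0 < (m (hopf y)).real {y} := ENNReal.toReal_pos (h4 hyE) (measure_ne_top _ _)
  obtain ⟨K, hK⟩ := exists_nat_gt (max K1 (max ((m (hopf y)).real univ) (1 / (m (hopf y)).real {y})))
  have a1 : K1 < K := lt_of_le_of_lt (le_max_left _ _) hK
  have a2 : (m (hopf y)).real univ < K := lt_of_le_of_lt ((le_max_left _ _).trans (le_max_right _ _)) hK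
  have a3 : 1 / (m (hopf y)).real {y} < K := lt_of_le_of_lt ((le_max_right _ _).trans (le_max_right _ _)) hK
  obtain ⟨L, hL⟩ := near_small (m (hopf y)) y (e := 1 / (8 * ((K+1:ℕ):ℝ))) (by positivity)
  refine ⟨K, L, h1, h2, ?_, ?_, ?_, hL⟩
  · push_cast; linarith
  · intro r hr
    refine (hK1 r hr).trans (ENNReal.ofReal_le_ofReal ?_)
    gcongr
    push_cast; linarith
  · rw [div_le_iff₀ (by positivity)]
    rw [div_lt_iff₀ ha] at a3
    push_cast
    nlinarith

end

end

lemma kappa_const (ε : ℝ) (hε0 : 0 < ε) (hε1 : ε < 1) (F : Finset (ℕ × ℕ)) :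
    ∃ C : ℕ, ∀ N p q : ℕ, p < q + N → q < p + N → C * N < p + q →
      (p, q) ∉ F ∧ memKappa ε p q := by
  set M := F.sup (fun x => x.1 + x.2) with hM
  set K := ⌈2/ε⌉₊ with hK
  have hKε : 2/ε ≤ (K:ℝ) := Nat.le_ceil _
  have hKε' : 2 ≤ K * ε := by rwa [div_le_iff₀ hε0] at hKε
  refine ⟨M + K + 1, fun N p q h1 h2 h3 => ?_⟩
  have hN : 1 ≤ N := by omega
  constructor
  · intro hF
    have h4 : p + q ≤ M := Finset.le_sup (f := fun x : ℕ × ℕ => x.1 + x.2) hF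
    have h5 : M * 1 ≤ M * N := Nat.mul_le_mul_left _ hN
    have h6 : (M + K + 1) * N = M * N + K * N + N := by ring
    omega
  · have h6 : (M + K + 1) * N = M * N + K * N + N := by ring
    have h7 : K * N + N < p + q := by
      have : 0 ≤ M * N := Nat.zero_le _
      omega
    have hp2 : K * N < 2 * p := by omega
    have hq2 : K * N < 2 * q := by omega
    have hp0 : 0 < p := by omega
    have hq0 : 0 < q := by omega
    have hp0' : (0:ℝ) < p := by exact_mod_cast hp0
    have hq0' : (0:ℝ) < q := by exact_mod_cast hq0
    have hp2' : (K:ℝ) * N < 2 * p := by exact_mod_cast hp2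
    have hq2' : (K:ℝ) * N < 2 * q := by exact_mod_cast hq2
    have h1' : (p:ℝ) < q + N := by exact_mod_cast h1
    have h2' : (q:ℝ) < p + N := by exact_mod_cast h2
    have hN' : (0:ℝ) ≤ N := Nat.cast_nonneg _
    have a1 : 2 * (N:ℝ) ≤ K * ε * N := mul_le_mul_of_nonneg_right hKε' hN'
    have a2 : ε * ((K:ℝ) * N) < ε * (2 * p) := mul_lt_mul_of_pos_left hp2' hε0
    have a3 : ε * ((K:ℝ) * N) < ε * (2 * q) := mul_lt_mul_of_pos_left hq2' hε0
    refine ⟨hp0, hq0, ?_, ?_⟩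
    · rw [lt_div_iff₀ hp0']; nlinarith
    · rw [div_lt_div_iff₀ hp0' (by linarith)]; nlinarith

/-- a finite complex measure `μ = f·ν` on `S^{2n−1}` whose spectrum meets
`κ(ε)` in a finite set has `(2n−2)`-rectifiable singular sets: every Borel `E` with
`H^{2n−2}(E) < ∞` and `μ(E) ≠ 0` contains a `(2n−2)`-rectifiable `E_r ⊆ E` with
`|μ|(E ∖ E_r) = 0`. -/
theorem stmt9 {n : ℕ} (hn : 2 ≤ n)
    (ν : Measure (EuclideanSpace ℂ (Fin n))) [IsFiniteMeasure ν]
    (hsupp : ν (unitSphere n)ᶜ = 0)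
    (f : EuclideanSpace ℂ (Fin n) → ℂ) (hf : Integrable f ν)
    (ε : ℝ) (hε0 : 0 < ε) (hε1 : ε < 1) (F : Finset (ℕ × ℕ))
    (hspec : ∀ p q : ℕ, (p, q) ∉ F → memKappa ε p q → projPQZero ν f p q)
    (E : Set (EuclideanSpace ℂ (Fin n))) (hEs : E ⊆ unitSphere n)
    (hE : MeasurableSet E) (hfin : μH[2 * (n : ℝ) - 2] E < ⊤)
    (hne : ∫ x in E, f x ∂ν ≠ 0) :
    ∃ Er ⊆ E, RectifiableSetC n (2 * n - 2) Er ∧ ∫ x in E \ Er, ‖f x‖ ∂ν = 0 := by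
  obtain ⟨d, rfl⟩ : ∃ d, n = d + 1 := ⟨n - 1, by omega⟩
  obtain ⟨f', hf'm, hff'⟩ : ∃ f' : EuclideanSpace ℂ (Fin (d+1)) → ℂ, Measurable f' ∧ f =ᵐ[ν] f' :=
    ⟨hf.1.mk f, hf.1.stronglyMeasurable_mk.measurable, hf.1.ae_eq_mk⟩
  have hf'i : Integrable f' ν := hf.congr hff'
  obtain ⟨C, hC⟩ := kappa_const ε hε0 hε1 F
  set φ : EuclideanSpace ℂ (Fin (d+1)) → ℂ := fun z => if f' z = 0 then 1 else f' z / (‖f' z‖ : ℂ) with hφ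
  have hφm : Measurable φ := by
    refine Measurable.ite (hf'm (measurableSet_singleton 0)) measurable_const ?_
    exact hf'm.div (Complex.measurable_ofReal.comp hf'm.norm)
  have hem : Measurable (fun z => ‖f' z‖ₑ) := hf'm.enorm
  have hcore : Core d C (ν.withDensity (fun z => ‖f' z‖ₑ)) φ := by
    refine ⟨by omega, ?_, ?_, hφm, ?_, ?_⟩
    · exact isFiniteMeasure_withDensity hf'i.2.ne
    · have h1 : ∀ᵐ w ∂ν, ‖w‖ = 1 := by
        rw [ae_iff]
        convert hsupp using 2
        ext z
        simp [unitSphere]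
      exact (withDensity_absolutelyContinuous ν _).ae_le h1
    · intro w
      simp only [hφ]
      split_ifs with h
      · simp
      · have : ‖f' w‖ ≠ 0 := norm_ne_zero_iff.2 h
        rw [norm_div, Complex.norm_real, norm_norm, div_self this]
    · intro N p q h hh h1 h2 h3
      obtain ⟨hF, hk⟩ := hC N p q h1 h2 h3
      rw [integral_withDensity_eq_integral_toReal_smul hem (by simp)]
      rw [← hspec p q hF hk (ev h) hh.memHpq]
      apply integral_congr_ae
      filter_upwards [hff'] with z hz
      rw [hz]
      simp only [hφ, toReal_enorm, Complex.real_smul]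
      split_ifs with h0
      · simp [h0]
      · have : (‖f' z‖ : ℂ) ≠ 0 := by exact_mod_cast norm_ne_zero_iff.2 h0
        field_simp
  have hfin' : μH[((2*d : ℕ) : ℝ)] E < ⊤ := by
    have e : ((2*d : ℕ) : ℝ) = 2 * ((d+1 : ℕ) : ℝ) - 2 := by push_cast; ring
    rw [e]; exact hfin
  obtain ⟨g, hg, hae⟩ := core_main hcore hE (fun z hz => by simpa [unitSphere] using hEs hz) hfin'
  rw [ae_withDensity_iff hem] at hae
  refine ⟨E ∩ ⋃ i, range (g i), inter_subset_left, ⟨g, hg, ?_⟩, ?_⟩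
  · have : (E ∩ ⋃ i, range (g i)) \ ⋃ i, range (g i) = ∅ := by
      ext x; simp
    rw [this]; simp
  · apply integral_eq_zero_of_ae
    have h0 : ∀ᵐ x ∂(ν.restrict (E \ (E ∩ ⋃ i, range (g i)))), f' x = 0 := by
      have hms : MeasurableSet {x | f' x = 0} := hf'm (measurableSet_singleton 0)
      rw [ae_restrict_iff hms]
      filter_upwards [hae] with x hx hxE
      by_contra hne0
      exact hxE.2 ⟨hxE.1, hx (by simpa using hne0) hxE.1⟩
    filter_upwards [h0, ae_restrict_of_ae hff'] with x hx hx'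
    simp [hx', hx]
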